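/- Let $G$ be a polycyclic group and let $P$ be a projective $\mathbb{Z}G$-module that is not finitely generated. Then $P$ is a free $\mathbb{Z}G$-module. -/

import Mathlib

open TensorProduct

/-- A group is polycyclic if it has a subnormal series with cyclic factors. -/
def IsPolycyclic (G : Type*) [Group G] : Prop :=
  ∃ (n : ℕ) (s : Fin (n + 1) → Subgroup G),
    s 0 = ⊥ ∧ s (Fin.last n) = ⊤ ∧
    ∀ i : Fin n, s i.castSucc ≤ s i.succ ∧
      ∃ _ : ((s i.castSucc).subgroupOf (s i.succ)).Normal,
        IsCyclic ((s i.succ) ⧸ (s i.castSucc).subgroupOf (s i.succ))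

/-- A group is polycyclic-by-finite if it has a normal polycyclic subgroup of
finite index. -/
def IsPolycyclicByFinite (G : Type*) [Group G] : Prop :=
  ∃ N : Subgroup G, N.Normal ∧ N.FiniteIndex ∧ IsPolycyclic N

section

section Swindle
variable {R : Type*} [Ring R]

theorem LinearMap.exists_equiv_prod_ker {M N : Type*} [AddCommGroup M] [Module R M]
    [AddCommGroup N] [Module R N] [Module.Projective R N] (g : M →ₗ[R] N)
    (hg : Function.Surjective g) : Nonempty (M ≃ₗ[R] N × LinearMap.ker g) := by
  obtain ⟨s, hs⟩ := g.exists_rightInverse_of_surjective (LinearMap.range_eq_top.2 hg)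
  have hs' : ∀ y, g (s y) = y := fun y => LinearMap.congr_fun hs y
  refine ⟨LinearEquiv.ofBijective
    (g.prod ((LinearMap.id - s ∘ₗ g).codRestrict (LinearMap.ker g) fun x => by simp [hs'])) ⟨?_, ?_⟩⟩
  · rw [injective_iff_map_eq_zero]
    intro x hx
    have h1 : g x = 0 := congrArg Prod.fst hx
    have h2 : x - s (g x) = 0 := congrArg Subtype.val (congrArg Prod.snd hx)
    simpa [h1] using h2
  · rintro ⟨y, z, hz⟩
    refine ⟨s y + z, ?_⟩
    have hz' : g z = 0 := hz
    ext <;> simp [hs', hz']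

/-- Finitely supported functions into a product split as a product. -/
noncomputable def Finsupp.natProdLEquiv (A B : Type*) [AddCommMonoid A] [Module R A] [AddCommMonoid B]
    [Module R B] : (ℕ →₀ A × B) ≃ₗ[R] (ℕ →₀ A) × (ℕ →₀ B) :=
  LinearEquiv.ofLinearMap
    ((Finsupp.mapRange.linearMap (LinearMap.fst R A B)).prod
      (Finsupp.mapRange.linearMap (LinearMap.snd R A B)))
    ((Finsupp.mapRange.linearMap (LinearMap.inl R A B)).coprod
      (Finsupp.mapRange.linearMap (LinearMap.inr R A B)))
    (by
      apply LinearMap.ext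
      rintro ⟨a, b⟩
      apply Prod.ext <;> ext <;> simp)
    (by
      apply LinearMap.ext
      intro a
      ext <;> simp)

/-- Absorbing one extra copy into countably many copies. -/
noncomputable def Finsupp.natSuccLEquiv (A : Type*) [AddCommMonoid A] [Module R A] :
    (A × (ℕ →₀ A)) ≃ₗ[R] (ℕ →₀ A) :=
  ((Finsupp.uniqueLinearEquiv R A ()).symm.prodCongr (LinearEquiv.refl R _)).trans <|
    (Finsupp.sumFinsuppLEquivProdFinsupp R).symm.trans <|
      Finsupp.domLCongr ((Equiv.sumComm Unit ℕ).trans Equiv.natSumPUnitEquivNat)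

theorem Module.Free.of_equiv_prod {P P' Q I : Type*} [AddCommMonoid P] [Module R P]
    [AddCommMonoid P'] [Module R P'] [AddCommMonoid Q] [Module R Q] [Infinite I]
    (e : P ≃ₗ[R] (I →₀ R) × P') (e' : (I →₀ R) ≃ₗ[R] P' × Q) : Module.Free R P := by
  obtain ⟨n⟩ : Nonempty (I ≃ ℕ × I) := by
    rw [← Cardinal.lift_mk_eq']
    simp [Cardinal.mk_prod]
  let F : (I →₀ R) ≃ₗ[R] (ℕ →₀ P') × (ℕ →₀ Q) :=
    (Finsupp.domLCongr n).trans <| (Finsupp.curryLinearEquiv R).trans <|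
      (Finsupp.mapRange.linearEquiv e').trans (Finsupp.natProdLEquiv P' Q)
  let E : P ≃ₗ[R] (I →₀ R) :=
    e.trans <| (F.prodCongr (LinearEquiv.refl R P')).trans <|
      (LinearEquiv.prodComm R _ _).trans <| (LinearEquiv.prodAssoc R _ _ _).symm.trans <|
      ((Finsupp.natSuccLEquiv P').prodCongr (LinearEquiv.refl R _)).trans F.symm
  exact Module.Free.of_equiv E.symm

theorem Module.Free.of_surjective_finsupp {P I : Type*} [AddCommGroup P] [Module R P]
    [Module.Projective R P] [Infinite I] (g : (I →₀ R) →ₗ[R] P) (hg : Function.Surjective g)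
    (f : P →ₗ[R] (I →₀ R)) (hf : Function.Surjective f) : Module.Free R P := by
  obtain ⟨e⟩ := f.exists_equiv_prod_ker hf
  let p : P →ₗ[R] LinearMap.ker f := LinearMap.snd R (I →₀ R) _ ∘ₗ e.toLinearMap
  have hp : Function.Surjective p := fun y => ⟨e.symm (0, y), by simp [p]⟩
  obtain ⟨s, hs⟩ : ∃ s : LinearMap.ker f →ₗ[R] P, p ∘ₗ s = LinearMap.id :=
    ⟨e.symm.toLinearMap ∘ₗ LinearMap.inr R (I →₀ R) _, by ext; simp [p]⟩
  have : Module.Projective R (LinearMap.ker f) := Module.Projective.of_split s p hs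
  obtain ⟨e'⟩ := (p ∘ₗ g).exists_equiv_prod_ker (hp.comp hg)
  exact Module.Free.of_equiv_prod e e'

end Swindle

end

section

section Coordinates
variable {R P I : Type*} [Ring R] [AddCommGroup P] [Module R P]

/-- A submodule of an algebra that is closed under multiplication on both sides. -/
def Submodule.IsBi {A R : Type*} [CommRing A] [Ring R] [Algebra A R] (T : Submodule A R) : Prop :=
  ∀ r, ∀ x ∈ T, r * x ∈ T ∧ x * r ∈ T

/-- A sequence of two-sided ideals, each of which is contained in its product with the
previous one. -/
structure IsDescent {A R : Type*} [CommRing A] [Ring R] [Algebra A R] (T : ℕ → Submodule A R) :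
    Prop where
  isBi : ∀ k, (T k).IsBi
  le_mul : ∀ k, T (k + 1) ≤ T k * T (k + 1)

/-- The two-sided ideal generated by the coordinates outside `S`. -/
def coordIdeal (A : Type*) [CommRing A] [Algebra A R] (σ : P →ₗ[R] (I →₀ R)) (S : Set I) :
    Submodule A R :=
  Submodule.span A {y | ∃ x j r, j ∉ S ∧ y = σ x j * r}

/-- The right ideal generated by the coordinates of `x` outside `S`. -/
def coordRight (σ : P →ₗ[R] (I →₀ R)) (S : Set I) (x : P) : Submodule Rᵐᵒᵖ R :=
  Submodule.span Rᵐᵒᵖ (σ x '' Sᶜ)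

theorem coordIdeal_isBi (A : Type*) [CommRing A] [Algebra A R] (σ : P →ₗ[R] (I →₀ R))
    (S : Set I) : (coordIdeal A σ S).IsBi := by
  intro r x hx
  induction hx using Submodule.span_induction with
  | mem y hy =>
    obtain ⟨x, j, s, hj, rfl⟩ := hy
    exact ⟨Submodule.subset_span ⟨r • x, j, s, hj, by simp [mul_assoc]⟩,
      Submodule.subset_span ⟨x, j, s * r, hj, by simp [mul_assoc]⟩⟩
  | zero => simp
  | add x y _ _ hx hy =>
    rw [mul_add, add_mul]
    exact ⟨add_mem hx.1 hy.1, add_mem hx.2 hy.2⟩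
  | smul a x _ hx =>
    rw [mul_smul_comm, smul_mul_assoc]
    exact ⟨Submodule.smul_mem _ _ hx.1, Submodule.smul_mem _ _ hx.2⟩

theorem coordIdeal_le_mul (A : Type*) [CommRing A] [Algebra A R] {σ : P →ₗ[R] (I →₀ R)}
    {e : I → P} (hσ : ∀ x, Finsupp.linearCombination R e (σ x) = x) {S S' : Set I}
    (hS : ∀ i ∈ S, ∀ j ∉ S', σ (e i) j = 0) :
    coordIdeal A σ S' ≤ coordIdeal A σ S * coordIdeal A σ S' := by
  refine Submodule.span_le.2 ?_
  rintro _ ⟨x, j, r, hj, rfl⟩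
  have hx : σ x j = ∑ i ∈ (σ x).support, σ x i * σ (e i) j := by
    conv_lhs => rw [← hσ x, Finsupp.linearCombination_apply, Finsupp.sum, map_sum]
    simp [Finset.sum_apply']
  rw [hx, Finset.sum_mul]
  refine Submodule.sum_mem _ fun i _ => ?_
  by_cases hi : i ∈ S
  · simp [hS i hi j hj]
  · rw [mul_assoc]
    exact Submodule.mul_mem_mul (Submodule.subset_span ⟨x, i, 1, hi, by simp⟩)
      (Submodule.subset_span ⟨e i, j, r, hj, rfl⟩)

theorem coord_mem_coordRight (σ : P →ₗ[R] (I →₀ R)) {S : Set I} {j : I} (hj : j ∉ S) (x : P) :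
    σ x j ∈ coordRight σ S x := Submodule.subset_span ⟨j, hj, rfl⟩

theorem exists_coordRight_eq_top (A : Type*) [CommRing A] [Algebra A R] [IsNoetherianRing R]
    [IsNoetherian Rᵐᵒᵖ R] (σ : P →ₗ[R] (I →₀ R)) {S : Set I}
    (hT : ∀ F : Finset I, coordIdeal A σ (S ∪ F) = ⊤) : ∃ z, coordRight σ S z = ⊤ := by
  classical
  obtain ⟨_, ⟨z, rfl⟩, hz⟩ := set_has_maximal_iff_noetherian.2 ‹IsNoetherian Rᵐᵒᵖ R›
    (Set.range (coordRight σ S)) ⟨_, 0, rfl⟩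
  refine ⟨z, ?_⟩
  by_contra hne
  let s := (σ z).support
  let ρ : P →ₗ[R] (s → R) := LinearMap.pi fun i => Finsupp.lapply (i : I) ∘ₗ σ
  have hρ : ∀ x (i : s), ρ x i = σ x i := fun _ _ => rfl
  obtain ⟨B, hB⟩ : (LinearMap.range ρ).FG := IsNoetherian.noetherian _
  have hB' : ∀ b ∈ B, ∃ p, ρ p = b := fun b hb => by
    have : b ∈ LinearMap.range ρ := hB ▸ Submodule.subset_span hb
    exact this
  choose! g hg using hB'
  let s' : Finset I := B.biUnion fun b => (σ (g b)).support
  have hsplit : ∀ x, ∃ p, (∀ j ∉ s', σ p j = 0) ∧ ρ p = ρ x := by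
    intro x
    have hx : ρ x ∈ Submodule.span R (B : Set (s → R)) := hB ▸ ⟨x, rfl⟩
    generalize ρ x = w at hx ⊢
    induction hx using Submodule.span_induction with
    | mem y hy =>
      refine ⟨g y, fun j hj => ?_, hg y hy⟩
      by_contra hj'
      exact hj (Finset.mem_biUnion.2 ⟨y, hy, by simpa using hj'⟩)
    | zero => exact ⟨0, by simp⟩
    | add a b _ _ ha hb =>
      obtain ⟨p, hp, rfl⟩ := ha
      obtain ⟨q, hq, rfl⟩ := hb
      exact ⟨p + q, fun j hj => by simp [hp j hj, hq j hj], map_add _ _ _⟩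
    | smul r a _ ha =>
      obtain ⟨p, hp, rfl⟩ := ha
      exact ⟨r • p, fun j hj => by simp [hp j hj], map_smul _ _ _⟩
  obtain ⟨x, j, hj, hx⟩ : ∃ x j, j ∉ S ∪ ((s ∪ s' : Finset I) : Set I) ∧
      σ x j ∉ coordRight σ S z := by
    by_contra! h
    have hright : ∀ y ∈ coordRight σ S z, ∀ r, y * r ∈ coordRight σ S z := fun y hy r =>
      Submodule.smul_mem _ (MulOpposite.op r) hy
    have hle : ∀ y ∈ coordIdeal A σ (S ∪ ((s ∪ s' : Finset I) : Set I)), y ∈ coordRight σ S z := by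
      intro y hy
      induction hy using Submodule.span_induction with
      | mem y hy =>
        obtain ⟨x, j, r, hj, rfl⟩ := hy
        exact hright _ (h x j hj) r
      | zero => exact zero_mem _
      | add x y _ _ hx hy => exact add_mem hx hy
      | smul a x _ hx =>
        rw [Algebra.smul_def, Algebra.commutes]
        exact hright _ hx _
    refine hne (top_unique fun r _ => ?_)
    simpa using hright 1 (hle 1 (hT _ ▸ Submodule.mem_top)) r
  obtain ⟨p, hp, hpx⟩ := hsplit x
  simp only [Set.mem_union, Finset.coe_union, Finset.mem_coe, not_or] at hj
  have hys : ∀ i ∈ s, σ (x - p) i = 0 := fun i hi => by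
    have := congrFun hpx ⟨i, hi⟩
    rw [hρ, hρ] at this
    simp [this]
  have hyj : σ (x - p) j = σ x j := by simp [hp j hj.2.2]
  refine hz _ ⟨z + (x - p), rfl⟩ (lt_of_le_of_ne ?_ ?_)
  · refine Submodule.span_le.2 ?_
    rintro _ ⟨i, hi, rfl⟩
    by_cases his : i ∈ s
    · have := coord_mem_coordRight σ hi (z + (x - p))
      rwa [map_add, Finsupp.add_apply, hys i his, add_zero] at this
    · simp [Finsupp.notMem_support_iff.1 his]
  · intro h
    have := coord_mem_coordRight σ hj.1 (z + (x - p))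
    rw [map_add, Finsupp.add_apply, Finsupp.notMem_support_iff.1 hj.2.1, zero_add, hyj, ← h] at this
    exact hx this

theorem exists_unimodular {σ : P →ₗ[R] (I →₀ R)} {S : Set I} {z : P}
    (hz : coordRight σ S z = ⊤) : ∃ a : I →₀ R, (∀ j ∈ S, a j = 0) ∧
      (∀ j, σ z j = 0 → a j = 0) ∧ Finsupp.linearCombination R a (σ z) = 1 := by
  classical
  have h1 : (1 : R) ∈ coordRight σ S z := hz ▸ Submodule.mem_top
  obtain ⟨l, hl, h⟩ := (Finsupp.mem_span_image_iff_linearCombination Rᵐᵒᵖ).1 h1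
  refine ⟨(l.mapRange MulOpposite.unop rfl).filter fun j => σ z j ≠ 0, ?_, ?_, ?_⟩
  · intro j hj
    have : l j = 0 := (Finsupp.mem_supported' _ _).1 hl j (by simpa using hj)
    simp [Finsupp.filter_apply, this]
  · intro j hj
    simp [hj]
  · rw [← h, Finsupp.linearCombination_apply, Finsupp.linearCombination_apply,
      Finsupp.sum_of_support_subset (s := (σ z).support ∪ l.support) _ Finset.subset_union_left _ (by simp),
      Finsupp.sum_of_support_subset (s := (σ z).support ∪ l.support) _ Finset.subset_union_right _ (by simp)]
    refine Finset.sum_congr rfl fun i _ => ?_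
    by_cases hi : σ z i = 0 <;> simp [hi, MulOpposite.smul_eq_mul_unop]

end Coordinates

end

section

section FreeOfDescent
open Cardinal
universe u v
variable {R : Type u} {P I : Type v} [Ring R] [AddCommGroup P] [Module R P]

theorem mk_biUnion_support_lt {M : Type*} [Zero M] (h : I → I →₀ M) {c : Cardinal.{v}} (hc : ℵ₀ ≤ c)
    {S : Set I} (hS : #S < c) : #(⋃ i ∈ S, ((h i).support : Set I) : Set I) < c := by
  rcases S.finite_or_infinite with hf | hf
  · have : (⋃ i ∈ S, ((h i).support : Set I) : Set I).Finite :=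
      hf.biUnion fun i _ => Finset.finite_toSet _
    exact (this.lt_aleph0).trans_le hc
  · have := hf.to_subtype
    calc #(⋃ i ∈ S, ((h i).support : Set I) : Set I) ≤ _ := mk_biUnion_le _ S
      _ ≤ #S * ℵ₀ := by
          gcongr
          exact ciSup_le' fun i => (Finset.finite_toSet _).lt_aleph0.le
      _ = #S := mk_mul_aleph0_eq
      _ < c := hS

theorem coordIdeal_eq_top (A : Type*) [CommRing A] [Algebra A R]
    (hD : ∀ T : ℕ → Submodule A R, IsDescent T → T 0 ≠ ⊤ → ∃ k, T k = ⊥)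
    {σ : P →ₗ[R] (I →₀ R)} {e : I → P} (hσ : ∀ x, Finsupp.linearCombination R e (σ x) = x)
    {c : Cardinal.{v}} (hc : ℵ₀ ≤ c) (hmin : ∀ s : Set P, Submodule.span R s = ⊤ → c ≤ #s)
    {S : Set I} (hS : #S < c) : coordIdeal A σ S = ⊤ := by
  by_contra hne
  let next : Set I → Set I := fun S => S ∪ ⋃ i ∈ S, ((σ (e i)).support : Set I)
  let T : ℕ → Set I := fun n => next^[n] S
  have hT : ∀ n, T (n + 1) = next (T n) := fun n => Function.iterate_succ_apply' _ _ _
  have hlt : ∀ n, #(T n) < c := by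
    intro n
    induction n with
    | zero => exact hS
    | succ n ih =>
      rw [hT]
      exact (mk_union_le _ _).trans_lt (add_lt_of_lt hc ih (mk_biUnion_support_lt _ hc ih))
  obtain ⟨k, hk⟩ := hD (fun n => coordIdeal A σ (T n)) ⟨fun k => coordIdeal_isBi A σ _, fun k => by
    refine coordIdeal_le_mul A hσ fun i hi j hj => ?_
    by_contra h
    refine hj ?_
    rw [hT]
    exact Or.inr (Set.mem_biUnion hi (by simpa using h))⟩ hne
  refine (hlt k).not_ge ((hmin (e '' T k) ?_).trans mk_image_le)
  refine top_unique fun x _ => ?_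
  rw [← hσ x]
  refine (Finsupp.mem_span_image_iff_linearCombination R).2 ⟨σ x, ?_, rfl⟩
  refine (Finsupp.mem_supported' _ _).2 fun j hj => ?_
  have : σ x j ∈ coordIdeal A σ (T k) := Submodule.subset_span ⟨x, j, 1, hj, by simp⟩
  rw [hk] at this
  simpa using this

/-- A system of functionals that is lower unitriangular with respect to a well order, with
pairwise disjoint finite supports, gives a surjection onto a free module. -/
theorem exists_surjective_of_unimodular [LinearOrder I] [WellFoundedLT I] (σ : P →ₗ[R] (I →₀ R))
    (x : I → P) (a : I → I →₀ R) (h1 : ∀ i, Finsupp.linearCombination R (a i) (σ (x i)) = 1)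
    (h2 : ∀ i j, σ (x i) j = 0 → a i j = 0)
    (h3 : ∀ i, ∀ i' < i, ∀ j, σ (x i') j ≠ 0 → a i j = 0) :
    ∃ f : P →ₗ[R] (I →₀ R), Function.Surjective f := by
  classical
  have hdisj : ∀ j i i', a i j ≠ 0 → a i' j ≠ 0 → i = i' := by
    intro j i i' hi hi'
    rcases lt_trichotomy i i' with h | h | h
    · exact absurd (h3 i' i h j fun h0 => hi (h2 i j h0)) hi'
    · exact h
    · exact absurd (h3 i i' h j fun h0 => hi' (h2 i' j h0)) hi
  have hfin : ∀ y, (Function.support fun i => Finsupp.linearCombination R (a i) (σ y)).Finite := by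
    intro y
    have : ∀ j, {i | a i j ≠ 0}.Finite := fun j =>
      Set.Subsingleton.finite fun i hi i' hi' => hdisj j i i' hi hi'
    refine ((σ y).support.finite_toSet.biUnion fun j _ => this j).subset fun i hi => ?_
    simp only [Set.mem_iUnion]
    by_contra! h
    refine hi ((Finsupp.linearCombination_apply R _).trans ?_)
    refine Finset.sum_eq_zero fun j hj => ?_
    have := h j (by simpa using hj)
    simp only [Set.mem_ofPred_eq, not_not] at this
    simp [this]
  let f : P →ₗ[R] (I →₀ R) :=
    { toFun y := Finsupp.ofSupportFinite _ (hfin y)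
      map_add' y z := by ext i; simp [Finsupp.ofSupportFinite_coe]
      map_smul' r y := by ext i; simp [Finsupp.ofSupportFinite_coe] }
  have hf : ∀ y i, f y i = Finsupp.linearCombination R (a i) (σ y) := fun _ _ => rfl
  refine ⟨f, LinearMap.range_eq_top.1 (top_unique ?_)⟩
  have hs : ∀ i, Finsupp.single i (1 : R) ∈ LinearMap.range f := by
    intro i
    induction i using WellFoundedLT.induction with
    | _ i ih =>
    have key : Finsupp.single i (1 : R) = f (x i) - ∑ j ∈ (f (x i)).support.erase i,
        (f (x i) j) • Finsupp.single j (1 : R) := by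
      have : f (x i) = ∑ j ∈ insert i (f (x i)).support, (f (x i) j) • Finsupp.single j (1 : R) := by
        conv_lhs => rw [← Finsupp.sum_single (f (x i)), Finsupp.sum]
        rw [Finset.sum_subset (Finset.subset_insert i _)]
        · simp
        · intro j _ hj
          simp [Finsupp.notMem_support_iff.1 hj]
      conv_rhs => enter [1]; rw [this]
      rw [← Finset.insert_erase (Finset.mem_insert_self i _), Finset.erase_insert_eq_erase,
        Finset.sum_insert (Finset.notMem_erase _ _), hf (x i) i, h1, one_smul]
      simp
    rw [key]
    refine sub_mem ⟨_, rfl⟩ (Submodule.sum_mem _ fun j hj => Submodule.smul_mem _ _ (ih j ?_))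
    rw [Finset.mem_erase, Finsupp.mem_support_iff, hf] at hj
    by_contra hij
    have hlt : i < j := lt_of_le_of_ne (not_lt.1 hij) hj.1.symm
    refine hj.2 ?_
    rw [Finsupp.linearCombination_apply]
    refine Finset.sum_eq_zero fun l hl => ?_
    simp [h3 j i hlt l (by simpa using hl)]
  intro l _
  rw [← Finsupp.sum_single l]
  refine Submodule.sum_mem _ fun i _ => ?_
  rw [← mul_one (l i), ← smul_eq_mul, ← Finsupp.smul_single]
  exact Submodule.smul_mem _ _ (hs i)

theorem Module.Free.of_isDescent (A : Type*) [CommRing A] [Algebra A R] [IsNoetherianRing R]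
    [IsNoetherian Rᵐᵒᵖ R]
    (hD : ∀ T : ℕ → Submodule A R, IsDescent T → T 0 ≠ ⊤ → ∃ k, T k = ⊥)
    (hP : Module.Projective R P) (hfg : ¬ Module.Finite R P) : Module.Free R P := by
  classical
  obtain ⟨s, hs, hmin⟩ : ∃ s : Set P, Submodule.span R s = ⊤ ∧
      ∀ t : Set P, Submodule.span R t = ⊤ → #s ≤ #t := by
    obtain ⟨s, hs⟩ := exists_minimalFor_of_wellFoundedLT
      (fun s : Set P => Submodule.span R s = ⊤) (fun s => #s) ⟨Set.univ, Submodule.span_univ⟩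
    exact ⟨s, hs.1, fun t ht => (le_total _ _).elim id fun h => hs.2 ht h⟩
  have hinf : Infinite s := by
    by_contra h
    have : Finite s := not_infinite_iff_finite.1 h
    exact hfg ⟨Submodule.fg_def.2 ⟨s, Set.toFinite s, hs⟩⟩
  have hc : ℵ₀ ≤ #s := aleph0_le_mk s
  let π : (s →₀ R) →ₗ[R] P := Finsupp.linearCombination R Subtype.val
  have hπ : LinearMap.range π = ⊤ := by rw [Finsupp.range_linearCombination]; simpa using hs
  obtain ⟨σ, hσ'⟩ := π.exists_rightInverse_of_surjective hπ
  have hσ : ∀ x, Finsupp.linearCombination R Subtype.val (σ x) = x := fun x =>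
    LinearMap.congr_fun hσ' x
  have hX : ∀ S : Set s, ∃ x : P, ∃ a : s →₀ R, #S < #s → (∀ j ∈ S, a j = 0) ∧
      (∀ j, σ x j = 0 → a j = 0) ∧ Finsupp.linearCombination R a (σ x) = 1 := by
    intro S
    by_cases hS : #S < #s
    · obtain ⟨z, hz⟩ := exists_coordRight_eq_top A σ (S := S) fun F =>
        coordIdeal_eq_top A hD hσ hc hmin ((mk_union_le _ _).trans_lt
          (add_lt_of_lt hc hS (F.finite_toSet.lt_aleph0.trans_le hc)))
      obtain ⟨a, ha⟩ := exists_unimodular hz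
      exact ⟨z, a, fun _ => ha⟩
    · exact ⟨0, 0, fun h => absurd h hS⟩
  choose X a hXa using hX
  obtain ⟨r, wo, hr⟩ := Cardinal.exists_ord_eq s
  let x : s → P := wo.wf.fix fun i ih => X (⋃ i' : {i' // r i' i}, ((σ (ih i'.1 i'.2)).support : Set s))
  let S : s → Set s := fun i => ⋃ i' ∈ {i' | r i' i}, ((σ (x i')).support : Set s)
  have hx : ∀ i, x i = X (S i) := by
    intro i
    refine (wo.wf.fix_eq _ i).trans ?_
    simp only [S, Set.biUnion_eq_iUnion]
    rfl
  have hlt : ∀ i, #(S i) < #s := fun i => mk_biUnion_support_lt _ hc (card_typein_lt i hr)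
  let _ : LinearOrder s := linearOrderOfSTO r
  have : WellFoundedLT s := ⟨wo.wf⟩
  obtain ⟨f, hf⟩ := exists_surjective_of_unimodular σ x (fun i => a (S i))
    (fun i => by rw [hx]; exact (hXa _ (hlt i)).2.2) (fun i j h => by
      rw [hx] at h; exact (hXa _ (hlt i)).2.1 j h) (fun i i' hi j hj =>
      (hXa _ (hlt i)).1 j (Set.mem_biUnion (show i' ∈ {i' | r i' i} from hi) (by simpa using hj)))
  exact Module.Free.of_surjective_finsupp π (LinearMap.range_eq_top.1 hπ) f hf

end FreeOfDescent

end

section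

section PolyZ
universe u

/-- Groups built from the trivial group by extensions with infinite cyclic quotients and quotients
of prime order. -/
inductive PolyZ : (G : Type u) → [Group G] → Prop
  | triv (G : Type u) [Group G] [Subsingleton G] : PolyZ G
  | int (G : Type u) [Group G] (φ : G →* Multiplicative ℤ) (h : PolyZ φ.ker) : PolyZ G
  | prime (G : Type u) [Group G] (p : ℕ) (hp : p.Prime) (φ : G →* Multiplicative (ZMod p))
      (h : PolyZ φ.ker) : PolyZ G

/-- The restriction of an injective homomorphism to the kernels over a common target. -/
def MonoidHom.kerMap {H G C : Type*} [Group H] [Group G] [Group C] (f : H →* G) (φ : G →* C) :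
    (φ.comp f).ker →* φ.ker :=
  (f.comp (φ.comp f).ker.subtype).codRestrict φ.ker fun x => x.2

theorem MonoidHom.kerMap_injective {H G C : Type*} [Group H] [Group G] [Group C] (f : H →* G)
    (hf : Function.Injective f) (φ : G →* C) : Function.Injective (f.kerMap φ) := fun _ _ h =>
  Subtype.ext (hf (congrArg Subtype.val h))

theorem PolyZ.of_injective {G : Type u} [Group G] (h : PolyZ G) :
    ∀ {H : Type u} [Group H] (f : H →* G), Function.Injective f → PolyZ H := by
  induction h with
  | triv G =>
    intro H _ f hf
    have := hf.subsingleton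
    exact .triv H
  | int G φ h ih => exact fun f hf => .int _ (φ.comp f) (ih _ (f.kerMap_injective hf φ))
  | prime G p hp φ h ih =>
    exact fun f hf => .prime _ p hp (φ.comp f) (ih _ (f.kerMap_injective hf φ))

theorem PolyZ.subgroup {G : Type u} [Group G] (h : PolyZ G) (H : Subgroup G) : PolyZ H :=
  h.of_injective H.subtype H.subtype_injective

theorem PolyZ.of_ker_zmod (n : ℕ) : ∀ {G : Type u} [Group G] (φ : G →* Multiplicative (ZMod n)),
    PolyZ φ.ker → PolyZ G := by
  induction n using Nat.strong_induction_on with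
  | _ n ih =>
  intro G _ φ h
  rcases Nat.eq_zero_or_pos n with rfl | hn
  · exact .int G φ h
  by_cases h1 : n = 1
  · subst h1
    exact h.of_injective ((MonoidHom.id G).codRestrict φ.ker fun x => Subsingleton.elim _ _)
      fun x y hxy => congrArg Subtype.val hxy
  · obtain ⟨p, hp, m, rfl⟩ := Nat.exists_prime_and_dvd h1
    have hm : 0 < m := Nat.pos_of_mul_pos_left hn
    have : NeZero (p * m) := ⟨hn.ne'⟩
    let ψ : Multiplicative (ZMod (p * m)) →* Multiplicative (ZMod p) :=
      AddMonoidHom.toMultiplicative (ZMod.castHom (dvd_mul_right p m) (ZMod p)).toAddMonoidHom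
    refine .prime G p hp (ψ.comp φ) ?_
    let φ' : (ψ.comp φ).ker →* ψ.ker := φ.kerMap ψ
    have hcard : Nat.card ψ.ker < p * m := by
      have hsurj : Function.Surjective ψ := ZMod.castHom_surjective (dvd_mul_right p m)
      have := Subgroup.card_mul_index ψ.ker
      rw [Subgroup.index_ker, MonoidHom.range_eq_top.2 hsurj] at this
      rw [Subgroup.card_top, Nat.card_congr Multiplicative.toAdd, Nat.card_congr
        Multiplicative.toAdd, Nat.card_zmod, Nat.card_zmod] at this
      refine lt_of_lt_of_eq ?_ this
      exact lt_mul_of_one_lt_right Nat.card_pos hp.one_lt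
    let e : ψ.ker ≃* Multiplicative (ZMod (Nat.card ψ.ker)) := (zmodCyclicMulEquiv inferInstance).symm
    refine ih _ hcard (e.toMonoidHom.comp φ') (h.of_injective (MonoidHom.codRestrict
      ((ψ.comp φ).ker.subtype.comp (Subgroup.subtype _)) φ.ker ?_) ?_)
    · rintro ⟨⟨x, hx⟩, hx'⟩
      have : φ' ⟨x, hx⟩ = 1 := e.injective (by simpa using hx')
      exact congrArg Subtype.val this
    · intro x y hxy
      exact Subtype.ext (Subtype.ext (congrArg (fun z : φ.ker => (z : G)) hxy))

theorem PolyZ.of_ker_cyclic {G : Type u} [Group G] {C : Type*} [Group C] [hC : IsCyclic C]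
    (φ : G →* C) (h : PolyZ φ.ker) : PolyZ G := by
  let e : C ≃* Multiplicative (ZMod (Nat.card C)) := (zmodCyclicMulEquiv hC).symm
  refine .of_ker_zmod _ (e.toMonoidHom.comp φ) ?_
  have : (e.toMonoidHom.comp φ).ker = φ.ker := by
    ext x
    simp [MonoidHom.mem_ker]
  rwa [this]

theorem IsPolycyclic.polyZ {G : Type u} [Group G] (h : IsPolycyclic G) : PolyZ G := by
  obtain ⟨n, s, h0, hn, hs⟩ := h
  have key : ∀ i : Fin (n + 1), PolyZ (s i) := by
    intro i
    induction i using Fin.induction with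
    | zero =>
      rw [h0]
      exact .triv _
    | succ i ih =>
      obtain ⟨hle, hN, hC⟩ := hs i
      refine .of_ker_cyclic (QuotientGroup.mk' ((s i.castSucc).subgroupOf (s i.succ))) ?_
      rw [QuotientGroup.ker_mk']
      exact ih.of_injective (Subgroup.subgroupOfEquivOfLe hle).toMonoidHom
        (Subgroup.subgroupOfEquivOfLe hle).injective
  exact (hn ▸ key (Fin.last n) : PolyZ (⊤ : Subgroup G)).of_injective
    (Subgroup.topEquiv (G := G)).symm.toMonoidHom (Subgroup.topEquiv (G := G)).symm.injective

theorem MonoidHom.exists_mul_zpow_mem_ker {G C : Type*} [Group G] [Group C] [IsCyclic C]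
    (φ : G →* C) : ∃ t : G, ∀ g, ∃ i : ℤ, g * t ^ i ∈ φ.ker := by
  obtain ⟨⟨_, t, rfl⟩, ht⟩ := IsCyclic.exists_generator (α := φ.range)
  refine ⟨t, fun g => ?_⟩
  obtain ⟨i, hi⟩ := ht ⟨φ g, g, rfl⟩
  have hi' : φ t ^ i = φ g := congrArg Subtype.val hi
  exact ⟨-i, by simp [MonoidHom.mem_ker, hi']⟩

theorem Group.fg_of_ker_fg {G C : Type*} [Group G] [Group C] [IsCyclic C] (φ : G →* C)
    (h : Group.FG φ.ker) : Group.FG G := by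
  obtain ⟨t, ht⟩ := φ.exists_mul_zpow_mem_ker
  obtain ⟨S, hS⟩ := (Group.fg_iff_subgroup_fg _).1 h
  classical
  refine ⟨⟨insert t S, top_unique fun g _ => ?_⟩⟩
  obtain ⟨i, hi⟩ := ht g
  rw [← hS] at hi
  have h1 : g * t ^ i ∈ Subgroup.closure ((insert t S : Finset G) : Set G) :=
    Subgroup.closure_mono (by simp) hi
  have h2 : t ^ i ∈ Subgroup.closure ((insert t S : Finset G) : Set G) :=
    zpow_mem (Subgroup.subset_closure (by simp)) i
  simpa using mul_mem h1 (inv_mem h2)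

theorem PolyZ.fg {G : Type u} [Group G] (h : PolyZ G) : Group.FG G := by
  induction h with
  | triv G => infer_instance
  | int G φ h ih => exact Group.fg_of_ker_fg φ ih
  | prime G p hp φ h ih => exact Group.fg_of_ker_fg φ ih

theorem PolyZ.isSolvable {G : Type u} [Group G] (h : PolyZ G) : Group.IsSolvable G := by
  induction h with
  | triv G => infer_instance
  | int G φ h ih =>
    exact Group.isSolvable_of_ker_le_range φ.ker.subtype φ (by simp)
  | prime G p hp φ h ih =>
    exact Group.isSolvable_of_ker_le_range φ.ker.subtype φ (by simp)

end PolyZ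

end

section

section StableSubmodules
variable {B G Y : Type*} [CommRing B] [Group G] [AddCommGroup Y] [Module B Y]

/-- Submodules stable under a group of linear transformations. -/
def Stable (ρ : G →* Module.End B Y) (W : Submodule B Y) : Prop := ∀ g, ∀ w ∈ W, ρ g w ∈ W

/-- The smallest stable submodule containing a set. -/
def gspan (ρ : G →* Module.End B Y) (s : Set Y) : Submodule B Y :=
  Submodule.span B {y | ∃ g, ∃ x ∈ s, ρ g x = y}

variable {ρ : G →* Module.End B Y}

theorem Module.End.hom_mul_apply (ρ : G →* Module.End B Y) (g h : G) (x : Y) :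
    ρ (g * h) x = ρ g (ρ h x) := by
  rw [map_mul, Module.End.mul_apply]

theorem Module.End.hom_inv_apply (ρ : G →* Module.End B Y) (g : G) (x : Y) :
    ρ g⁻¹ (ρ g x) = x := by
  rw [← Module.End.hom_mul_apply, inv_mul_cancel, map_one, Module.End.one_apply]

theorem subset_gspan (s : Set Y) : s ⊆ gspan ρ s := fun x hx =>
  Submodule.subset_span ⟨1, x, hx, by simp⟩

theorem stable_gspan (s : Set Y) : Stable ρ (gspan ρ s) := by
  intro g w hw
  induction hw using Submodule.span_induction with
  | mem y hy =>
    obtain ⟨h, x, hx, rfl⟩ := hy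
    exact Submodule.subset_span ⟨g * h, x, hx, by simp⟩
  | zero => simp
  | add x y _ _ hx hy => rw [map_add]; exact add_mem hx hy
  | smul b x _ hx => rw [map_smul]; exact Submodule.smul_mem _ _ hx

theorem gspan_le {s : Set Y} {W : Submodule B Y} (hW : Stable ρ W) (h : s ⊆ W) :
    gspan ρ s ≤ W := by
  refine Submodule.span_le.2 ?_
  rintro _ ⟨g, x, hx, rfl⟩
  exact hW g x (h hx)

theorem Stable.sup {W X : Submodule B Y} (hW : Stable ρ W) (hX : Stable ρ X) :
    Stable ρ (W ⊔ X) := by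
  intro g w hw
  obtain ⟨a, ha, b, hb, rfl⟩ := Submodule.mem_sup.1 hw
  rw [map_add]
  exact Submodule.add_mem_sup (hW g a ha) (hX g b hb)

theorem stable_bot : Stable ρ ⊥ := by
  intro g w hw
  simp [(Submodule.mem_bot B).1 hw]

theorem Stable.restrict {W : Submodule B Y} (hW : Stable ρ W) (N : Subgroup G) :
    Stable (ρ.comp N.subtype) W := fun g => hW g

variable {N : Subgroup G}

theorem Stable.map [hN : N.Normal] {X : Submodule B Y} (hX : Stable (ρ.comp N.subtype) X) (t : G) :
    Stable (ρ.comp N.subtype) (X.map (ρ t)) := by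
  rintro h _ ⟨x, hx, rfl⟩
  have hmem : t⁻¹ * h * t ∈ N := by simpa using hN.conj_mem h h.2 t⁻¹
  refine ⟨ρ (t⁻¹ * h * t) x, hX ⟨_, hmem⟩ x hx, ?_⟩
  simp [← Module.End.mul_apply, ← map_mul, mul_assoc]

/-- The sum of the first `n` translates of a submodule under the powers of `t`. -/
def layer (ρ : G →* Module.End B Y) (t : G) (X : Submodule B Y) : ℕ → Submodule B Y
  | 0 => ⊥
  | n + 1 => layer ρ t X n ⊔ X.map (ρ (t ^ n))

/-- The elements of `X` whose translate under `t ^ n` lies in `W` modulo lower translates. -/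
def leading (ρ : G →* Module.End B Y) (t : G) (X W : Submodule B Y) (n : ℕ) : Submodule B Y :=
  X ⊓ (W ⊔ layer ρ t X n).comap (ρ (t ^ n))

variable {t : G} {X W : Submodule B Y}

theorem layer_stable [N.Normal] (hX : Stable (ρ.comp N.subtype) X) (n : ℕ) :
    Stable (ρ.comp N.subtype) (layer ρ t X n) := by
  induction n with
  | zero => exact stable_bot
  | succ n ih => exact ih.sup (hX.map _)

theorem layer_mono : Monotone (layer ρ t X) := monotone_nat_of_le_succ fun _ => le_sup_left

theorem mem_layer_of_mem {x : Y} (hx : x ∈ X) (n : ℕ) : ρ (t ^ n) x ∈ layer ρ t X (n + 1) :=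
  (le_sup_right : _ ≤ layer ρ t X (n + 1)) ⟨x, hx, rfl⟩

theorem apply_layer {x : Y} {n : ℕ} (hx : x ∈ layer ρ t X n) : ρ t x ∈ layer ρ t X (n + 1) := by
  induction n generalizing x with
  | zero => simp [(Submodule.mem_bot B).1 hx]
  | succ n ih =>
    obtain ⟨a, ha, _, ⟨b, hb, rfl⟩, rfl⟩ := Submodule.mem_sup.1 hx
    rw [map_add]
    refine Submodule.add_mem_sup (ih ha) ⟨b, hb, ?_⟩
    rw [pow_succ', Module.End.hom_mul_apply]

theorem apply_pow_layer {x : Y} {n : ℕ} (hx : x ∈ layer ρ t X n) (m : ℕ) :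
    ρ (t ^ m) x ∈ layer ρ t X (n + m) := by
  induction m with
  | zero => simpa
  | succ m ih =>
    rw [pow_succ', Module.End.hom_mul_apply]
    exact apply_layer ih

theorem leading_stable [hN : N.Normal] (hX : Stable (ρ.comp N.subtype) X)
    (hW : Stable (ρ.comp N.subtype) W) (n : ℕ) :
    Stable (ρ.comp N.subtype) (leading ρ t X W n) := by
  rintro h x ⟨hx, hx'⟩
  refine ⟨hX h x hx, ?_⟩
  have hmem : t ^ n * h * (t ^ n)⁻¹ ∈ N := hN.conj_mem h h.2 _
  have := (hW.sup (layer_stable (t := t) hX n)) ⟨_, hmem⟩ _ hx'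
  change ρ (t ^ n) (ρ h x) ∈ W ⊔ layer ρ t X n
  change ρ (t ^ n * h * (t ^ n)⁻¹) (ρ (t ^ n) x) ∈ _ at this
  rwa [← Module.End.hom_mul_apply, inv_mul_cancel_right, Module.End.hom_mul_apply] at this

theorem leading_mono (hW : ∀ w ∈ W, ρ t w ∈ W) : Monotone (leading ρ t X W) := by
  refine monotone_nat_of_le_succ fun n => ?_
  rintro x ⟨hx, hx'⟩
  refine ⟨hx, ?_⟩
  obtain ⟨a, ha, b, hb, hab⟩ := Submodule.mem_sup.1 hx'
  change ρ (t ^ (n + 1)) x ∈ W ⊔ layer ρ t X (n + 1)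
  rw [pow_succ', Module.End.hom_mul_apply, ← hab, map_add]
  exact Submodule.add_mem_sup (hW a ha) (apply_layer hb)

theorem leading_mono_right {W' : Submodule B Y} (h : W ≤ W') (n : ℕ) :
    leading ρ t X W n ≤ leading ρ t X W' n :=
  inf_le_inf_left _ (Submodule.comap_mono (sup_le_sup_right h _))

theorem inf_layer_le_of_leading_eq {W' : Submodule B Y} (h : W ≤ W')
    (hD : ∀ n, leading ρ t X W n = leading ρ t X W' n) (n : ℕ) : W' ⊓ layer ρ t X n ≤ W := by
  induction n with
  | zero =>
    rintro x ⟨-, hx⟩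
    rw [(Submodule.mem_bot B).1 hx]
    exact zero_mem _
  | succ n ih =>
    rintro y ⟨hy, hy'⟩
    obtain ⟨f, hf, _, ⟨x, hx, rfl⟩, rfl⟩ := Submodule.mem_sup.1 hy'
    have hx' : x ∈ leading ρ t X W' n := by
      refine ⟨hx, ?_⟩
      change ρ (t ^ n) x ∈ W' ⊔ layer ρ t X n
      have := Submodule.add_mem_sup hy (neg_mem hf)
      simpa using this
    rw [← hD] at hx'
    obtain ⟨w, hw, f', hf', e⟩ := Submodule.mem_sup.1 hx'.2
    have : f + f' ∈ W' ⊓ layer ρ t X n := by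
      refine ⟨?_, add_mem hf hf'⟩
      have := sub_mem hy (h hw)
      rw [← e] at this
      have e' : f + (w + f') - w = f + f' := by abel
      rwa [e'] at this
    have := add_mem (ih this) hw
    rw [← e]
    convert this using 1
    abel

theorem exists_pow_mem_layer [hN : N.Normal] (ht : ∀ g, ∃ i : ℤ, g * t ^ i ∈ N) {s : Set Y} {x : Y}
    (hx : x ∈ gspan ρ s) :
    ∃ i n : ℕ, ρ (t ^ i) x ∈ layer ρ t (gspan (ρ.comp N.subtype) s) n := by
  induction hx using Submodule.span_induction with
  | mem y hy =>
    obtain ⟨g, x, hx, rfl⟩ := hy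
    obtain ⟨i, hi⟩ := ht g
    obtain ⟨m, hm⟩ := Int.eq_ofNat_of_zero_le (sub_nonneg.2 (le_abs_self i))
    have hmem : t ^ i * (g * t ^ i) * (t ^ i)⁻¹ ∈ N := hN.conj_mem _ hi _
    have hx' : ρ (t ^ i * (g * t ^ i) * (t ^ i)⁻¹) x ∈ gspan (ρ.comp N.subtype) s :=
      stable_gspan (ρ := ρ.comp N.subtype) s ⟨_, hmem⟩ x (subset_gspan s hx)
    refine ⟨i.natAbs, m + 1, ?_⟩
    have := mem_layer_of_mem (ρ := ρ) (t := t) hx' m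
    rw [← Module.End.hom_mul_apply] at this ⊢
    convert this using 3
    rw [← zpow_natCast t m, ← hm, zpow_sub, ← zpow_natCast t i.natAbs,
      Int.natCast_natAbs]
    group
  | zero => exact ⟨0, 0, by simp⟩
  | add x y _ _ hx hy =>
    obtain ⟨i, n, h⟩ := hx
    obtain ⟨j, m, h'⟩ := hy
    refine ⟨i + j, max (n + j) (m + i), ?_⟩
    rw [map_add]
    refine add_mem ?_ ?_
    · rw [add_comm i, pow_add, Module.End.hom_mul_apply]
      exact layer_mono (le_max_left _ _) (apply_pow_layer h j)
    · rw [pow_add, Module.End.hom_mul_apply]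
      exact layer_mono (le_max_right _ _) (apply_pow_layer h' i)
  | smul b x _ hx =>
    obtain ⟨i, n, h⟩ := hx
    exact ⟨i, n, by rw [map_smul]; exact Submodule.smul_mem _ _ h⟩

theorem eq_of_leading_eq [hN : N.Normal] (ht : ∀ g, ∃ i : ℤ, g * t ^ i ∈ N) {s : Set Y}
    {W W' : Submodule B Y} (hW : Stable ρ W) (hW' : Stable ρ W') (h : W ≤ W') (hs : W' ≤ gspan ρ s)
    (hD : ∀ n, leading ρ t (gspan (ρ.comp N.subtype) s) W n =
      leading ρ t (gspan (ρ.comp N.subtype) s) W' n) : W = W' := by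
  refine le_antisymm h fun y hy => ?_
  obtain ⟨i, n, hi⟩ := exists_pow_mem_layer ht (hs hy)
  have := hW (t ^ i)⁻¹ _ (inf_layer_le_of_leading_eq h hD n ⟨hW' _ _ hy, hi⟩)
  rwa [Module.End.hom_inv_apply] at this

/-- The ascending chain condition on stable submodules of `X`. -/
def StableAcc (ρ : G →* Module.End B Y) (X : Submodule B Y) : Prop :=
  ∀ W : ℕ → Submodule B Y, Monotone W → (∀ n, Stable ρ (W n)) → (∀ n, W n ≤ X) →
    ∃ n, ∀ m ≥ n, W m = W n

theorem StableAcc.of_restrict (h : StableAcc (ρ.comp N.subtype) X) : StableAcc ρ X :=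
  fun W hW hs hle => h W hW (fun n => (hs n).restrict N) hle

theorem StableAcc.gspan_of_normal [hN : N.Normal] (ht : ∀ g, ∃ i : ℤ, g * t ^ i ∈ N) {s : Set Y}
    (h : StableAcc (ρ.comp N.subtype) (gspan (ρ.comp N.subtype) s)) : StableAcc ρ (gspan ρ s) := by
  intro W hW hst hle
  set X := gspan (ρ.comp N.subtype) s
  have hXs : Stable (ρ.comp N.subtype) X := stable_gspan s
  have hmono : ∀ {a b c d}, a ≤ b → c ≤ d → leading ρ t X (W a) c ≤ leading ρ t X (W b) d :=
    fun {a b c d} hab hcd => (leading_mono_right (hW hab) c).trans (leading_mono (hst b t) hcd)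
  obtain ⟨n₀, hn₀⟩ := h (fun n => leading ρ t X (W n) n) (fun a b hab => hmono hab hab)
    (fun n => leading_stable hXs ((hst n).restrict N) n) (fun n => inf_le_left)
  have hfix : ∀ n, ∃ k, ∀ m ≥ k, leading ρ t X (W m) n = leading ρ t X (W k) n := fun n =>
    h (fun k => leading ρ t X (W k) n) (fun a b hab => hmono hab le_rfl)
      (fun k => leading_stable hXs ((hst k).restrict N) n) (fun n => inf_le_left)
  choose k hk using hfix
  let K := n₀ + ∑ n ∈ Finset.range n₀, k n
  refine ⟨K, fun m hm => (eq_of_leading_eq ht (hst K) (hst m) (hW hm) (hle m) fun n => ?_).symm⟩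
  rcases lt_or_ge n n₀ with hn | hn
  · have hkK : k n ≤ K := (Finset.single_le_sum (f := k) (fun _ _ => Nat.zero_le _)
      (Finset.mem_range.2 hn)).trans (Nat.le_add_left _ _)
    rw [hk n K hkK, hk n m (hkK.trans hm)]
  · refine le_antisymm (hmono hm le_rfl) ?_
    have hK : n₀ ≤ K := Nat.le_add_right _ _
    calc leading ρ t X (W m) n ≤ leading ρ t X (W (m + n)) (m + n) :=
          hmono (Nat.le_add_right _ _) (Nat.le_add_left _ _)
      _ = leading ρ t X (W n₀) n₀ := hn₀ _ (by omega)
      _ ≤ leading ρ t X (W K) n := hmono hK hn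

theorem exists_finite_gspan_restrict (hT : ∃ T : Set G, T.Finite ∧ ∀ g, ∃ τ ∈ T, g * τ⁻¹ ∈ N)
    {s : Set Y} (hs : s.Finite) :
    ∃ s' : Set Y, s'.Finite ∧ gspan ρ s = gspan (ρ.comp N.subtype) s' := by
  obtain ⟨T, hT, hT'⟩ := hT
  refine ⟨Set.image2 (fun g x => ρ g x) T s, hT.image2 _ hs, le_antisymm ?_ ?_⟩
  · refine Submodule.span_le.2 ?_
    rintro _ ⟨g, x, hx, rfl⟩
    obtain ⟨τ, hτ, hg⟩ := hT' g
    have := stable_gspan (ρ := ρ.comp N.subtype) (Set.image2 (fun g x => ρ g x) T s) ⟨_, hg⟩ _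
      (subset_gspan _ ⟨τ, hτ, x, hx, rfl⟩)
    simpa [← Module.End.mul_apply, ← map_mul] using this
  · refine gspan_le ((stable_gspan s).restrict N) ?_
    rintro _ ⟨τ, -, x, hx, rfl⟩
    exact stable_gspan s τ x (subset_gspan s hx)

theorem MonoidHom.exists_finite_transversal {C : Type*} [Group C] [Finite C] (φ : G →* C) :
    ∃ T : Set G, T.Finite ∧ ∀ g, ∃ τ ∈ T, g * τ⁻¹ ∈ φ.ker := by
  choose r hr using fun c : φ.range => c.2
  refine ⟨Set.range r, Set.finite_range r, fun g => ⟨r ⟨φ g, g, rfl⟩, ⟨_, rfl⟩, ?_⟩⟩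
  simp [MonoidHom.mem_ker, hr]

end StableSubmodules

theorem PolyZ.stableAcc {G : Type*} [Group G] (h : PolyZ G) {B Y : Type*} [CommRing B]
    [IsNoetherianRing B] [AddCommGroup Y] [Module B Y] (ρ : G →* Module.End B Y) {s : Set Y}
    (hs : s.Finite) : StableAcc ρ (gspan ρ s) := by
  induction h generalizing s with
  | triv G =>
    intro W hW hst hle
    have hfg : (gspan ρ s).FG := by
      refine Submodule.fg_def.2 ⟨s, hs, le_antisymm (Submodule.span_le.2 (subset_gspan s)) ?_⟩
      refine gspan_le (fun g w hw => ?_) Submodule.subset_span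
      rwa [Subsingleton.elim g 1, map_one]
    have := isNoetherian_of_fg_of_noetherian _ hfg
    obtain ⟨n, hn⟩ := monotone_stabilizes_iff_noetherian.2 this
      ⟨fun n => (W n).comap (gspan ρ s).subtype, fun a b hab => Submodule.comap_mono (hW hab)⟩
    refine ⟨n, fun m hm => ?_⟩
    have := congrArg (Submodule.map (gspan ρ s).subtype) (hn m hm)
    change (Submodule.comap _ (W n)).map _ = (Submodule.comap _ (W m)).map _ at this
    rw [Submodule.map_comap_subtype, Submodule.map_comap_subtype, inf_eq_right.2 (hle _),
      inf_eq_right.2 (hle _)] at this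
    exact this.symm
  | int G φ h ih =>
    obtain ⟨t, ht⟩ := φ.exists_mul_zpow_mem_ker
    exact .gspan_of_normal ht (ih _ hs)
  | prime G p hp φ h ih =>
    have : NeZero p := ⟨hp.ne_zero⟩
    obtain ⟨s', hs', e⟩ := exists_finite_gspan_restrict (ρ := ρ) φ.exists_finite_transversal hs
    rw [e]
    exact (ih _ hs').of_restrict

end

section

section GroupRingNoetherian
variable (B G : Type*) [CommRing B] [Group G]

/-- Left multiplication by group elements on the group ring. -/
noncomputable def leftRep : G →* Module.End B (MonoidAlgebra B G) :=
  (Algebra.lmul B (MonoidAlgebra B G)).toMonoidHom.comp (MonoidAlgebra.of B G)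

/-- Right multiplication by inverses of group elements on the group ring. -/
noncomputable def rightRep : G →* Module.End B (MonoidAlgebra B G) where
  toFun g := LinearMap.mulRight B (MonoidAlgebra.of B G g⁻¹)
  map_one' := by ext; simp
  map_mul' g h := by
    apply LinearMap.ext
    intro x
    simp only [mul_inv_rev, map_mul, LinearMap.mulRight_apply, Module.End.mul_apply, mul_assoc]

variable {B G}

theorem leftRep_apply (g : G) (x : MonoidAlgebra B G) :
    leftRep B G g x = MonoidAlgebra.of B G g * x := rfl

theorem rightRep_apply (g : G) (x : MonoidAlgebra B G) :
    rightRep B G g x = x * MonoidAlgebra.of B G g⁻¹ := rfl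

theorem eq_top_of_of_mem {W : Submodule B (MonoidAlgebra B G)}
    (h : ∀ g, MonoidAlgebra.of B G g ∈ W) : W = ⊤ := by
  refine top_unique fun x _ => ?_
  induction x using MonoidAlgebra.induction_on with
  | of g => exact h g
  | add x y hx hy => exact add_mem (hx trivial) (hy trivial)
  | smul b x hx => exact Submodule.smul_mem _ _ (hx trivial)

theorem isNoetherian_of_acc {S M : Type*} [Semiring S] [AddCommMonoid M] [Module S M]
    (h : ∀ W : ℕ → Submodule S M, Monotone W → ∃ n, ∀ m ≥ n, W m = W n) : IsNoetherian S M :=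
  monotone_stabilizes_iff_noetherian.1 fun f => by
    obtain ⟨n, hn⟩ := h f f.monotone
    exact ⟨n, fun m hm => (hn m hm).symm⟩

theorem PolyZ.isNoetherianRing [IsNoetherianRing B] (hG : PolyZ G) :
    IsNoetherianRing (MonoidAlgebra B G) := by
  refine isNoetherian_of_acc fun W hW => ?_
  have htop : gspan (leftRep B G) {1} = ⊤ := eq_top_of_of_mem fun g => by
    simpa [leftRep_apply] using stable_gspan (ρ := leftRep B G) {1} g 1 (subset_gspan _ rfl)
  obtain ⟨n, hn⟩ := hG.stableAcc (leftRep B G) (Set.finite_singleton 1)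
    (fun n => (W n).restrictScalars B) (fun a b hab => hW hab)
    (fun n g w hw => (W n).smul_mem (MonoidAlgebra.of B G g) hw) (fun n => htop ▸ le_top)
  refine ⟨n, fun m hm => Submodule.ext fun x => ?_⟩
  exact SetLike.ext_iff.1 (hn m hm) x

theorem PolyZ.isNoetherian_op [IsNoetherianRing B] (hG : PolyZ G) :
    IsNoetherian (MonoidAlgebra B G)ᵐᵒᵖ (MonoidAlgebra B G) := by
  refine isNoetherian_of_acc fun W hW => ?_
  have htop : gspan (rightRep B G) {1} = ⊤ := eq_top_of_of_mem fun g => by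
    simpa [rightRep_apply] using stable_gspan (ρ := rightRep B G) {1} g⁻¹ 1 (subset_gspan _ rfl)
  have hmul : ∀ n x r, x ∈ W n → x * r ∈ W n := fun n x r hx =>
    (W n).smul_mem (MulOpposite.op r) hx
  obtain ⟨n, hn⟩ := hG.stableAcc (rightRep B G) (Set.finite_singleton 1)
    (fun n => { W n with
      smul_mem' := fun b x hx => by
        rw [Algebra.smul_def, Algebra.commutes]
        exact hmul n x _ hx }) (fun a b hab => hW hab)
    (fun n g w hw => hmul n w _ hw) (fun n => htop ▸ le_top)
  refine ⟨n, fun m hm => Submodule.ext fun x => ?_⟩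
  exact SetLike.ext_iff.1 (hn m hm) x

end GroupRingNoetherian

end

section

section GenericFreeness
universe v
variable {B : Type*} {Y : Type v} [CommRing B] [AddCommGroup Y] [Module B Y]

/-- `X / W` contains a free submodule with basis `b` whose quotient is `f`-power torsion. -/
def GenFree (f : B) (W X : Submodule B Y) : Prop :=
  ∃ (ι : Type v) (b : ι → Y), (∀ i, b i ∈ X) ∧
    (∀ c : ι →₀ B, Finsupp.linearCombination B b c ∈ W → c = 0) ∧
    ∀ x ∈ X, ∃ k : ℕ, f ^ k • x ∈ W ⊔ Submodule.span B (Set.range b)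

variable {f : B} {W X Z : Submodule B Y}

theorem GenFree.of_le (h : X ≤ W) : GenFree f W X :=
  ⟨PEmpty, PEmpty.elim, fun i => i.elim, fun c _ => Subsingleton.elim _ _, fun x hx =>
    ⟨0, by rw [pow_zero, one_smul]; exact Submodule.mem_sup_left (h hx)⟩⟩

theorem GenFree.mul_right (h : GenFree f W X) (g : B) : GenFree (f * g) W X := by
  obtain ⟨ι, b, hb, hi, hs⟩ := h
  refine ⟨ι, b, hb, hi, fun x hx => ?_⟩
  obtain ⟨k, hk⟩ := hs x hx
  refine ⟨k, ?_⟩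
  rw [mul_pow, mul_comm, mul_smul]
  exact Submodule.smul_mem _ _ hk

theorem GenFree.of_dvd {g : B} (h : GenFree f W X) (hfg : f ∣ g) : GenFree g W X := by
  obtain ⟨a, rfl⟩ := hfg
  exact h.mul_right a

theorem GenFree.map {W' X' : Submodule B Y} (h : GenFree f W X) (e : Y →ₗ[B] Y)
    (hX : ∀ x ∈ X, e x ∈ X') (hW : ∀ x ∈ X, e x ∈ W' ↔ x ∈ W) (hX' : X' ≤ W' ⊔ X.map e) :
    GenFree f W' X' := by
  obtain ⟨ι, b, hb, hi, hs⟩ := h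
  have hlc : ∀ c : ι →₀ B, Finsupp.linearCombination B b c ∈ X := fun c => by
    rw [Finsupp.linearCombination_apply]
    exact Submodule.sum_mem _ fun i _ => Submodule.smul_mem _ _ (hb i)
  refine ⟨ι, e ∘ b, fun i => hX _ (hb i), fun c hc => hi c ?_, fun x hx => ?_⟩
  · rwa [← hW _ (hlc c), LinearMap.map_finsupp_linearCombination]
  · obtain ⟨w, hw, _, ⟨y, hy, rfl⟩, rfl⟩ := Submodule.mem_sup.1 (hX' hx)
    obtain ⟨k, hk⟩ := hs y hy
    refine ⟨k, ?_⟩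
    rw [smul_add, ← map_smul]
    refine add_mem (Submodule.mem_sup_left (Submodule.smul_mem _ _ hw)) ?_
    obtain ⟨d, hd, z, hz, hdz⟩ := Submodule.mem_sup.1 hk
    rw [← hdz, map_add]
    have hzX : z ∈ X := (Submodule.span_le.2 (by rintro _ ⟨i, rfl⟩; exact hb i)) hz
    have hdX : d ∈ X := by
      have := sub_mem (Submodule.smul_mem X (f ^ k) hy) hzX
      rwa [← hdz, add_sub_cancel_right] at this
    refine Submodule.add_mem_sup ((hW d hdX).2 hd) ?_
    rw [Set.range_comp, ← Submodule.map_span]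
    exact ⟨z, hz, rfl⟩

/-- Generic freeness passes to the union of an ascending chain. -/
theorem GenFree.iUnion {X : ℕ → Submodule B Y} (hX : Monotone X)
    (h : ∀ n, GenFree f (X n) (X (n + 1))) (hZ : ∀ z ∈ Z, ∃ n, z ∈ X n) (hle : ∀ n, X n ≤ Z) :
    GenFree f (X 0) Z := by
  classical
  choose ι b hb hi hs using h
  let b' : (Σ n, ι n) → Y := fun p => b p.1 p.2
  refine ⟨Σ n, ι n, b', fun i => hle _ (hb i.1 i.2), fun c hc => ?_, fun z hz => ?_⟩
  · by_contra hne
    obtain ⟨p, hp, hmax⟩ := Finset.exists_max_image c.support (fun p => p.1)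
      (Finsupp.support_nonempty_iff.2 hne)
    obtain ⟨n, i⟩ := p
    refine (Finsupp.mem_support_iff.1 hp) ?_
    let c' : ι n →₀ B := c.comapDomain (Sigma.mk n) sigma_mk_injective.injOn
    have hrest : Finsupp.linearCombination B b' c - Finsupp.linearCombination B (b n) c' ∈ X n := by
      have hsplit : Finsupp.linearCombination B (b n) c' =
          ∑ p ∈ c.support with p.1 = n, c p • b' p := by
        rw [Finsupp.linearCombination_apply, Finsupp.sum]
        refine Finset.sum_bij (fun i _ => (⟨n, i⟩ : Σ n, ι n)) ?_ ?_ ?_ ?_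
        · intro i hi
          simpa [c'] using hi
        · intro i _ j _ h
          exact sigma_mk_injective h
        · rintro ⟨m, j⟩ hj
          obtain ⟨hj, rfl⟩ := Finset.mem_filter.1 hj
          exact ⟨j, by simpa [c'] using hj, rfl⟩
        · intro i _
          rfl
      rw [Finsupp.linearCombination_apply, Finsupp.sum, hsplit, ← Finset.sum_filter_add_sum_filter_not
        c.support (fun p => p.1 = n), add_sub_cancel_left]
      refine Submodule.sum_mem _ fun p hp => Submodule.smul_mem _ _ ?_
      obtain ⟨hp, hne⟩ := Finset.mem_filter.1 hp
      exact hX (Nat.succ_le_of_lt (lt_of_le_of_ne (hmax p hp) hne)) (hb p.1 p.2)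
    have hc' : c' = 0 := hi n c' (by
      have := sub_mem (hX (Nat.zero_le n) hc) hrest
      rwa [sub_sub_cancel] at this)
    exact DFunLike.congr_fun hc' i
  · obtain ⟨n, hn⟩ := hZ z hz
    induction n generalizing z with
    | zero => exact ⟨0, by rw [pow_zero, one_smul]; exact Submodule.mem_sup_left hn⟩
    | succ n ih =>
      obtain ⟨k, hk⟩ := hs n z hn
      obtain ⟨d, hd, y, hy, hdy⟩ := Submodule.mem_sup.1 hk
      obtain ⟨l, hl⟩ := ih d (hle n hd) hd
      refine ⟨l + k, ?_⟩
      rw [pow_add, mul_smul, ← hdy, smul_add]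
      refine add_mem hl (Submodule.mem_sup_right (Submodule.smul_mem _ _ ?_))
      refine Submodule.span_mono ?_ hy
      rintro _ ⟨i, rfl⟩
      exact ⟨⟨n, i⟩, rfl⟩

theorem GenFree.trans (h₁ : GenFree f W X) (h₂ : GenFree f X Z) (hWX : W ≤ X) (hXZ : X ≤ Z) :
    GenFree f W Z := by
  let T : ℕ → Submodule B Y := fun n => match n with
    | 0 => W
    | 1 => X
    | _ + 2 => Z
  have hT : ∀ n, T n ≤ Z := fun n => match n with
    | 0 => hWX.trans hXZ
    | 1 => hXZ
    | _ + 2 => le_rfl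
  refine GenFree.iUnion (X := T) (monotone_nat_of_le_succ fun n => ?_) (fun n => ?_)
    (fun z hz => ⟨2, hz⟩) hT
  · match n with
    | 0 => exact hWX
    | 1 => exact hXZ
    | n + 2 => exact le_rfl
  · match n with
    | 0 => exact h₁
    | 1 => exact h₂
    | n + 2 => exact .of_le le_rfl

variable [IsDomain B]

theorem exists_genFree_sup_span_singleton (W : Submodule B Y) (a : Y) :
    ∃ f : B, f ≠ 0 ∧ GenFree f W (W ⊔ Submodule.span B {a}) := by
  by_cases h : ∃ f : B, f ≠ 0 ∧ f • a ∈ W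
  · obtain ⟨f, hf, ha⟩ := h
    refine ⟨f, hf, PEmpty, PEmpty.elim, fun i => i.elim, fun c _ => Subsingleton.elim _ _,
      fun x hx => ⟨1, ?_⟩⟩
    obtain ⟨w, hw, y, hy, rfl⟩ := Submodule.mem_sup.1 hx
    obtain ⟨r, rfl⟩ := Submodule.mem_span_singleton.1 hy
    refine Submodule.mem_sup_left ?_
    rw [pow_one, smul_add, smul_comm]
    exact add_mem (Submodule.smul_mem _ _ hw) (Submodule.smul_mem _ _ ha)
  · push Not at h
    refine ⟨1, one_ne_zero, PUnit, fun _ => a, fun i =>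
      Submodule.mem_sup_right (Submodule.mem_span_singleton_self a), fun c hc => ?_, fun x hx =>
        ⟨0, by simpa using hx⟩⟩
    rw [Finsupp.linearCombination_unique] at hc
    by_contra hne
    refine h _ (fun h0 => hne ?_) hc
    ext
    exact h0

theorem exists_genFree_sup_span (W : Submodule B Y) {s : Set Y} (hs : s.Finite) :
    ∃ f : B, f ≠ 0 ∧ GenFree f W (W ⊔ Submodule.span B s) := by
  induction s, hs using Set.Finite.induction_on with
  | empty => exact ⟨1, one_ne_zero, .of_le (by simp)⟩
  | @insert a s _ _ ih =>
    obtain ⟨f, hf, h⟩ := ih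
    obtain ⟨g, hg, h'⟩ := exists_genFree_sup_span_singleton (W ⊔ Submodule.span B s) a
    refine ⟨f * g, mul_ne_zero hf hg, ?_⟩
    have e : W ⊔ Submodule.span B (insert a s) = W ⊔ Submodule.span B s ⊔ Submodule.span B {a} := by
      rw [Submodule.span_insert, sup_assoc, sup_comm (Submodule.span B s)]
    rw [e]
    exact (h.of_dvd (dvd_mul_right f g)).trans (h'.of_dvd (dvd_mul_left g f)) le_sup_left le_sup_left

variable {G : Type*} [Group G] {ρ : G →* Module.End B Y} {N : Subgroup G} {t : G}

theorem exists_genFree_of_normal [IsNoetherianRing B] [hN : N.Normal]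
    (ht : ∀ g, ∃ i : ℤ, g * t ^ i ∈ N) {s : Set Y}
    (hacc : StableAcc (ρ.comp N.subtype) (gspan (ρ.comp N.subtype) s))
    (ih : ∀ W : Submodule B Y, Stable (ρ.comp N.subtype) W →
      ∃ f : B, f ≠ 0 ∧ GenFree f W (W ⊔ gspan (ρ.comp N.subtype) s))
    (hW : Stable ρ W) : ∃ f : B, f ≠ 0 ∧ GenFree f W (W ⊔ gspan ρ s) := by
  set X := gspan (ρ.comp N.subtype) s with hX
  have hXs : Stable (ρ.comp N.subtype) X := stable_gspan s
  have hXle : X ≤ gspan ρ s := gspan_le ((stable_gspan s).restrict N) (subset_gspan s)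
  have hlay : ∀ n, layer ρ t X n ≤ gspan ρ s := by
    intro n
    induction n with
    | zero => exact bot_le
    | succ n ih =>
      refine sup_le ih ?_
      rintro _ ⟨x, hx, rfl⟩
      exact stable_gspan s _ _ (hXle hx)
  have hDs := fun n => leading_stable (t := t) hXs (hW.restrict N) n
  have hstep : ∀ f n, GenFree f (leading ρ t X W n) X →
      GenFree f (W ⊔ layer ρ t X n) (W ⊔ layer ρ t X (n + 1)) := fun f n h =>
    h.map (ρ (t ^ n)) (fun x hx => Submodule.mem_sup_right (mem_layer_of_mem hx n))
      (fun x hx => ⟨fun h => ⟨hx, h⟩, fun h => h.2⟩) (by rw [sup_assoc]; exact le_rfl)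
  obtain ⟨n₀, hn₀⟩ := hacc (leading ρ t X W) (leading_mono (hW t)) hDs (fun n => inf_le_left)
  have hex : ∀ n, ∃ f : B, f ≠ 0 ∧ GenFree f (leading ρ t X W n) X := fun n => by
    have := ih _ (hDs n)
    rwa [sup_eq_right.2 inf_le_left] at this
  choose f hf0 hf using hex
  let F := ∏ n ∈ Finset.range (n₀ + 1), f n
  have hF : F ≠ 0 := Finset.prod_ne_zero_iff.2 fun n _ => hf0 n
  have hF' : ∀ n, GenFree F (W ⊔ layer ρ t X n) (W ⊔ layer ρ t X (n + 1)) := by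
    intro n
    refine hstep F n ?_
    rcases le_or_gt n n₀ with h | h
    · exact (hf n).of_dvd (Finset.dvd_prod_of_mem f (Finset.mem_range.2 (Nat.lt_succ_of_le h)))
    · rw [hn₀ n h.le]
      exact (hf n₀).of_dvd (Finset.dvd_prod_of_mem f (Finset.mem_range.2 (Nat.lt_succ_self _)))
  have hmono : Monotone fun n => W ⊔ layer ρ t X n := fun a b hab =>
    sup_le_sup_left (layer_mono hab) W
  let P : Submodule B Y := ⨆ n, W ⊔ layer ρ t X n
  have hmemP : ∀ z, z ∈ P ↔ ∃ n, z ∈ W ⊔ layer ρ t X n := fun z =>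
    Submodule.mem_iSup_of_directed _ hmono.directed_le
  have hP : GenFree F W P := by
    have := GenFree.iUnion hmono hF' (fun z hz => (hmemP z).1 hz)
      (fun n => le_iSup (fun n => W ⊔ layer ρ t X n) n)
    simpa [layer] using this
  have hWP : W ≤ P := fun w hw => (hmemP w).2 ⟨0, Submodule.mem_sup_left hw⟩
  have hXP : X ≤ P := fun x hx => (hmemP x).2 ⟨1, Submodule.mem_sup_right (by
    simpa using mem_layer_of_mem (ρ := ρ) (t := t) hx 0)⟩
  have hPle : P ≤ W ⊔ gspan ρ s := iSup_le fun n => sup_le_sup_left (hlay n) W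
  have htP : ∀ x ∈ P, ρ t x ∈ P := fun x hx => by
    obtain ⟨n, hn⟩ := (hmemP x).1 hx
    obtain ⟨a, ha, b, hb, rfl⟩ := Submodule.mem_sup.1 hn
    rw [map_add]
    exact (hmemP _).2 ⟨n + 1, Submodule.add_mem_sup (hW t a ha) (apply_layer hb)⟩
  have hPs : Stable (ρ.comp N.subtype) P := fun g x hx => by
    obtain ⟨n, hn⟩ := (hmemP x).1 hx
    exact (hmemP _).2 ⟨n, ((hW.restrict N).sup (layer_stable hXs n)) g x hn⟩
  have hPgen : P ≤ P.map (ρ t) ⊔ X := by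
    refine iSup_le fun n => sup_le (fun w hw => Submodule.mem_sup_left
      ⟨ρ t⁻¹ w, hWP (hW _ w hw), by simp⟩) ?_
    induction n with
    | zero => exact bot_le
    | succ n ih =>
      refine sup_le ih ?_
      rcases n with _ | n
      · rintro _ ⟨x, hx, rfl⟩
        exact Submodule.mem_sup_right (by simpa using hx)
      · rintro _ ⟨x, hx, rfl⟩
        refine Submodule.mem_sup_left ⟨ρ (t ^ n) x, (hmemP _).2 ⟨n + 1,
          Submodule.mem_sup_right (mem_layer_of_mem hx n)⟩, ?_⟩
        rw [← Module.End.hom_mul_apply, pow_succ']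
  obtain ⟨g, hg0, hg⟩ := ih (P.map (ρ t)) (hPs.map t)
  have hPtop : P.map (ρ t) ⊔ X = P := le_antisymm
    (sup_le (by rintro _ ⟨x, hx, rfl⟩; exact htP x hx) hXP) hPgen
  rw [hPtop] at hg
  let Q : ℕ → Submodule B Y := fun m => P.comap (ρ (t ^ m))
  have hQmono : Monotone Q := monotone_nat_of_le_succ fun m x hx => by
    change ρ (t ^ (m + 1)) x ∈ P
    rw [pow_succ', Module.End.hom_mul_apply]
    exact htP _ hx
  have hQstep : ∀ m, GenFree g (Q m) (Q (m + 1)) := by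
    intro m
    refine hg.map (ρ (t ^ (m + 1))⁻¹) (fun x hx => ?_) (fun x hx => ?_) (fun x hx => ?_)
    · change ρ (t ^ (m + 1)) (ρ (t ^ (m + 1))⁻¹ x) ∈ P
      rwa [← Module.End.hom_mul_apply, mul_inv_cancel, map_one]
    · change ρ (t ^ m) (ρ (t ^ (m + 1))⁻¹ x) ∈ P ↔ _
      have e : t ^ m * (t ^ (m + 1))⁻¹ = t⁻¹ := by rw [pow_succ', mul_inv_rev, mul_inv_cancel_left]
      rw [← Module.End.hom_mul_apply, e]
      constructor
      · intro h
        exact ⟨_, h, by simp⟩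
      · rintro ⟨y, hy, rfl⟩
        rwa [Module.End.hom_inv_apply]
    · exact Submodule.mem_sup_right ⟨_, hx, Module.End.hom_inv_apply ρ _ x⟩
  have hQ0 : Q 0 = P := by ext x; simp [Q]
  have hQle : ∀ m, Q m ≤ W ⊔ gspan ρ s := fun m x hx => by
    have := (hW.sup (stable_gspan s)) (t ^ m)⁻¹ _ (hPle hx)
    rwa [Module.End.hom_inv_apply] at this
  have hPQ : GenFree g P (W ⊔ gspan ρ s) := by
    rw [← hQ0]
    refine GenFree.iUnion hQmono hQstep (fun z hz => ?_) hQle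
    obtain ⟨a, ha, b, hb, rfl⟩ := Submodule.mem_sup.1 hz
    obtain ⟨i, n, h⟩ := exists_pow_mem_layer ht hb
    refine ⟨i, ?_⟩
    change ρ (t ^ i) (a + b) ∈ P
    rw [map_add]
    exact (hmemP _).2 ⟨n, Submodule.add_mem_sup (hW _ a ha) h⟩
  exact ⟨F * g, mul_ne_zero hF hg0, (hP.of_dvd (dvd_mul_right F g)).trans
    (hPQ.of_dvd (dvd_mul_left g F)) hWP hPle⟩

end GenericFreeness

/-- Generic freeness for finitely generated representations of polycyclic groups. -/
theorem PolyZ.exists_genFree {G : Type*} [Group G] (h : PolyZ G) {B Y : Type*} [CommRing B]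
    [IsDomain B] [IsNoetherianRing B] [AddCommGroup Y] [Module B Y] (ρ : G →* Module.End B Y)
    {s : Set Y} (hs : s.Finite) {W : Submodule B Y} (hW : Stable ρ W) :
    ∃ f : B, f ≠ 0 ∧ GenFree f W (W ⊔ gspan ρ s) := by
  induction h generalizing s W with
  | triv G =>
    have : gspan ρ s = Submodule.span B s := by
      refine le_antisymm (gspan_le (fun g w hw => ?_) Submodule.subset_span)
        (Submodule.span_le.2 (subset_gspan s))
      rwa [Subsingleton.elim g 1, map_one]
    rw [this]
    exact exists_genFree_sup_span W hs
  | int G φ h ih =>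
    obtain ⟨t, ht⟩ := φ.exists_mul_zpow_mem_ker
    exact exists_genFree_of_normal ht (h.stableAcc _ hs) (fun W hW => ih _ hs hW) hW
  | prime G p hp φ h ih =>
    have : NeZero p := ⟨hp.ne_zero⟩
    obtain ⟨s', hs', e⟩ := exists_finite_gspan_restrict (ρ := ρ) φ.exists_finite_transversal hs
    rw [e]
    exact ih _ hs' (hW.restrict _)

theorem smul_top_ne_top_of_genFree {B Y : Type*} [CommRing B] [AddCommGroup Y] [Module B Y]
    {f : B} {X : Submodule B Y} (h : GenFree f ⊥ X) (hX : ∃ x ∈ X, ∀ k : ℕ, f ^ k • x ≠ 0)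
    (m : Ideal B) [hm : m.IsPrime] (hf : f ∉ m) : ¬ X ≤ m • X := by
  obtain ⟨ι, b, hb, hi, hs⟩ := h
  intro hle
  have hspan : ∀ x ∈ X, ∃ k : ℕ, f ^ k • x ∈ Submodule.span B (Set.range b) := by simpa using hs
  have hsmul : ∀ x ∈ m • X, ∃ k : ℕ, f ^ k • x ∈ m • Submodule.span B (Set.range b) := by
    intro x hx
    induction hx using Submodule.smul_induction_on' with
    | smul r hr y hy =>
      obtain ⟨k, hk⟩ := hspan y hy
      exact ⟨k, by rw [smul_comm]; exact Submodule.smul_mem_smul hr hk⟩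
    | add x hx y hy h1 h2 =>
      obtain ⟨k, hk⟩ := h1
      obtain ⟨l, hl⟩ := h2
      refine ⟨k + l, ?_⟩
      rw [smul_add]
      refine add_mem ?_ ?_
      · rw [add_comm, pow_add, mul_smul]
        exact Submodule.smul_mem _ _ hk
      · rw [pow_add, mul_smul]
        exact Submodule.smul_mem _ _ hl
  obtain ⟨x, hx, hx0⟩ := hX
  obtain ⟨k, hk⟩ := hspan x hx
  have hne : Nonempty ι := by
    by_contra hne
    have := not_nonempty_iff.1 hne
    rw [Set.range_eq_empty b, Submodule.span_empty] at hk
    exact hx0 k ((Submodule.mem_bot B).1 hk)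
  obtain ⟨i⟩ := hne
  obtain ⟨k, hk⟩ := hsmul _ (hle (hb i))
  obtain ⟨c, hc, e⟩ := (Submodule.mem_ideal_smul_span_iff_exists_sum m b _).1 hk
  have : c - Finsupp.single i (f ^ k) = 0 := hi _ (by
    rw [map_sub, Finsupp.linearCombination_apply, e]
    simp)
  have h2 := DFunLike.congr_fun this i
  simp only [Finsupp.coe_sub, Pi.sub_apply, Finsupp.single_eq_same, Finsupp.coe_zero,
    Pi.zero_apply, sub_eq_zero] at h2
  exact hf (hm.mem_of_pow_mem k (h2 ▸ hc i))

end

section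

section Restriction
variable {B : Type*} [CommRing B] {G : Type*} [Group G] (H : Subgroup G)

/-- The inclusion of the group algebra of a subgroup. -/
noncomputable def MonoidAlgebra.incl : MonoidAlgebra B H →ₐ[B] MonoidAlgebra B G :=
  MonoidAlgebra.mapDomainAlgHom B B H.subtype

/-- Restriction of the support to a subgroup. -/
noncomputable def MonoidAlgebra.restr : MonoidAlgebra B G →ₗ[B] MonoidAlgebra B H where
  toFun := MonoidAlgebra.comapDomain H.subtype H.subtype_injective
  map_add' := MonoidAlgebra.comapDomain_add _ _
  map_smul' c x := by
    ext h
    simp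

variable {H}

namespace MonoidAlgebra

@[simp]
theorem coeff_restr (x : MonoidAlgebra B G) (h : H) : (restr H x).coeff h = x.coeff h := rfl

@[simp]
theorem incl_single (h : H) (b : B) : incl H (single h b) = single (h : G) b := by
  simp [incl]

theorem coeff_incl_coe (x : MonoidAlgebra B H) (h : H) : (incl H x).coeff (h : G) = x.coeff h := by
  induction x using MonoidAlgebra.induction_linear with
  | zero => simp
  | add x y hx hy => simp [hx, hy]
  | single m r => classical simp [Finsupp.single_apply]

theorem coeff_incl_of_notMem (x : MonoidAlgebra B H) {g : G} (hg : g ∉ H) :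
    (incl H x).coeff g = 0 := by
  induction x using MonoidAlgebra.induction_linear with
  | zero => simp
  | add x y hx hy => simp [hx, hy]
  | single m r =>
    classical
    rw [incl_single, coeff_single, Finsupp.single_apply, if_neg]
    rintro rfl
    exact hg m.2

@[simp]
theorem restr_incl (x : MonoidAlgebra B H) : restr H (incl H x) = x := by
  ext h
  simp [coeff_incl_coe]

@[simp]
theorem restr_one : restr H (1 : MonoidAlgebra B G) = 1 := by
  rw [← map_one (incl H), restr_incl]

theorem restr_mul_incl (x : MonoidAlgebra B G) (y : MonoidAlgebra B H) :
    restr H (x * incl H y) = restr H x * y := by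
  induction y using MonoidAlgebra.induction_linear with
  | zero => simp
  | add y z hy hz => simp [mul_add, hy, hz]
  | single m r => ext h; simp [coeff_mul_single_apply]

theorem restr_incl_mul (x : MonoidAlgebra B G) (y : MonoidAlgebra B H) :
    restr H (incl H y * x) = y * restr H x := by
  induction y using MonoidAlgebra.induction_linear with
  | zero => simp
  | add y z hy hz => simp [add_mul, hy, hz]
  | single m r => ext h; simp [coeff_single_mul_apply]

theorem restr_of_notMem {g : G} (hg : g ∉ H) : restr H (of B G g) = 0 := by
  classical
  ext h
  rw [coeff_restr, of_apply, coeff_single, Finsupp.single_apply, if_neg]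
  · simp
  · rintro rfl
    exact hg h.2

variable (H) in
theorem exists_eq_sum_of_mul_incl (y : MonoidAlgebra B G) :
    ∃ F : Finset G, (∀ g ∈ F, ∀ g' ∈ F, g⁻¹ * g' ∈ H → g = g') ∧
      ∑ g ∈ F, of B G g * incl H (restr H (of B G g⁻¹ * y)) = y := by
  classical
  let r : G → G := fun g => (g : G ⧸ H).out
  have hr : ∀ g, (r g)⁻¹ * g ∈ H := fun g =>
    QuotientGroup.eq.1 (Quotient.out_eq (g : G ⧸ H))
  have hrr : ∀ g u, (r g)⁻¹ * u ∈ H ↔ r u = r g := fun g u => by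
    rw [← QuotientGroup.eq]
    constructor
    · intro h
      have h' : ((r g : G) : G ⧸ H) = (g : G ⧸ H) := Quotient.out_eq _
      exact congrArg Quotient.out (h.symm.trans h')
    · intro h
      rw [← h]
      exact Quotient.out_eq _
  have hidem : ∀ g, r (r g) = r g := fun g => congrArg Quotient.out (Quotient.out_eq (g : G ⧸ H))
  refine ⟨y.coeff.support.image r, ?_, ?_⟩
  · intro g hg g' hg' h
    obtain ⟨u, -, rfl⟩ := Finset.mem_image.1 hg
    obtain ⟨v, -, rfl⟩ := Finset.mem_image.1 hg'
    have := (hrr _ _).1 h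
    rw [hidem] at this
    exact this.symm
  · ext u
    rw [coeff_sum, Finsupp.finsetSum_apply]
    have key : ∀ g ∈ y.coeff.support.image r,
        (of B G g * incl H (restr H (of B G g⁻¹ * y))).coeff u =
          if r u = g then y.coeff u else 0 := by
      intro g hg
      obtain ⟨v, -, rfl⟩ := Finset.mem_image.1 hg
      rw [of_apply, coeff_single_mul_apply, one_mul]
      split_ifs with h
      · have hm := (hrr v u).2 h
        rw [← Subgroup.coe_mk H _ hm, coeff_incl_coe, coeff_restr, of_apply,
          coeff_single_mul_apply]
        simp
      · exact coeff_incl_of_notMem _ fun h' => h ((hrr v u).1 h')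
    rw [Finset.sum_congr rfl key, Finset.sum_ite_eq]
    split_ifs with h
    · rfl
    · by_contra hne
      exact h (Finset.mem_image_of_mem r (Finsupp.mem_support_iff.2 (Ne.symm hne)))

variable (H) in
theorem exists_restr_mul (y : MonoidAlgebra B G) :
    ∃ F : Finset G, ∀ x, restr H (x * y) =
      ∑ g ∈ F, restr H (x * of B G g) * restr H (of B G g⁻¹ * y) := by
  obtain ⟨F, -, hF⟩ := exists_eq_sum_of_mul_incl H y
  refine ⟨F, fun x => ?_⟩
  conv_lhs => rw [← hF]
  simp only [Finset.mul_sum, map_sum, ← restr_mul_incl, mul_assoc]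

end MonoidAlgebra

variable {R : Type*} [CommRing R] {V : Type*} [AddCommGroup V] [Module R V]

/-- Independence of distinct weights. If `A` acts on the translates of `V₁` under distinct cosets
of `C` through distinct weights, then the translates satisfy no simultaneous linear relation. -/
theorem eq_zero_of_sum_translates_eq_zero {ρ : G →* Module.End R V} {A C : Subgroup G}
    [hA : A.Normal] {V₁ : AddSubgroup V}
    (hAV : ∀ a ∈ A, ∀ v ∈ V₁, ρ a v ∈ V₁)
    (hcomm : ∀ a ∈ A, ∀ b ∈ A, ∀ v ∈ V₁, ρ (a * b) v = ρ (b * a) v)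
    (hsep : ∀ g ∉ C, ∃ a ∈ A, ∀ v ∈ V₁, ρ a v = ρ (g * a * g⁻¹) v → v = 0)
    (F : Finset G) (hF : ∀ g ∈ F, ∀ g' ∈ F, g⁻¹ * g' ∈ C → g = g')
    (n : G → Module.End R V) (hn : ∀ g, ∀ v ∈ V₁, n g v ∈ V₁)
    (hnA : ∀ g, ∀ a ∈ A, ∀ v ∈ V₁, n g (ρ a v) = ρ a (n g v))
    (hsum : ∀ v ∈ V₁, ∑ g ∈ F, ρ g (n g v) = 0) : ∀ g ∈ F, ∀ v ∈ V₁, n g v = 0 := by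
  classical
  induction F using Finset.induction_on generalizing n with
  | empty => simp
  | insert t F ht ih =>
    have hrest : ∀ g ∈ F, ∀ v ∈ V₁, n g v = 0 := by
      intro g hg v hv
      have hgt : g⁻¹ * t ∉ C := fun h => ht (by
        rw [← hF g (Finset.mem_insert_of_mem hg) t (Finset.mem_insert_self _ _) h]
        exact hg)
      obtain ⟨a, ha, hsep⟩ := hsep _ hgt
      have hc : ∀ h : G, h⁻¹ * t * a * (h⁻¹ * t)⁻¹ ∈ A := fun h => hA.conj_mem a ha _
      have hmem : ∀ h, ∀ v ∈ V₁, ρ a (n h v) - ρ (h⁻¹ * t * a * (h⁻¹ * t)⁻¹) (n h v) ∈ V₁ :=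
        fun h v hv => sub_mem (hAV a ha _ (hn h v hv)) (hAV _ (hc h) _ (hn h v hv))
      have := ih (fun g hg g' hg' => hF g (Finset.mem_insert_of_mem hg) g'
        (Finset.mem_insert_of_mem hg'))
        (fun h => (ρ a - ρ (h⁻¹ * t * a * (h⁻¹ * t)⁻¹)) ∘ₗ n h) hmem ?_ ?_ g hg v hv
      · exact hsep _ (hn g v hv) (sub_eq_zero.1 this)
      · intro h b hb v hv
        simp only [LinearMap.comp_apply, LinearMap.sub_apply, map_sub]
        rw [hnA h b hb v hv, ← Module.End.hom_mul_apply, ← Module.End.hom_mul_apply,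
          ← Module.End.hom_mul_apply, ← Module.End.hom_mul_apply, hcomm a ha b hb _ (hn h v hv),
          hcomm _ (hc h) b hb _ (hn h v hv)]
      · intro v hv
        have h1 := hsum (ρ a v) (hAV a ha v hv)
        have h2 := congrArg (ρ (t * a * t⁻¹)) (hsum v hv)
        rw [map_zero, map_sum, Finset.sum_insert ht] at h2
        rw [Finset.sum_insert ht] at h1
        have e0 : ρ (t * a * t⁻¹) (ρ t (n t v)) = ρ t (n t (ρ a v)) := by
          rw [hnA t a ha v hv, ← Module.End.hom_mul_apply, ← Module.End.hom_mul_apply]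
          simp
        rw [e0] at h2
        have h3 := h1.trans h2.symm
        rw [add_right_inj, ← sub_eq_zero, ← Finset.sum_sub_distrib] at h3
        rw [← h3]
        refine Finset.sum_congr rfl fun h _ => ?_
        simp only [LinearMap.comp_apply, LinearMap.sub_apply, map_sub]
        rw [hnA h a ha v hv, ← Module.End.hom_mul_apply ρ (t * a * t⁻¹),
          ← Module.End.hom_mul_apply ρ h (h⁻¹ * t * a * (h⁻¹ * t)⁻¹)]
        congr 3
        group
    intro g hg v hv
    rcases Finset.mem_insert.1 hg with rfl | hg
    · have := hsum v hv
      rw [Finset.sum_insert ht, Finset.sum_eq_zero fun g hg => by rw [hrest g hg v hv, map_zero],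
        add_zero] at this
      rw [← Module.End.hom_inv_apply ρ g (n g v), this, map_zero]
    · exact hrest g hg v hv

/-- If `x` annihilates the module generated by `V₁`, so does its restriction to the
stabiliser `C` of the weight of `V₁`. -/
theorem restr_apply_eq_zero_of_weight {ρ : G →* Module.End R V} {A C : Subgroup G}
    [hA : A.Normal] {V₁ : AddSubgroup V} (hAC : A ≤ C)
    (hCV : ∀ g ∈ C, ∀ v ∈ V₁, ρ g v ∈ V₁) (hRV : ∀ (r : R), ∀ v ∈ V₁, r • v ∈ V₁)
    (hcomm : ∀ g ∈ C, ∀ b ∈ A, ∀ v ∈ V₁, ρ (g * b) v = ρ (b * g) v)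
    (hsep : ∀ g ∉ C, ∃ a ∈ A, ∀ v ∈ V₁, ρ a v = ρ (g * a * g⁻¹) v → v = 0)
    {x : MonoidAlgebra R G} (hx : ∀ v ∈ V₁, MonoidAlgebra.lift R _ G ρ x v = 0) :
    ∀ v ∈ V₁, MonoidAlgebra.lift R _ G ρ (MonoidAlgebra.incl C (MonoidAlgebra.restr C x)) v = 0 := by
  have hn : ∀ (y : MonoidAlgebra R C), ∀ v ∈ V₁,
      MonoidAlgebra.lift R _ G ρ (MonoidAlgebra.incl C y) v ∈ V₁ := by
    intro y v hv
    induction y using MonoidAlgebra.induction_linear with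
    | zero => simp
    | add y z hy hz => simpa using add_mem hy hz
    | single m r => simpa using hRV r _ (hCV m m.2 v hv)
  have hnA : ∀ (y : MonoidAlgebra R C), ∀ a ∈ A, ∀ v ∈ V₁,
      MonoidAlgebra.lift R _ G ρ (MonoidAlgebra.incl C y) (ρ a v) =
        ρ a (MonoidAlgebra.lift R _ G ρ (MonoidAlgebra.incl C y) v) := by
    intro y a ha v hv
    induction y using MonoidAlgebra.induction_linear with
    | zero => simp
    | add y z hy hz => simp [hy, hz]
    | single m r =>
      simp only [MonoidAlgebra.incl_single, MonoidAlgebra.lift_single, LinearMap.smul_apply,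
        map_smul]
      rw [← Module.End.hom_mul_apply, ← Module.End.hom_mul_apply, hcomm m m.2 a ha v hv]
  obtain ⟨F, hF, e⟩ := MonoidAlgebra.exists_eq_sum_of_mul_incl C x
  have key := eq_zero_of_sum_translates_eq_zero (fun a ha => hCV a (hAC ha))
    (fun a ha => hcomm a (hAC ha)) hsep F hF
    (fun g => MonoidAlgebra.lift R _ G ρ (MonoidAlgebra.incl C (MonoidAlgebra.restr C
      (MonoidAlgebra.of R G g⁻¹ * x)))) (fun g => hn _) (fun g => hnA _) (fun v hv => by
      have := hx v hv
      conv_lhs at this => rw [← e]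
      simpa [map_sum, LinearMap.sum_apply] using this)
  intro v hv
  conv_lhs => rw [← e]
  simp only [map_sum, LinearMap.sum_apply, MonoidAlgebra.restr_mul_incl, map_mul,
    Module.End.mul_apply]
  exact Finset.sum_eq_zero fun g hg => by rw [key g hg v hv, map_zero]

end Restriction

end

section

section Lattice

theorem IsDescent.map_restr {B G : Type*} [CommRing B] [Group G]
    {T : ℕ → Submodule B (MonoidAlgebra B G)} (hT : IsDescent T) (H : Subgroup G) :
    IsDescent fun k => (T k).map (MonoidAlgebra.restr H) where
  isBi := by
    rintro k r _ ⟨x, hx, rfl⟩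
    exact ⟨⟨MonoidAlgebra.incl H r * x, (hT.isBi k _ x hx).1, MonoidAlgebra.restr_incl_mul _ _⟩,
      ⟨x * MonoidAlgebra.incl H r, (hT.isBi k _ x hx).2, MonoidAlgebra.restr_mul_incl _ _⟩⟩
  le_mul := by
    rintro k _ ⟨x, hx, rfl⟩
    refine Submodule.mul_induction_on (hT.le_mul k hx) (fun a ha b hb => ?_) (fun a b ha hb => ?_)
    · obtain ⟨F, hF⟩ := MonoidAlgebra.exists_restr_mul H b
      rw [hF]
      exact Submodule.sum_mem _ fun g _ => Submodule.mul_mem_mul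
        ⟨_, (hT.isBi k _ a ha).2, rfl⟩ ⟨_, (hT.isBi _ _ b hb).1, rfl⟩
    · rw [map_add]
      exact add_mem ha hb

theorem IsDescent.shift {A R : Type*} [CommRing A] [Ring R] [Algebra A R] {T : ℕ → Submodule A R}
    (hT : IsDescent T) : IsDescent fun k => T (k + 1) :=
  ⟨fun _ => hT.isBi _, fun _ => hT.le_mul _⟩

variable {G Q : Type*} [Group G] [Ring Q]

/-- The twist of a ring homomorphism on a group ring by a homomorphism of groups. -/
noncomputable def MonoidAlgebra.twist {C : Type*} [Group C] (f : MonoidAlgebra ℤ G →+* Q)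
    (φ : G →* C) : MonoidAlgebra ℤ G →+* MonoidAlgebra Q C :=
  (MonoidAlgebra.lift ℤ (MonoidAlgebra Q C) G
    { toFun := fun g => single (φ g) (f (of ℤ G g))
      map_one' := by
        rw [map_one, map_one, map_one]
        rfl
      map_mul' := fun g h => by rw [single_mul_single, map_mul, map_mul, map_mul] }).toRingHom

namespace MonoidAlgebra

theorem twist_single {C : Type*} [Group C] (f : MonoidAlgebra ℤ G →+* Q) (φ : G →* C) (g : G)
    (n : ℤ) : twist f φ (single g n) = single (φ g) (f (single g n)) := by
  have e : (single g n : MonoidAlgebra ℤ G) = n • of ℤ G g := by simp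
  change MonoidAlgebra.lift ℤ (MonoidAlgebra Q C) G _ (single g n) = _
  rw [lift_single, e, map_zsmul, ← smul_single]
  rfl

theorem coeff_twist_one {C : Type*} [Group C] (f : MonoidAlgebra ℤ G →+* Q) (φ : G →* C)
    (x : MonoidAlgebra ℤ G) : (twist f φ x).coeff 1 = f (incl φ.ker (restr φ.ker x)) := by
  induction x using MonoidAlgebra.induction_linear with
  | zero => simp
  | add x y hx hy => simp [hx, hy]
  | single g n =>
    rw [twist_single]
    by_cases hg : g ∈ φ.ker
    · have : (single g n : MonoidAlgebra ℤ G) = incl φ.ker (single ⟨g, hg⟩ n) := by simp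
      rw [this, restr_incl, ← this, (MonoidHom.mem_ker.1 hg), coeff_single, Finsupp.single_eq_same]
    · have : (single g n : MonoidAlgebra ℤ G) = n • of ℤ G g := by simp
      rw [coeff_single, Finsupp.single_eq_of_ne (fun h => hg (MonoidHom.mem_ker.2 h.symm)), this,
        map_zsmul, restr_of_notMem hg]
      simp

theorem exists_twist_sub_eq {ℓ : ℕ} [NeZero ℓ] (f : MonoidAlgebra ℤ G →+* Q)
    (φ : G →* Multiplicative (ZMod ℓ)) (x : MonoidAlgebra ℤ G) :
    ∃ y, twist f φ x - single 1 (f x) =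
      (of Q (Multiplicative (ZMod ℓ)) (Multiplicative.ofAdd 1) - 1) * y := by
  induction x using MonoidAlgebra.induction_linear with
  | zero => exact ⟨0, by simp⟩
  | add x y hx hy =>
    obtain ⟨a, ha⟩ := hx
    obtain ⟨b, hb⟩ := hy
    refine ⟨a + b, ?_⟩
    rw [mul_add, ← ha, ← hb, map_add, map_add, single_add]
    abel
  | single g n =>
    have hg : Multiplicative.ofAdd (1 : ZMod ℓ) ^ (Multiplicative.toAdd (φ g)).val = φ g := by
      rw [← ofAdd_nsmul, nsmul_one, ZMod.natCast_zmod_val]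
      rfl
    refine ⟨(∑ i ∈ Finset.range (Multiplicative.toAdd (φ g)).val,
      of Q (Multiplicative (ZMod ℓ)) (Multiplicative.ofAdd 1) ^ i) * single 1 (f (single g n)), ?_⟩
    rw [twist_single, ← mul_assoc, mul_geom_sum, ← map_pow, hg, sub_mul, one_mul, of_apply,
      single_mul_single, one_mul, mul_one]

theorem exists_sub_one_pow_eq {ℓ : ℕ} (hℓ : ℓ.Prime) :
    ∃ z, (of Q (Multiplicative (ZMod ℓ)) (Multiplicative.ofAdd 1) - 1) ^ ℓ =
      (ℓ : MonoidAlgebra Q (Multiplicative (ZMod ℓ))) * z := by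
  obtain ⟨r, hr⟩ := (Commute.one_right
    (of Q (Multiplicative (ZMod ℓ)) (Multiplicative.ofAdd 1) - 1)).exists_add_pow_prime_eq hℓ
  have h1 : of Q (Multiplicative (ZMod ℓ)) (Multiplicative.ofAdd 1) ^ ℓ = 1 := by
    rw [← map_pow, ← ofAdd_nsmul, nsmul_one, ZMod.natCast_self, ofAdd_zero, map_one]
  rw [sub_add_cancel, h1, one_pow, mul_one, mul_assoc] at hr
  refine ⟨-((of Q (Multiplicative (ZMod ℓ)) (Multiplicative.ofAdd 1) - 1) * r), ?_⟩
  rw [mul_neg, eq_neg_iff_add_eq_zero]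
  rw [add_right_comm] at hr
  exact add_eq_right.1 hr.symm

end MonoidAlgebra

open MonoidAlgebra

theorem IsDescent.map_restr_eq_zero_of_prime {T : ℕ → Submodule ℤ (MonoidAlgebra ℤ G)}
    (hT : IsDescent T) {ℓ : ℕ} (hℓ : ℓ.Prime)
    (hQ : ∀ x : Q, (∀ n : ℕ, ∃ y, x = (ℓ : Q) ^ n * y) → x = 0) (f : MonoidAlgebra ℤ G →+* Q)
    (h0 : ∀ x ∈ T 0, f x = 0) (φ : G →* Multiplicative (ZMod ℓ)) :
    ∀ x ∈ T 1, f (incl φ.ker (restr φ.ker x)) = 0 := by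
  have : NeZero ℓ := ⟨hℓ.ne_zero⟩
  set δ := of Q (Multiplicative (ZMod ℓ)) (Multiplicative.ofAdd 1) - 1 with hδ
  have hcomm : ∀ y, Commute δ y := fun y =>
    (MonoidAlgebra.of_commute (fun m' => Commute.all _ _) y).sub_left (Commute.one_left y)
  have hpow : ∀ n : ℕ, ∀ x ∈ T 1, ∃ y, twist f φ x = δ ^ n * y := by
    intro n
    induction n with
    | zero => exact fun x _ => ⟨twist f φ x, by simp⟩
    | succ n ih =>
      intro x hx
      refine Submodule.mul_induction_on (hT.le_mul 0 hx) (fun a ha b hb => ?_) (fun a b ha hb => ?_)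
      · obtain ⟨y, hy⟩ := exists_twist_sub_eq f φ a
        obtain ⟨z, hz⟩ := ih b hb
        rw [h0 a ha, single_zero, sub_zero] at hy
        refine ⟨y * z, ?_⟩
        rw [map_mul, hy, hz, ← mul_assoc, mul_assoc _ y, ((hcomm y).pow_left n).eq.symm,
          ← mul_assoc, pow_succ', mul_assoc, mul_assoc]
      · obtain ⟨y, hy⟩ := ha
        obtain ⟨z, hz⟩ := hb
        exact ⟨y + z, by rw [map_add, hy, hz, mul_add]⟩
  intro x hx
  rw [← coeff_twist_one]
  refine hQ _ fun n => ?_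
  obtain ⟨y, hy⟩ := hpow (ℓ * n) x hx
  obtain ⟨z, hz⟩ := exists_sub_one_pow_eq (Q := Q) hℓ
  refine ⟨(z ^ n * y).coeff 1, ?_⟩
  rw [hy, pow_mul, hz, (Nat.cast_commute ℓ z).mul_pow, mul_assoc, natCast_def, single_pow, one_pow,
    coeff_single_one_mul]

theorem IsDescent.map_restr_eq_zero_of_int {T : ℕ → Submodule ℤ (MonoidAlgebra ℤ G)}
    (hT : IsDescent T)
    (hQ : ∀ ℓ : ℕ, ℓ.Prime → ∀ x : Q, (∀ n : ℕ, ∃ y, x = (ℓ : Q) ^ n * y) → x = 0)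
    (f : MonoidAlgebra ℤ G →+* Q) (h0 : ∀ x ∈ T 0, f x = 0) (φ : G →* Multiplicative ℤ) :
    ∀ x ∈ T 1, f (incl φ.ker (restr φ.ker x)) = 0 := by
  intro x hx
  obtain ⟨ℓ, hle, hℓ⟩ := Nat.exists_infinite_primes
    (x.coeff.support.sup (fun u => (Multiplicative.toAdd (φ u)).natAbs) + 1)
  let ψ : G →* Multiplicative (ZMod ℓ) :=
    (AddMonoidHom.toMultiplicative (Int.castAddHom (ZMod ℓ))).comp φ
  have key : ∀ u ∈ x.coeff.support, u ∈ ψ.ker ↔ u ∈ φ.ker := by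
    intro u hu
    have h1 : (Multiplicative.toAdd (φ u)).natAbs < ℓ :=
      (Nat.lt_succ_of_le (Finset.le_sup (f := fun u => (Multiplicative.toAdd (φ u)).natAbs)
        hu)).trans_le hle
    have h2 : u ∈ ψ.ker ↔ ((Multiplicative.toAdd (φ u) : ℤ) : ZMod ℓ) = 0 := Iff.rfl
    rw [h2, ZMod.intCast_zmod_eq_zero_iff_dvd, MonoidHom.mem_ker]
    constructor
    · intro h
      exact Int.eq_zero_of_dvd_of_natAbs_lt_natAbs h (by rw [Int.natAbs_natCast]; exact h1)
    · intro h
      rw [h]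
      simp
  have e : incl φ.ker (restr φ.ker x) = incl ψ.ker (restr ψ.ker x) := by
    ext u
    by_cases hu : u ∈ x.coeff.support
    · by_cases h : u ∈ φ.ker
      · have h1 := coeff_incl_coe (restr φ.ker x) ⟨u, h⟩
        have h2 := coeff_incl_coe (restr ψ.ker x) ⟨u, (key u hu).2 h⟩
        exact h1.trans h2.symm
      · rw [coeff_incl_of_notMem _ h, coeff_incl_of_notMem _ (fun h' => h ((key u hu).1 h'))]
    · have h0 : ∀ K : Subgroup G, (incl K (restr K x)).coeff u = 0 := fun K => by
        by_cases h : u ∈ K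
        · exact (coeff_incl_coe (restr K x) ⟨u, h⟩).trans
            (show x.coeff u = 0 from Finsupp.notMem_support_iff.1 hu)
        · exact coeff_incl_of_notMem _ h
      rw [h0, h0]
  rw [e]
  exact hT.map_restr_eq_zero_of_prime hℓ (hQ ℓ hℓ) f h0 ψ x hx

/-- A descending chain of ideals which starts inside the kernel of a homomorphism to a
residually finite ring of characteristic zero reaches zero. -/
theorem PolyZ.exists_eq_bot_of_isDescent [CharZero Q]
    (hQ : ∀ ℓ : ℕ, ℓ.Prime → ∀ x : Q, (∀ n : ℕ, ∃ y, x = (ℓ : Q) ^ n * y) → x = 0)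
    (h : PolyZ G) (f : MonoidAlgebra ℤ G →+* Q) {T : ℕ → Submodule ℤ (MonoidAlgebra ℤ G)}
    (hT : IsDescent T) (h0 : ∀ x ∈ T 0, f x = 0) : ∃ k, T k = ⊥ := by
  have step : ∀ {G : Type _} [Group G] (f : MonoidAlgebra ℤ G →+* Q)
      {T : ℕ → Submodule ℤ (MonoidAlgebra ℤ G)} (N : Subgroup G), IsDescent T →
      (∀ x ∈ T 1, f (incl N (restr N x)) = 0) →
      (∀ (f : MonoidAlgebra ℤ N →+* Q) {T : ℕ → Submodule ℤ (MonoidAlgebra ℤ N)}, IsDescent T →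
        (∀ x ∈ T 0, f x = 0) → ∃ k, T k = ⊥) → ∃ k, T k = ⊥ := by
    intro G _ f T N hT h1 ih
    obtain ⟨k, hk⟩ := ih (f.comp (incl N).toRingHom) (hT.shift.map_restr N)
      (by rintro _ ⟨x, hx, rfl⟩; exact h1 x hx)
    refine ⟨k + 1, (Submodule.eq_bot_iff _).2 fun x hx => ?_⟩
    ext g
    have := (Submodule.eq_bot_iff _).1 hk _ ⟨of ℤ G g⁻¹ * x, (hT.isBi _ _ x hx).1, rfl⟩
    have := congrArg (fun y => y.coeff 1) this
    simpa [coeff_single_mul_apply] using this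
  induction h with
  | triv G =>
    refine ⟨0, (Submodule.eq_bot_iff _).2 fun x hx => ?_⟩
    have e : x = ((x.coeff 1 : ℤ) : MonoidAlgebra ℤ G) := by
      ext g
      rw [Subsingleton.elim g 1, intCast_def]
      simp
    have := h0 x hx
    rw [e, map_intCast, Int.cast_eq_zero] at this
    rw [e, this, Int.cast_zero]
  | int G φ h ih =>
    exact step f φ.ker hT (hT.map_restr_eq_zero_of_int hQ f h0 φ) ih
  | prime G p hp φ h ih =>
    exact step f φ.ker hT (hT.map_restr_eq_zero_of_prime hp (hQ p hp) f h0 φ) ih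

end Lattice

end

section

section SimpleQuotients

theorem exists_isPrime_annihilator (E V : Type*) [CommRing E] [IsNoetherianRing E] [AddCommGroup V]
    [Module E V] [Nontrivial V] : ∃ p : Ideal E, p.IsPrime ∧ (∃ v : V, v ≠ 0 ∧ ∀ x ∈ p, x • v = 0) ∧
      ∀ v : V, v ≠ 0 → (∀ x ∈ p, x • v = 0) → ∀ x : E, x • v = 0 → x ∈ p := by
  obtain ⟨v₀, hv₀⟩ := exists_ne (0 : V)
  obtain ⟨p, ⟨v, hv, rfl⟩, hmax⟩ := set_has_maximal_iff_noetherian.2 ‹_›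
    {p : Ideal E | ∃ v : V, v ≠ 0 ∧ LinearMap.ker (LinearMap.toSpanSingleton E V v) = p}
    ⟨_, v₀, hv₀, rfl⟩
  have key : ∀ w : V, w ≠ 0 → (∀ x : E, x • v = 0 → x • w = 0) → ∀ x : E, x • w = 0 → x • v = 0 := by
    intro w hw h x hx
    by_contra hxv
    exact hmax _ ⟨w, hw, rfl⟩ (lt_of_le_not_ge h fun h' => hxv (h' hx))
  refine ⟨LinearMap.ker (LinearMap.toSpanSingleton E V v), ⟨fun h => hv ?_, fun {a b} hab => ?_⟩, ⟨v, hv, fun x hx => hx⟩, key⟩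
  · have : (1 : E) ∈ LinearMap.ker (LinearMap.toSpanSingleton E V v) := h ▸ Submodule.mem_top
    simpa using this
  · rw [or_iff_not_imp_right]
    intro hb
    refine key (b • v) hb (fun x hx => ?_) a ?_
    · rw [smul_comm, hx, smul_zero]
    · rw [← mul_smul]
      exact hab

theorem Int.isJacobsonRing : IsJacobsonRing ℤ := by
  refine isJacobsonRing_iff_prime_eq.2 fun P hP => ?_
  by_cases hb : P = ⊥
  · subst hb
    refine (Submodule.eq_bot_iff _).2 fun x hx => ?_
    by_contra hx0
    obtain ⟨p, hle, hp⟩ := Nat.exists_infinite_primes (x.natAbs + 1)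
    have hmax : (Ideal.span {(p : ℤ)}).IsMaximal :=
      PrincipalIdealRing.isMaximal_of_irreducible (Nat.prime_iff_prime_int.1 hp).irreducible
    have h := Ideal.mem_sInf.1 hx (I := Ideal.span {(p : ℤ)}) ⟨bot_le, hmax⟩
    exact hx0 (Int.eq_zero_of_dvd_of_natAbs_lt_natAbs (Ideal.mem_span_singleton.1 h)
      (by rw [Int.natAbs_natCast]; exact hle))
  · have := hP.isMaximal hb
    exact le_antisymm (sInf_le ⟨le_rfl, this⟩) Ideal.le_jacobson

theorem Field.finite_of_finiteType_int {B K : Type*} [CommRing B] [Algebra.FiniteType ℤ B] [Field K]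
    (g : B →+* K) (hg : Function.Surjective g) : Finite K := by
  have : Algebra.FiniteType ℤ K := .of_surjective g.toIntAlgHom hg
  have := Int.isJacobsonRing
  have := finite_of_finite_type_of_isJacobsonRing ℤ K
  obtain ⟨p, hp⟩ := CharP.exists K
  rcases (CharP.char_is_prime_or_zero K p) with h | rfl
  · have := Fact.mk h
    algebraize [ZMod.castHom (dvd_refl p) K]
    have : Module.Finite (ZMod p) K := Module.Finite.of_restrictScalars_finite ℤ (ZMod p) K
    exact Module.finite_of_finite (ZMod p)
  · have : CharZero K := CharP.charP_to_charZero K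
    exact absurd (isField_of_isIntegral_of_isField (R := ℤ) (S := K) (RingHom.injective_int _)
      (Field.toIsField K)) Int.not_isField

theorem exists_isMaximal_finite_quotient {B : Type*} [CommRing B] [IsDomain B]
    [Algebra.FiniteType ℤ B] {f : B} (hf : f ≠ 0) :
    ∃ m : Ideal B, m.IsMaximal ∧ f ∉ m ∧ Finite (B ⧸ m) := by
  have := Int.isJacobsonRing
  have : IsJacobsonRing B := isJacobsonRing_of_finiteType (A := ℤ)
  have h : (⊥ : Ideal B).jacobson = ⊥ := IsJacobsonRing.out ‹_› Ideal.isPrime_bot.isRadical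
  have hf' : f ∉ (⊥ : Ideal B).jacobson := by rwa [h]
  rw [Ideal.jacobson, Ideal.mem_sInf] at hf'
  push Not at hf'
  obtain ⟨m, ⟨-, hm⟩, hfm⟩ := hf'
  let _ := Ideal.Quotient.field m
  exact ⟨m, hm, hfm, Field.finite_of_finiteType_int (Ideal.Quotient.mk m)
    Ideal.Quotient.mk_surjective⟩

end SimpleQuotients

end

section

section SimpleQuotients

open MonoidAlgebra

/-- For a normal subgroup `α.range`, the right multiples of the elements `u (α a) ^ n - 1` generate
a two-sided ideal. -/
theorem mul_mem_closure_pow_sub_one {Γ A S : Type*} [Group Γ] [Group A] [Ring S] (α : A →* Γ)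
    [hα : α.range.Normal] (u : Γ →* S) (hu : Function.Surjective (lift ℤ S Γ u)) (n : ℕ) (r : S) :
    ∀ x ∈ AddSubgroup.closure {x | ∃ a s, (u (α a) ^ n - 1) * s = x},
      r * x ∈ AddSubgroup.closure {x | ∃ a s, (u (α a) ^ n - 1) * s = x} ∧
      x * r ∈ AddSubgroup.closure {x | ∃ a s, (u (α a) ^ n - 1) * s = x} := by
  intro x hx
  constructor
  · obtain ⟨y, rfl⟩ := hu r
    induction y using MonoidAlgebra.induction_linear with
    | zero => simp
    | add y z hy hz =>
      rw [map_add, add_mul]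
      exact add_mem hy hz
    | single g m =>
      rw [lift_single, smul_mul_assoc]
      refine AddSubgroup.zsmul_mem _ ?_ m
      induction hx using AddSubgroup.closure_induction with
      | mem x hx =>
        obtain ⟨a, s, rfl⟩ := hx
        obtain ⟨b, hb⟩ := hα.conj_mem (α a) ⟨a, rfl⟩ g
        refine AddSubgroup.subset_closure ⟨b, u g * s, ?_⟩
        rw [hb, ← map_pow, conj_pow, ← mul_assoc, ← mul_assoc, sub_mul, mul_sub, one_mul, mul_one,
          ← map_mul]
        simp
      | zero => simp
      | add x y _ _ hx hy =>
        rw [mul_add]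
        exact add_mem hx hy
      | neg x _ hx =>
        rw [mul_neg]
        exact neg_mem hx
  · induction hx using AddSubgroup.closure_induction with
    | mem x hx =>
      obtain ⟨a, s, rfl⟩ := hx
      exact AddSubgroup.subset_closure ⟨a, s * r, (mul_assoc _ _ _).symm⟩
    | zero => simp
    | add x y _ _ hx hy =>
      rw [add_mul]
      exact add_mem hx hy
    | neg x _ hx =>
      rw [neg_mul]
      exact neg_mem hx

/-- Abelian normal subgroups of a polycyclic group have finite exponent in every simple quotient
of the integral group ring. -/
theorem PolyZ.exists_pow_eq_one_of_simple {G Γ A S : Type*} [Group G] [Group Γ] [CommGroup A]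
    [Ring S] [Nontrivial S] (hG : PolyZ G) {π : G →* Γ} (hπ : Function.Surjective π) (α : A →* Γ)
    [hα : α.range.Normal] [hA : Group.FG A] (u : Γ →* S)
    (hu : Function.Surjective (lift ℤ S Γ u))
    (hS : ∀ J : AddSubgroup S, (∀ r, ∀ x ∈ J, r * x ∈ J ∧ x * r ∈ J) → J = ⊥ ∨ J = ⊤) :
    ∃ n > 0, ∀ a, u (α a) ^ n = 1 := by
  let j := lift ℤ S A (u.comp α)
  have hft : Algebra.FiniteType ℤ (MonoidAlgebra ℤ A) := MonoidAlgebra.finiteType_of_fg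
  have hnoeth : IsNoetherianRing (MonoidAlgebra ℤ A) := Algebra.FiniteType.isNoetherianRing ℤ _
  let _ : Module (MonoidAlgebra ℤ A) S := Module.compHom S j.toRingHom
  have smul_def : ∀ (x : MonoidAlgebra ℤ A) (v : S), x • v = j x * v := fun _ _ => rfl
  obtain ⟨p, hp, ⟨v₀, hv₀, hpv₀⟩, hann⟩ := exists_isPrime_annihilator (MonoidAlgebra ℤ A) S
  let V₁ := Submodule.torsionBySet (MonoidAlgebra ℤ A) S p
  have mem_V₁ : ∀ {v : S}, v ∈ V₁ ↔ ∀ x ∈ p, j x * v = 0 := fun {v} =>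
    (Submodule.mem_torsionBySet_iff _ _).trans ⟨fun h x hx => h ⟨x, hx⟩, fun h x => h x x.2⟩
  let C : Subgroup Γ :=
    { carrier := {g | ∀ a, ∀ v ∈ V₁, u (g * α a * g⁻¹) * v = u (α a) * v}
      one_mem' := fun a v _ => by simp
      mul_mem' := fun {g h} hg hh a v hv => by
        obtain ⟨b, hb⟩ := hα.conj_mem (α a) ⟨a, rfl⟩ h
        have := hg b v hv
        rw [hb] at this
        rw [← hh a v hv, ← this]
        simp [mul_assoc]
      inv_mem' := fun {g} hg a v hv => by
        obtain ⟨b, hb⟩ := hα.conj_mem (α a) ⟨a, rfl⟩ g⁻¹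
        have := hg b v hv
        rw [hb] at this
        rw [← this]
        simp [mul_assoc] }
  have hcomm₁ : ∀ g ∈ C, ∀ a, ∀ v ∈ V₁, u (α a) * (u g * v) = u g * (u (α a) * v) := by
    intro g hg a v hv
    have h : u (g⁻¹ * α a * g⁻¹⁻¹) * v = u (α a) * v := C.inv_mem hg a v hv
    rw [← h, ← mul_assoc, ← mul_assoc, ← map_mul, ← map_mul]
    simp [mul_assoc]
  have hcomm : ∀ g ∈ C, ∀ x, ∀ v ∈ V₁, j x * (u g * v) = u g * (j x * v) := by
    intro g hg x v hv
    induction x using MonoidAlgebra.induction_linear with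
    | zero => simp
    | add x y hx hy => rw [map_add, add_mul, add_mul, mul_add, hx, hy]
    | single a m =>
      rw [lift_single, smul_mul_assoc, smul_mul_assoc, mul_smul_comm]
      exact congrArg (m • ·) (hcomm₁ g hg a v hv)
  have hCV : ∀ g ∈ C, ∀ v ∈ V₁, u g * v ∈ V₁ := fun g hg v hv => mem_V₁.2 fun x hx => by
    rw [hcomm g hg x v hv, mem_V₁.1 hv x hx, mul_zero]
  have hlift : ∀ x v, lift ℤ _ Γ ((Algebra.lmul ℤ S : S →* Module.End ℤ S).comp u) x v =
      lift ℤ S Γ u x * v := by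
    intro x v
    induction x using MonoidAlgebra.induction_linear with
    | zero => simp
    | add x y hx hy => simp [hx, hy, add_mul]
    | single a m => simp [mul_assoc]
  have hrestr : ∀ x, lift ℤ S Γ u x = 0 → ∀ v ∈ V₁, lift ℤ S Γ u (incl C (restr C x)) * v = 0 := by
    intro x hx v hv
    rw [← hlift]
    refine restr_apply_eq_zero_of_weight (A := α.range) (V₁ := V₁.toAddSubgroup) ?_ hCV
      (fun r v hv => AddSubgroup.zsmul_mem _ hv r) ?_ ?_ (fun v _ => by rw [hlift, hx, zero_mul])
      v hv
    · rintro _ ⟨b, rfl⟩ a v _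
      rw [← map_mul, ← map_inv, ← map_mul, mul_comm b a, mul_inv_cancel_right]
    · rintro g hg _ ⟨b, rfl⟩ v hv
      have := hcomm₁ g hg b v hv
      simp only [MonoidHom.comp_apply, map_mul, Module.End.mul_apply]
      exact this.symm
    · intro g hg
      have hg' : ¬ ∀ a, ∀ v ∈ V₁, u (g * α a * g⁻¹) * v = u (α a) * v := hg
      push Not at hg'
      obtain ⟨a, w, hw, hne⟩ := hg'
      refine ⟨α a, ⟨a, rfl⟩, fun v hv h => ?_⟩
      by_contra hv0
      obtain ⟨b, hb⟩ := hα.conj_mem (α a) ⟨a, rfl⟩ g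
      rw [← hb] at h hne
      have e : ∀ y, (of ℤ A a - of ℤ A b) • y = u (α a) * y - u (α b) * y := fun y => by
        rw [smul_def, map_sub, sub_mul]
        simp [j]
      have hmem : of ℤ A a - of ℤ A b ∈ p := by
        refine hann v hv0 (mem_V₁.1 hv) _ ?_
        rw [e, sub_eq_zero]
        exact h
      have := mem_V₁.1 hw _ hmem
      rw [← smul_def, e, sub_eq_zero] at this
      exact hne this.symm
  let ρ : C →* Module.End (MonoidAlgebra ℤ A ⧸ p) V₁ :=
    { toFun := fun g =>
        { toFun := fun v => ⟨u g * v, hCV g g.2 v v.2⟩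
          map_add' := fun v w => Subtype.ext (mul_add _ _ _)
          map_smul' := fun x v => by
            obtain ⟨x, rfl⟩ := Ideal.Quotient.mk_surjective x
            exact Subtype.ext (hcomm g g.2 x v v.2).symm }
      map_one' := LinearMap.ext fun v => Subtype.ext (by simp)
      map_mul' := fun g h => LinearMap.ext fun v => Subtype.ext (by simp [mul_assoc]) }
  have hρ : ∀ g v, (ρ g v : S) = u g * v := fun _ _ => rfl
  let v₁ : V₁ := ⟨v₀, mem_V₁.2 hpv₀⟩
  let π' : C.comap π →* C := π.subgroupComap C
  let Y := gspan (ρ.comp π') {v₁}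
  have hv₁ : v₁ ∈ Y := subset_gspan _ rfl
  obtain ⟨f, hf, hfree⟩ := (hG.subgroup (C.comap π)).exists_genFree (ρ.comp π')
    (Set.finite_singleton v₁) (stable_bot (ρ := ρ.comp π'))
  rw [bot_sup_eq] at hfree
  have hft' : @Algebra.FiniteType ℤ (MonoidAlgebra ℤ A ⧸ p) _ _ (Ring.toIntAlgebra _) := by
    convert hft.of_surjective (Ideal.Quotient.mkₐ ℤ p)
      Ideal.Quotient.mk_surjective
    exact Algebra.algebra_ext _ _ fun r => by rw [eq_intCast, eq_intCast]
  obtain ⟨m, hm, hfm, hfin⟩ := exists_isMaximal_finite_quotient hf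
  have hnot := smul_top_ne_top_of_genFree hfree ⟨v₁, hv₁, fun k h => ?_⟩ m hfm
  swap
  · obtain ⟨x, hx⟩ := Ideal.Quotient.mk_surjective (f ^ k)
    have h' : x • v₀ = 0 := by
      rw [← hx] at h
      exact congrArg Subtype.val h
    have := hann v₀ hv₀ hpv₀ x h'
    rw [← Ideal.Quotient.eq_zero_iff_mem, hx] at this
    exact hf (eq_zero_of_pow_eq_zero this)
  have hY : ∀ z, ∀ y ∈ Y, ∃ y' ∈ Y, (y' : S) = lift ℤ S Γ u (incl C z) * (y : S) := by
    intro z y hy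
    induction z using MonoidAlgebra.induction_linear with
    | zero => exact ⟨0, zero_mem _, by simp⟩
    | add z w hz hw =>
      obtain ⟨a, ha, ha'⟩ := hz
      obtain ⟨b, hb, hb'⟩ := hw
      exact ⟨a + b, add_mem ha hb, by simp [ha', hb', add_mul]⟩
    | single g r =>
      obtain ⟨g', hg'⟩ := hπ g
      have hmem : ρ g y ∈ Y := by
        have hmem : g' ∈ C.comap π := by
          rw [Subgroup.mem_comap, hg']
          exact g.2
        have e : g = π' ⟨g', hmem⟩ := Subtype.ext hg'.symm
        rw [e]
        exact stable_gspan (ρ := ρ.comp π') {v₁} ⟨g', hmem⟩ y hy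
      exact ⟨r • ρ g y, Y.toAddSubgroup.zsmul_mem hmem r, by
        rw [incl_single, lift_single, smul_mul_assoc]; rfl⟩
  let _ := Ideal.Quotient.field m
  have : Fintype ((MonoidAlgebra ℤ A ⧸ p) ⧸ m)ˣ := Fintype.ofFinite _
  refine ⟨Fintype.card ((MonoidAlgebra ℤ A ⧸ p) ⧸ m)ˣ, Fintype.card_pos, ?_⟩
  set n := Fintype.card ((MonoidAlgebra ℤ A ⧸ p) ⧸ m)ˣ
  rcases hS _ fun r => mul_mem_closure_pow_sub_one α u hu n r with h | h
  · intro a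
    have : (u (α a) ^ n - 1) * 1 ∈ AddSubgroup.closure {x | ∃ a s, (u (α a) ^ n - 1) * s = x} :=
      AddSubgroup.subset_closure ⟨a, 1, rfl⟩
    rw [h, AddSubgroup.mem_bot, mul_one, sub_eq_zero] at this
    exact this
  · refine absurd (fun y hy => ?_) hnot
    have hpow : ∀ a, Ideal.Quotient.mk p (of ℤ A a ^ n - 1) ∈ m := by
      intro a
      rw [← Ideal.Quotient.eq_zero_iff_mem, map_sub, map_one, map_sub, map_one, map_pow, map_pow,
        sub_eq_zero]
      have := pow_card_eq_one (x := (((Units.map (Ideal.Quotient.mk m).toMonoidHom).comp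
        (Units.map (Ideal.Quotient.mk p).toMonoidHom)).comp (Units.map (of ℤ A))).comp
        (toUnits (G := A)).toMonoidHom a)
      exact congrArg Units.val this
    have key : ∀ s ∈ AddSubgroup.closure {x | ∃ a s, (u (α a) ^ n - 1) * s = x},
        ∃ x, lift ℤ S Γ u x = s ∧
          ∃ y' ∈ m • Y, (y' : S) = lift ℤ S Γ u (incl C (restr C x)) * (y : S) := by
      intro s hs
      induction hs using AddSubgroup.closure_induction with
      | mem s hs =>
        obtain ⟨a, t, rfl⟩ := hs
        obtain ⟨x, rfl⟩ := hu t
        have haC : α a ∈ C := fun b v _ => by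
          rw [← map_mul, ← map_inv, ← map_mul, mul_comm a b, mul_inv_cancel_right]
        obtain ⟨y', hy', e⟩ := hY (restr C x) y hy
        have e' : (of ℤ Γ (α a) ^ n - 1) = incl C (of ℤ C ⟨α a, haC⟩ ^ n - 1) := by
          rw [map_sub, map_pow, map_one]
          simp
        refine ⟨(of ℤ Γ (α a) ^ n - 1) * x, by simp,
          _, Submodule.smul_mem_smul (hpow a) hy', ?_⟩
        rw [e', restr_incl_mul, map_mul (incl C), ← e', map_mul, mul_assoc, ← e]
        change j (of ℤ A a ^ n - 1) * (y' : S) = _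
        simp [j]
      | zero => exact ⟨0, by simp, 0, zero_mem _, by simp⟩
      | add s t _ _ hs ht =>
        obtain ⟨x, rfl, y₁, h₁, e₁⟩ := hs
        obtain ⟨x', rfl, y₂, h₂, e₂⟩ := ht
        exact ⟨x + x', by simp, y₁ + y₂, add_mem h₁ h₂, by simp [e₁, e₂, add_mul]⟩
      | neg s _ hs =>
        obtain ⟨x, rfl, y₁, h₁, e₁⟩ := hs
        exact ⟨-x, by simp, -y₁, neg_mem h₁, by simp [e₁]⟩
    obtain ⟨x, hx, y', hy', e⟩ := key 1 (h ▸ AddSubgroup.mem_top _)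
    have := hrestr (x - 1) (by rw [map_sub, hx, map_one, sub_self]) y y.2
    rw [map_sub, restr_one, map_sub, map_one, map_sub, sub_mul, map_one, one_mul, sub_eq_zero,
      ← e] at this
    rwa [← Subtype.ext this]

end SimpleQuotients

end

section

section FiniteQuotients

open scoped commutatorElement

theorem Group.finite_of_finite_ker {G H : Type*} [Group G] [Group H] [Finite H] (f : G →* H)
    [Finite f.ker] : Finite G :=
  have : Finite (G ⧸ f.ker) := Finite.of_equiv _ (QuotientGroup.quotientKerEquivRange f).symm.toEquiv
  Finite.of_subgroup_quotient f.ker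

/-- A finitely generated group of finite exponent with finite commutator subgroup is finite. -/
theorem Group.finite_of_fg_of_pow_eq_one {G : Type*} [Group G] [Group.FG G] [Finite (commutator G)]
    {n : ℕ} (hn : 0 < n) (h : ∀ g : G, g ^ n = 1) : Finite G := by
  have hfg : Group.FG (Abelianization G) := inferInstanceAs (Group.FG (G ⧸ commutator G))
  have : Finite (Abelianization G) := CommGroup.finite_of_fg_isMulTorsion _ fun g => by
    obtain ⟨g, rfl⟩ := QuotientGroup.mk_surjective g
    exact isOfFinOrder_iff_pow_eq_one.2 ⟨n, hn, (QuotientGroup.mk_pow _ _ _).symm.trans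
      (congrArg _ (h g))⟩
  have : Finite (G ⧸ commutator G) := this
  exact Finite.of_subgroup_quotient (commutator G)

theorem Subgroup.finite_of_commutator_le {Γ : Type*} [Group Γ] (hfg : ∀ H : Subgroup Γ, Group.FG H)
    (hexp : ∀ A : Subgroup Γ, A.Normal → (∀ a ∈ A, ∀ b ∈ A, a * b = b * a) →
      ∃ n > 0, ∀ a ∈ A, a ^ n = 1)
    (N M : Subgroup Γ) [hN : N.Normal] [hM : M.Normal] [Finite N] (h : ⁅M, M⁆ ≤ N) : Finite M := by
  let C := M ⊓ centralizer (N : Set Γ)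
  have hC : C.Normal := inferInstance
  have hcomm : ∀ x ∈ C, ∀ y ∈ C, ⁅x, y⁆ ∈ N := fun x hx y hy =>
    h (commutator_mem_commutator hx.1 hy.1)
  have hpow : ∀ x ∈ C, x ^ Nat.card N ∈ C ⊓ centralizer (C : Set Γ) := by
    refine fun x hx => ⟨pow_mem hx _, mem_centralizer_iff.2 fun y hy => ?_⟩
    have h1 : ⁅y, x⁆ ^ Nat.card N = 1 := by
      have := pow_card_eq_one' (x := (⟨_, hcomm y hy x hx⟩ : N))
      exact congrArg Subtype.val this
    have h2 : Commute ⁅y, x⁆ x := mem_centralizer_iff.1 hx.2 _ (hcomm y hy x hx)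
    have h3 : y * x * y⁻¹ = ⁅y, x⁆ * x := by simp [commutatorElement_def]
    have h4 : y * x ^ Nat.card N * y⁻¹ = x ^ Nat.card N := by
      rw [← conj_pow, h3, h2.mul_pow, h1, one_mul]
    exact mul_inv_eq_iff_eq_mul.1 h4
  obtain ⟨n, hn, hn'⟩ := hexp (C ⊓ centralizer (C : Set Γ)) inferInstance
    fun a ha b hb => mem_centralizer_iff.1 hb.2 a ha.1
  have := hfg C
  have : Finite (_root_.commutator C) := by
    have hle : (_root_.commutator C).map C.subtype ≤ N := by
      rw [_root_.commutator_def, map_commutator, commutator_le]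
      rintro _ ⟨x, -, rfl⟩ _ ⟨y, -, rfl⟩
      exact hcomm x x.2 y y.2
    exact Finite.of_injective (fun x : _root_.commutator C => (⟨x.1, hle ⟨x.1, x.2, rfl⟩⟩ : N))
      fun x y hxy => Subtype.ext (Subtype.ext (congrArg (fun z : N => (z : Γ)) hxy))
  have hCfin : Finite C := Group.finite_of_fg_of_pow_eq_one (n := Nat.card N * n)
    (mul_pos Nat.card_pos hn) fun g => Subtype.ext (by
      have := hn' _ (hpow g g.2)
      rwa [← pow_mul] at this)
  let c : M →* MulAut N := MulAut.conjNormal.comp M.subtype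
  have : Finite (MulAut N) := Finite.of_injective (fun e : MulAut N => (e : N → N))
    DFunLike.coe_injective
  have : Finite c.ker := by
    refine Finite.of_injective (fun x : c.ker => (⟨x.1.1, x.1.2, mem_centralizer_iff.2
      fun y hy => ?_⟩ : C)) fun x y hxy =>
        Subtype.ext (Subtype.ext (congrArg (fun z : C => (z : Γ)) hxy))
    have h1 := congrArg (fun e : MulAut N => (e ⟨y, hy⟩ : Γ)) (MonoidHom.mem_ker.1 x.2)
    have h2 : (x.1.1 : Γ) * y * (x.1.1 : Γ)⁻¹ = y := h1
    exact (mul_inv_eq_iff_eq_mul.1 h2).symm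
  exact Group.finite_of_finite_ker c

theorem Group.finite_of_isSolvable {Γ : Type*} [Group Γ] [hs : Group.IsSolvable Γ]
    (hfg : ∀ H : Subgroup Γ, Group.FG H)
    (hexp : ∀ A : Subgroup Γ, A.Normal → (∀ a ∈ A, ∀ b ∈ A, a * b = b * a) →
      ∃ n > 0, ∀ a ∈ A, a ^ n = 1) : Finite Γ := by
  obtain ⟨k, hk⟩ := hs.solvable
  have : ∀ i ≤ k, Finite (derivedSeries Γ (k - i)) := by
    intro i
    induction i with
    | zero =>
      intro _
      rw [Nat.sub_zero, hk]
      infer_instance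
    | succ i ih =>
      intro hi
      have := ih (by lia)
      have e : k - i = k - (i + 1) + 1 := by lia
      refine Subgroup.finite_of_commutator_le hfg hexp (derivedSeries Γ (k - i)) _ ?_
      rw [e, derivedSeries_succ]
  have := this k le_rfl
  rw [Nat.sub_self, derivedSeries_zero] at this
  exact Finite.of_equiv _ Subgroup.topEquiv.toEquiv

open MonoidAlgebra in
theorem PolyZ.finite_of_simple {G Γ S : Type*} [Group G] [Group Γ] [Ring S] [Nontrivial S]
    (hG : PolyZ G) {π : G →* Γ} (hπ : Function.Surjective π) (u : Γ →* S)
    (hinj : Function.Injective u) (hu : Function.Surjective (lift ℤ S Γ u))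
    (hS : ∀ J : AddSubgroup S, (∀ r, ∀ x ∈ J, r * x ∈ J ∧ x * r ∈ J) → J = ⊥ ∨ J = ⊤) :
    Finite Γ := by
  have := hG.isSolvable
  have := Group.isSolvable_of_surjective hπ
  have hfg : ∀ H : Subgroup Γ, Group.FG H := fun H => by
    have := (hG.subgroup (H.comap π)).fg
    exact Group.fg_of_surjective (f := π.subgroupComap H) (π.subgroupComap_surjective_of_surjective H hπ)
  refine Group.finite_of_isSolvable hfg fun A hA hcomm => ?_
  let _ : CommGroup A := { (inferInstance : Group A) with
    mul_comm := fun a b => Subtype.ext (hcomm a a.2 b b.2) }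
  have := hfg A
  have hr : A.subtype.range.Normal := by rwa [A.range_subtype]
  obtain ⟨n, hn, h⟩ := hG.exists_pow_eq_one_of_simple hπ A.subtype u hu hS
  exact ⟨n, hn, fun a ha => hinj (by rw [map_pow, map_one]; exact h ⟨a, ha⟩)⟩

open MonoidAlgebra in
/-- Proper ideals of the integral group ring of a polycyclic group remain proper in the integral
group ring of some finite quotient. -/
theorem PolyZ.exists_finite_quotient {G : Type*} [Group G] (hG : PolyZ G)
    {T : Submodule ℤ (MonoidAlgebra ℤ G)} (hT : T.IsBi) (h1 : T ≠ ⊤) :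
    ∃ (K : Subgroup G) (_ : K.Normal), Finite (G ⧸ K) ∧
      1 ∉ T.map (MonoidAlgebra.mapDomainAlgHom ℤ ℤ (QuotientGroup.mk' K)).toLinearMap := by
  have := hG.isNoetherianRing (B := ℤ)
  let T' : Ideal (MonoidAlgebra ℤ G) := { T with smul_mem' := fun r x hx => (hT r x hx).1 }
  obtain ⟨M, ⟨hM, hM1, hTM⟩, hmax⟩ := set_has_maximal_iff_noetherian.2 this
    {I : Ideal (MonoidAlgebra ℤ G) | I.IsTwoSided ∧ I ≠ ⊤ ∧ T' ≤ I}
    ⟨T', ⟨fun r hx => (hT r _ hx).2⟩, fun h => h1 (top_unique fun x _ => h.ge trivial), le_rfl⟩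
  have : Nontrivial (MonoidAlgebra ℤ G ⧸ M) := Ideal.Quotient.nontrivial_iff.2 hM1
  let u₀ : G →* MonoidAlgebra ℤ G ⧸ M := (Ideal.Quotient.mk M).toMonoidHom.comp (of ℤ G)
  let u : G ⧸ u₀.ker →* MonoidAlgebra ℤ G ⧸ M := QuotientGroup.lift u₀.ker u₀ fun _ h => h
  have hu₀ : ∀ g, u (QuotientGroup.mk' u₀.ker g) = Ideal.Quotient.mk M (of ℤ G g) := fun g => rfl
  have hlift : ∀ x, lift ℤ _ _ u (mapDomainAlgHom ℤ ℤ (QuotientGroup.mk' u₀.ker) x) =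
      Ideal.Quotient.mk M x := by
    intro x
    induction x using MonoidAlgebra.induction_on with
    | of g => simpa using hu₀ g
    | add x y hx hy => rw [map_add, map_add, map_add, hx, hy]
    | smul r x hx => rw [map_smul, map_smul, hx, map_zsmul]
  refine ⟨u₀.ker, inferInstance, ?_, ?_⟩
  · refine hG.finite_of_simple (QuotientGroup.mk'_surjective _) u ?_ (fun s => ?_) fun J hJ => ?_
    · intro a b h
      obtain ⟨a, rfl⟩ := QuotientGroup.mk'_surjective _ a
      obtain ⟨b, rfl⟩ := QuotientGroup.mk'_surjective _ b
      have h' : u₀ a = u₀ b := h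
      refine QuotientGroup.eq.2 (MonoidHom.mem_ker.2 ?_)
      rw [map_mul, ← h', ← map_mul, inv_mul_cancel, map_one]
    · obtain ⟨x, rfl⟩ := Ideal.Quotient.mk_surjective s
      exact ⟨_, hlift x⟩
    · let I : Ideal (MonoidAlgebra ℤ G) :=
        { J.comap (Ideal.Quotient.mk M).toAddMonoidHom with
          smul_mem' := fun r x hx => by
            have : Ideal.Quotient.mk M (r * x) ∈ J := by
              rw [map_mul]
              exact (hJ _ _ hx).1
            exact this }
      have mem_I : ∀ x, x ∈ I ↔ Ideal.Quotient.mk M x ∈ J := fun x => Iff.rfl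
      have hMI : M ≤ I := fun x hx => by
        rw [mem_I, Ideal.Quotient.eq_zero_iff_mem.2 hx]
        exact zero_mem _
      by_cases hI : I = ⊤
      · refine Or.inr (top_unique fun s _ => ?_)
        obtain ⟨x, rfl⟩ := Ideal.Quotient.mk_surjective s
        exact (mem_I x).1 (hI ▸ trivial)
      · refine Or.inl ((AddSubgroup.eq_bot_iff_forall _).2 fun s hs => ?_)
        obtain ⟨x, rfl⟩ := Ideal.Quotient.mk_surjective s
        rw [Ideal.Quotient.eq_zero_iff_mem]
        by_contra hx
        refine hmax I ⟨⟨fun {x} r hx => ?_⟩, hI, hTM.trans hMI⟩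
          (lt_of_le_not_ge hMI fun h => hx (h hs))
        rw [mem_I, map_mul]
        exact (hJ _ _ hx).2
  · rintro ⟨x, hx, h⟩
    have h' := hlift x
    rw [Ideal.Quotient.eq_zero_iff_mem.2 (hTM hx)] at h'
    have h2 : mapDomainAlgHom ℤ ℤ (QuotientGroup.mk' u₀.ker) x = 1 := h
    rw [h2, map_one] at h'
    exact one_ne_zero h'

end FiniteQuotients

end

section

section Filtration
variable {O : Type*} [CommRing O]

/-- A multiplicative filtration of an algebra that is separated from the scalars to order `n`
in degree `n`. -/
structure IsFilt {C : Type*} [Ring C] [Algebra O C] (ϖ : O) (J : ℕ → AddSubgroup C) : Prop where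
  mul_mem : ∀ {n m x y}, x ∈ J n → y ∈ J m → x * y ∈ J (n + m)
  dvd : ∀ {n c}, algebraMap O C c ∈ J n → ϖ ^ n ∣ c

/-- The pullback of a filtration to a two-sided one. -/
def AddSubgroup.core {B C : Type*} [Ring B] [Ring C] (π : B →+ C) (J : AddSubgroup C) :
    AddSubgroup B where
  carrier := {x | ∀ u w, π (u * x * w) ∈ J}
  zero_mem' u w := by simp [J.zero_mem]
  add_mem' hx hy u w := by
    rw [mul_add, add_mul, map_add]
    exact J.add_mem (hx u w) (hy u w)
  neg_mem' hx u w := by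
    rw [mul_neg, neg_mul, map_neg]
    exact J.neg_mem (hx u w)

section
variable {B C : Type*} [Ring B] [Ring C] {π : B →+ C} {J : AddSubgroup C}

theorem AddSubgroup.mul_mem_core_left (r : B) {x : B} (hx : x ∈ J.core π) : r * x ∈ J.core π :=
  fun u w => by simpa only [mul_assoc] using hx (u * r) w

theorem AddSubgroup.mul_mem_core_right (r : B) {x : B} (hx : x ∈ J.core π) : x * r ∈ J.core π :=
  fun u w => by simpa only [mul_assoc] using hx u (r * w)
end

theorem IsFilt.core {B C : Type*} [Ring B] [Ring C] [Algebra O B] [Algebra O C] {ϖ : O}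
    {J : ℕ → AddSubgroup C} (hJ : IsFilt ϖ J) {π : B →+ C}
    (hπ : ∀ c, π (algebraMap O B c) = algebraMap O C c)
    (hmul : ∀ x y, π (x * y) ∈ AddSubgroup.closure {c | ∃ s t, c = π (x * s) * π (t * y)}) :
    IsFilt ϖ fun n => (J n).core π where
  mul_mem {n m x y} hx hy u w := by
    have h := hmul (u * x) (y * w)
    rw [show u * (x * y) * w = u * x * (y * w) by simp only [mul_assoc]]
    refine (AddSubgroup.closure_le (J (n + m))).2 ?_ h
    rintro _ ⟨s, t, rfl⟩
    refine hJ.mul_mem (hx u s) ?_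
    rw [← mul_assoc]
    exact hy t w
  dvd {n c} h := by
    have := h 1 1
    rw [one_mul, mul_one, hπ] at this
    exact hJ.dvd this

end Filtration

/-- A ring with a residue map onto a field, multiplicative lifts, and roots of units. -/
structure Lifting (O k : Type*) [CommRing O] [Field k] where
  /-- reduction -/
  red : O →+* k
  /-- multiplicative lifts -/
  teich : k →* O
  /-- a generator of the kernel of reduction -/
  unif : O
  red_teich : ∀ x, red (teich x) = x
  unif_dvd : ∀ c, red c = 0 → unif ∣ c
  isUnit_of_red : ∀ c, red c ≠ 0 → IsUnit c
  exists_root : ∀ N : ℕ, (N : k) ≠ 0 → ∀ c, red c ≠ 0 → ∃ s, s ^ N = c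

namespace Lifting
open MonoidAlgebra

variable {O k : Type*} [CommRing O] [Field k] (L : Lifting O k)

theorem eq_teich {c : O} {M : ℕ} {b : k} (hM : (M : k) ≠ 0) (hc : L.red c ≠ 0)
    (h : c ^ M = L.teich b) : c = L.teich (L.red c) := by
  have ht : L.teich (L.red c) ^ M = c ^ M := by
    rw [← map_pow, ← map_pow, h, L.red_teich]
  have h1 := (Commute.all c (L.teich (L.red c))).geom_sum₂_mul M
  rw [ht, sub_self] at h1
  have hu : IsUnit (∑ i ∈ Finset.range M, c ^ i * L.teich (L.red c) ^ (M - 1 - i)) := by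
    apply L.isUnit_of_red
    simp only [map_sum, map_mul, map_pow, L.red_teich]
    have : ∀ i ∈ Finset.range M, L.red c ^ i * L.red c ^ (M - 1 - i) = L.red c ^ (M - 1) := by
      intro i hi
      rw [← pow_add]
      congr 1
      have := Finset.mem_range.1 hi
      omega
    rw [Finset.sum_congr rfl this, Finset.sum_const, Finset.card_range, nsmul_eq_mul]
    exact mul_ne_zero hM (pow_ne_zero _ hc)
  exact sub_eq_zero.1 (hu.mul_right_eq_zero.1 h1)

variable {U : Type*} [Group U] {V : Type*} [AddCommGroup V] [Module k V]

/-- The action of the group algebra over `O` on a representation over `k`. -/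
noncomputable def act (σ : U →* Module.End k V) : MonoidAlgebra O U →+* Module.End k V :=
  (lift k (Module.End k V) U σ).toRingHom.comp (mapRingHom U L.red)

theorem act_single (σ : U →* Module.End k V) (g : U) (c : O) :
    L.act σ (single g c) = L.red c • σ g := by
  simp [act, mapRingHom_single]

theorem act_algebraMap (σ : U →* Module.End k V) (c : O) :
    L.act σ (algebraMap O _ c) = algebraMap k _ (L.red c) := by
  rw [MonoidAlgebra.coe_algebraMap, Function.comp_apply, act_single, map_one,
    Algebra.algebraMap_self_apply, Algebra.algebraMap_eq_smul_one]

variable {Z : Subgroup U}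

/-- The linear form on the group algebra that extends the lift of `χ` by zero. -/
noncomputable def tr (χ : Z →* k) : MonoidAlgebra O U →ₗ[O] O :=
  (lift O O Z (L.teich.comp χ)).toLinearMap ∘ₗ restr Z

theorem tr_of_mem (χ : Z →* k) (z : Z) : L.tr χ (of O U z) = L.teich (χ z) := by
  have : of O U (z : U) = incl Z (single z 1) := by simp
  rw [tr, LinearMap.comp_apply, this, restr_incl]
  simp

theorem tr_of_notMem (χ : Z →* k) {g : U} (hg : g ∉ Z) : L.tr χ (of O U g) = 0 := by
  rw [tr, LinearMap.comp_apply, restr_of_notMem hg, map_zero]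

theorem mem_of_tr_eq_zero {χ : Z →* k} {J : AddSubgroup (MonoidAlgebra O U)}
    (hl : ∀ r, ∀ x ∈ J, r * x ∈ J)
    (hr : ∀ r, ∀ x ∈ J, x * r ∈ J)
    (hz : ∀ z : Z, of O U (z : U) - algebraMap O _ (L.teich (χ z)) ∈ J)
    {x : MonoidAlgebra O U} (hx : ∀ g, L.tr χ (of O U g * x) = 0) : x ∈ J := by
  have key : ∀ w : MonoidAlgebra O Z,
      incl Z w - algebraMap O _ (lift O O Z (L.teich.comp χ) w) ∈ J := by
    intro w
    induction w using MonoidAlgebra.induction_linear with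
    | zero => simp [J.zero_mem]
    | add x y hx hy =>
      have := J.add_mem hx hy
      simp only [map_add] at this ⊢
      convert this using 1
      abel
    | single z c =>
      have := hr (algebraMap O _ c) _ (hz z)
      convert this using 1
      rw [sub_mul, ← map_mul]
      simp [mul_comm]
  obtain ⟨F, -, hF⟩ := exists_eq_sum_of_mul_incl Z x
  rw [← hF]
  refine J.sum_mem fun g _ => hl _ _ ?_
  have h1 := key (restr Z (of O U g⁻¹ * x))
  have h2 := hx g⁻¹
  rw [tr, LinearMap.comp_apply] at h2
  change lift O O Z (L.teich.comp χ) (restr Z (of O U g⁻¹ * x)) = 0 at h2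
  rwa [h2, map_zero, sub_zero] at h1

/-- A two-sided filtration of the group algebra that is compatible with a representation with
central character `χ`. -/
structure IsGood (χ : Z →* k) (σ : U →* Module.End k V)
    (J : ℕ → AddSubgroup (MonoidAlgebra O U)) : Prop extends IsFilt L.unif J where
  mul_left : ∀ n r, ∀ x ∈ J n, r * x ∈ J n
  mul_right : ∀ n r, ∀ x ∈ J n, x * r ∈ J n
  central : ∀ n (z : Z), of O U (z : U) - algebraMap O _ (L.teich (χ z)) ∈ J n
  ker : ∀ x, L.act σ x = 0 → x ∈ J 1

theorem exists_isGood_of_top [Nontrivial V] {χ : Z →* k} {σ : U →* Module.End k V}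
    (hZ : Z = ⊤) (hσ : ∀ (z : Z) v, σ z v = χ z • v) : ∃ J, L.IsGood χ σ J := by
  let e : U →* Z := MonoidHom.codRestrict (MonoidHom.id U) Z fun g => hZ ▸ Subgroup.mem_top g
  have he : ∀ g, (e g : U) = g := fun g => rfl
  let ε : MonoidAlgebra O U →ₐ[O] O := lift O O U (L.teich.comp (χ.comp e))
  let J : ℕ → AddSubgroup (MonoidAlgebra O U) := fun n =>
    (Ideal.span {L.unif ^ n}).toAddSubgroup.comap ε.toRingHom.toAddMonoidHom
  have hJ : ∀ n x, x ∈ J n ↔ L.unif ^ n ∣ ε x := fun n x => Ideal.mem_span_singleton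
  have hact : ∀ x, L.act σ x = algebraMap k _ (L.red (ε x)) := by
    intro x
    induction x using MonoidAlgebra.induction_linear with
    | zero => simp
    | add x y hx hy => rw [map_add, hx, hy, ← map_add, ← map_add, ← map_add]
    | single g c =>
      ext v
      have := hσ (e g) v
      rw [he] at this
      rw [act_single, LinearMap.smul_apply, this]
      simp only [ε, lift_single, smul_eq_mul, map_mul, MonoidHom.comp_apply, L.red_teich,
        Module.algebraMap_end_apply, Module.End.mul_apply]
  refine ⟨J, ⟨⟨fun {n m x y} hx hy => ?_, fun {n c} h => ?_⟩, fun n r x h => ?_, fun n r x h => ?_,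
    fun n z => ?_, fun x hx => ?_⟩⟩
  · rw [hJ] at *
    rw [map_mul, pow_add]
    exact mul_dvd_mul hx hy
  · rwa [hJ, AlgHom.commutes] at h
  · rw [hJ] at *
    rw [map_mul]
    exact h.mul_left _
  · rw [hJ] at *
    rw [map_mul]
    exact h.mul_right _
  · rw [hJ, map_sub]
    have : ε (of O U z) = L.teich (χ z) := by
      simp only [ε, of_apply, lift_single, one_smul, MonoidHom.comp_apply]
      rfl
    rw [this, AlgHom.commutes]
    simp
  · rw [hJ, pow_one]
    apply L.unif_dvd
    rw [hact] at hx
    exact (FaithfulSMul.algebraMap_injective k (Module.End k V)) (hx.trans (map_zero _).symm)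

end Lifting

end

section

universe u w

namespace Lifting
open MonoidAlgebra

section
variable {O k : Type*} [CommRing O] [Field k] (L : Lifting O k)
  {U : Type*} [Group U] {Z : Subgroup U}

/-- A quotient of the group algebra of `U` in which `Z` acts by scalars, with a linear form. -/
structure Crossed (χ : Z →* k) (R : Type*) [Ring R] [Algebra O R] where
  /-- the quotient map -/
  map : MonoidAlgebra O U →ₐ[O] R
  /-- the linear form -/
  form : R →ₗ[O] O
  map_surjective : Function.Surjective map
  form_map : ∀ x, form (map x) = L.tr χ x
  map_central : ∀ z : Z, map (of O U (z : U)) = algebraMap O R (L.teich (χ z))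

variable {L} {V : Type*} [AddCommGroup V] [Module k V]

theorem tr_incl_mul (χ : Z →* k) (z : Z) (x : MonoidAlgebra O U) :
    L.tr χ (of O U (z : U) * x) = L.teich (χ z) * L.tr χ x := by
  have : of O U (z : U) = incl Z (single z 1) := by simp
  rw [tr, LinearMap.comp_apply, this, restr_incl_mul]
  simp

theorem tr_mul_central [Z.Normal] {χ : Z →* k}
    (hχ : ∀ g (z : Z) (h : g * (z : U) * g⁻¹ ∈ Z), χ ⟨_, h⟩ = χ z) (z : Z) (x y : MonoidAlgebra O U) :
    L.tr χ (x * (of O U (z : U) - algebraMap O _ (L.teich (χ z))) * y) = 0 := by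
  induction x using MonoidAlgebra.induction_linear with
  | zero => simp
  | add x x' hx hx' => rw [add_mul, add_mul, map_add, hx, hx', add_zero]
  | single g c =>
    have hz := ‹Z.Normal›.conj_mem z z.2 g
    have h1 : (single g c : MonoidAlgebra O U) * of O U (z : U) =
        of O U (g * z * g⁻¹) * single g c := by simp
    have h2 := tr_incl_mul (L := L) χ ⟨_, hz⟩ (single g c * y)
    rw [mul_sub, sub_mul, map_sub, h1, ← Algebra.commutes, mul_assoc (of O U _),
      mul_assoc (algebraMap O _ _),
      ← Algebra.smul_def, map_smul, h2, hχ, smul_eq_mul, sub_self]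

theorem exists_crossed {O : Type w} {U : Type u} {k : Type*} [CommRing O] [Field k]
    {L : Lifting O k} [Group U] {Z : Subgroup U} {V : Type*} [AddCommGroup V] [Module k V] [Z.Normal] {χ : Z →* k} {σ : U →* Module.End k V}
    (hχ : ∀ g (z : Z) (h : g * (z : U) * g⁻¹ ∈ Z), χ ⟨_, h⟩ = χ z)
    (hσ : ∀ (z : Z) v, σ z v = χ z • v) :
    ∃ (R : Type (max u w)) (_ : Ring R) (_ : Algebra O R) (X : L.Crossed χ R)
      (ρ : R →+* Module.End k V), ∀ x, ρ (X.map x) = L.act σ x := by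
  let S : AddSubgroup (MonoidAlgebra O U) :=
    (⊥ : AddSubgroup O).core (L.tr χ).toAddMonoidHom
  let I : Ideal (MonoidAlgebra O U) :=
    { S with smul_mem' := fun r x hx => AddSubgroup.mul_mem_core_left r hx }
  have hI : ∀ x, x ∈ I ↔ ∀ u w, L.tr χ (u * x * w) = 0 := fun x => Iff.rfl
  have : I.IsTwoSided := ⟨fun r hx => AddSubgroup.mul_mem_core_right r hx⟩
  have htr : ∀ x ∈ I, L.tr χ x = 0 := fun x hx => by simpa using (hI x).1 hx 1 1
  have hact : ∀ x ∈ I, L.act σ x = 0 := by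
    intro x hx
    refine L.mem_of_tr_eq_zero (χ := χ) (J := (L.act σ).toAddMonoidHom.ker) ?_ ?_ ?_ ?_
    · intro r x hx
      change L.act σ (r * x) = 0
      rw [map_mul, show L.act σ x = 0 from hx, mul_zero]
    · intro r x hx
      change L.act σ (x * r) = 0
      rw [map_mul, show L.act σ x = 0 from hx, zero_mul]
    · intro z
      change L.act σ (of O U (z : U) - algebraMap O _ (L.teich (χ z))) = 0
      ext v
      rw [map_sub, act_algebraMap, L.red_teich, of_apply, act_single, map_one, one_smul]
      simp [hσ, Module.algebraMap_end_apply]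
    · intro g
      simpa using (hI x).1 hx (of O U g) 1
  let f : MonoidAlgebra O U ⧸ I →ₗ[O] O :=
    { toFun := fun x => Quotient.liftOn' x (L.tr χ) (fun a b h => by
        rw [← sub_eq_zero, ← map_sub, ← neg_sub, map_neg, neg_eq_zero, sub_eq_neg_add]
        exact htr _ (QuotientAddGroup.leftRel_apply.1 h))
      map_add' := by
        intro x y
        obtain ⟨x, rfl⟩ := Ideal.Quotient.mk_surjective x
        obtain ⟨y, rfl⟩ := Ideal.Quotient.mk_surjective y
        exact map_add (L.tr χ) x y
      map_smul' := by
        intro c x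
        obtain ⟨x, rfl⟩ := Ideal.Quotient.mk_surjective x
        exact map_smul (L.tr χ) c x }
  refine ⟨MonoidAlgebra O U ⧸ I, inferInstance, inferInstance,
    { map := Ideal.Quotient.mkₐ O I
      form := f
      map_surjective := Ideal.Quotient.mk_surjective
      form_map := fun x => rfl
      map_central := fun z => ?_ }, Ideal.Quotient.lift I (L.act σ) hact, fun x => rfl⟩
  rw [← sub_eq_zero, ← AlgHom.commutes (Ideal.Quotient.mkₐ O I), ← map_sub]
  exact Ideal.Quotient.eq_zero_iff_mem.2 fun u w => tr_mul_central hχ z u w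

end

namespace Crossed
variable {O k : Type*} [CommRing O] [Field k] {L : Lifting O k}
  {U : Type*} [Group U] {Z : Subgroup U} {χ : Z →* k} {R : Type*} [Ring R] [Algebra O R]
  (X : L.Crossed χ R)

/-- The images of the group elements. -/
noncomputable def u : U →* R := (X.map : MonoidAlgebra O U →* R).comp (of O U)

theorem u_apply (g : U) : X.u g = X.map (of O U g) := rfl

@[simp]
theorem u_mul_inv (g : U) : X.u g * X.u g⁻¹ = 1 := by rw [← map_mul, mul_inv_cancel, map_one]

@[simp]
theorem u_inv_mul (g : U) : X.u g⁻¹ * X.u g = 1 := by rw [← map_mul, inv_mul_cancel, map_one]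

theorem u_central (z : Z) : X.u z = algebraMap O R (L.teich (χ z)) := X.map_central z

theorem form_u_of_notMem {g : U} (hg : g ∉ Z) : X.form (X.u g) = 0 := by
  rw [u_apply, X.form_map, L.tr_of_notMem χ hg]

theorem form_algebraMap (c : O) : X.form (algebraMap O R c) = c := by
  have : L.tr χ 1 = 1 := by
    have := L.tr_of_mem χ 1
    rwa [Z.coe_one, map_one (of O U), map_one χ, map_one L.teich] at this
  rw [Algebra.algebraMap_eq_smul_one, map_smul, ← map_one X.map, X.form_map, this, smul_eq_mul,
    mul_one]

theorem induction {p : R → Prop} (h0 : p 0) (hadd : ∀ x y, p x → p y → p (x + y))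
    (hu : ∀ (c : O) g, p (c • X.u g)) (x : R) : p x := by
  obtain ⟨x, rfl⟩ := X.map_surjective x
  induction x using MonoidAlgebra.induction_linear with
  | zero => rwa [map_zero]
  | add x y hx hy =>
    rw [map_add]
    exact hadd _ _ hx hy
  | single g c =>
    have := hu c g
    rw [u_apply, ← map_smul] at this
    simpa using this

/-- The subalgebra spanned by a subgroup. -/
noncomputable def sub (A : Subgroup U) : Subalgebra O R := (X.map.comp (incl A)).range

theorem u_mem_sub {A : Subgroup U} {a : U} (ha : a ∈ A) : X.u a ∈ X.sub A :=
  ⟨single ⟨a, ha⟩ 1, by simp [u_apply]⟩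

theorem sub_induction {A : Subgroup U} {p : R → Prop} (h0 : p 0)
    (hadd : ∀ x y, p x → p y → p (x + y))
    (hu : ∀ (c : O), ∀ a ∈ A, p (c • X.u a)) {x : R} (hx : x ∈ X.sub A) : p x := by
  obtain ⟨x, rfl⟩ := hx
  induction x using MonoidAlgebra.induction_linear with
  | zero => simpa
  | add x y hx hy =>
    rw [map_add]
    exact hadd _ _ hx hy
  | single g c =>
    have := hu c g g.2
    rw [u_apply, ← map_smul] at this
    simpa using this

theorem conj_mem_sub {A : Subgroup U} [A.Normal] (g : U) {x : R} (hx : x ∈ X.sub A) :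
    X.u g * x * X.u g⁻¹ ∈ X.sub A := by
  refine X.sub_induction (p := fun x => X.u g * x * X.u g⁻¹ ∈ X.sub A) ?_ ?_ ?_ hx
  · simp [zero_mem]
  · intro x y hx hy
    rw [mul_add, add_mul]
    exact add_mem hx hy
  · intro c a ha
    rw [mul_smul_comm, smul_mul_assoc, ← map_mul, ← map_mul]
    exact Subalgebra.smul_mem _ (X.u_mem_sub (‹A.Normal›.conj_mem a ha g)) c

end Crossed

end Lifting

end

section

namespace Lifting
open MonoidAlgebra
open scoped commutatorElement

namespace Crossed
variable {O k : Type*} [CommRing O] [Field k] {L : Lifting O k}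
  {U : Type*} [Group U] {Z : Subgroup U} {χ : Z →* k} {R : Type*} [Ring R] [Algebra O R]
  (X : L.Crossed χ R)

/-- A transversal of a subgroup `A` modulo `Z`, where the commutator pairing of `A` modulo `Z`
is nondegenerate. -/
structure Frame (A : Subgroup U) (ι : Type*) [Fintype ι] where
  /-- the representatives -/
  t : ι → U
  mem : ∀ i, t i ∈ A
  le : Z ≤ A
  exists_unique : ∀ a ∈ A, ∃! i, (t i)⁻¹ * a ∈ Z
  comm : ∀ a ∈ A, ∀ b ∈ A, ⁅a, b⁆ ∈ Z
  nondeg : ∀ a ∈ A, (∀ b ∈ A, X.u a * X.u b = X.u b * X.u a) → a ∈ Z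
  card_ne_zero : (Fintype.card ι : k) ≠ 0
  pow_mem : ∀ a ∈ A, a ^ Fintype.card ι ∈ Z

variable {X} {A : Subgroup U} {ι : Type*} [Fintype ι] (F : X.Frame A ι)

namespace Frame

include F in
theorem exists_eq_smul {a b : U} (ha : a ∈ A) (hb : b ∈ A) :
    ∃ y : k, X.u a * X.u b = L.teich y • (X.u b * X.u a) := by
  refine ⟨χ ⟨_, F.comm a ha b hb⟩, ?_⟩
  rw [Algebra.smul_def, ← X.u_central, ← map_mul, ← map_mul, ← map_mul]
  simp [commutatorElement_def]

theorem sum_mul_left {M : Type*} [AddCommMonoid M] (f : U → M)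
    (hf : ∀ a, ∀ z ∈ Z, f (a * z) = f a) {a : U} (ha : a ∈ A) :
    ∑ i, f (a * F.t i) = ∑ i, f (F.t i) := by
  choose e he using fun i => (F.exists_unique _ (A.mul_mem ha (F.mem i))).exists
  have hinj : Function.Injective e := by
    intro i j hij
    refine (F.exists_unique _ (F.mem j)).unique ?_ ?_
    · have h1 := he i
      have h2 := he j
      rw [hij] at h1
      have := Z.mul_mem (Z.inv_mem h1) h2
      convert this using 1
      group
    · simp [Z.one_mem]
  refine Fintype.sum_bijective e (Finite.injective_iff_bijective.1 hinj) _ _ fun i => ?_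
  rw [← hf (F.t (e i)) _ (he i)]
  simp

theorem conj_mul_central (x : R) (a : U) {z : U} (hz : z ∈ Z) :
    X.u (a * z) * x * X.u (a * z)⁻¹ = X.u a * x * X.u a⁻¹ := by
  have h := X.u_central ⟨z, hz⟩
  rw [mul_inv_rev, map_mul, map_mul, mul_assoc (X.u a), mul_assoc (X.u a), mul_assoc (X.u a)]
  change X.u z = _ at h
  rw [h, Algebra.commutes, mul_assoc, ← mul_assoc _ (X.u z⁻¹), ← h, X.u_mul_inv, one_mul]

/-- The inverse of the index. -/
noncomputable def ninv : O :=
  ↑(L.isUnit_of_red (Fintype.card ι : O) (by simpa using F.card_ne_zero)).unit⁻¹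

theorem ninv_mul : F.ninv * (Fintype.card ι : O) = 1 := by
  simp [ninv]

/-- The average over conjugation by the elements of `A`. -/
noncomputable def avg : R →ₗ[O] R :=
  F.ninv • ∑ i, (LinearMap.mulLeft O (X.u (F.t i))) ∘ₗ (LinearMap.mulRight O (X.u (F.t i)⁻¹))

theorem avg_apply (x : R) : F.avg x = F.ninv • ∑ i, X.u (F.t i) * x * X.u (F.t i)⁻¹ := by
  simp [avg, mul_assoc]

theorem u_mul_avg {a : U} (ha : a ∈ A) (x : R) : X.u a * F.avg x = F.avg x * X.u a := by
  have h := F.sum_mul_left (fun g => X.u g * x * X.u g⁻¹)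
    (fun a z hz => conj_mul_central x a hz) ha
  simp only [mul_inv_rev, map_mul] at h
  have h2 : X.u a * F.avg x * X.u a⁻¹ = F.avg x := by
    rw [avg_apply, mul_smul_comm, smul_mul_assoc, Finset.mul_sum, Finset.sum_mul]
    conv_rhs => rw [← h]
    simp only [mul_assoc]
  calc _ = X.u a * F.avg x * (X.u a⁻¹ * X.u a) := by simp
    _ = _ := by rw [← mul_assoc, h2]

theorem avg_mul_left {y : R} (hy : ∀ a ∈ A, X.u a * y = y * X.u a) (x : R) :
    F.avg (y * x) = y * F.avg x := by
  rw [avg_apply, avg_apply, mul_smul_comm, Finset.mul_sum]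
  congr 1
  refine Finset.sum_congr rfl fun i _ => ?_
  rw [← mul_assoc, hy _ (F.mem i)]
  simp only [mul_assoc]

theorem avg_mul_right {y : R} (hy : ∀ a ∈ A, X.u a * y = y * X.u a) (x : R) :
    F.avg (x * y) = F.avg x * y := by
  rw [avg_apply, avg_apply, smul_mul_assoc, Finset.sum_mul]
  congr 1
  refine Finset.sum_congr rfl fun i _ => ?_
  rw [mul_assoc, mul_assoc, ← hy _ (A.inv_mem (F.mem i))]
  simp only [mul_assoc]

theorem avg_one : F.avg 1 = 1 := by
  rw [avg_apply]
  simp [← Nat.cast_smul_eq_nsmul O, smul_smul, F.ninv_mul]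

theorem avg_eq_self {y : R} (hy : ∀ a ∈ A, X.u a * y = y * X.u a) : F.avg y = y := by
  have := F.avg_mul_left hy 1
  rwa [mul_one, F.avg_one, mul_one] at this

theorem avg_algebraMap (c : O) : F.avg (algebraMap O R c) = algebraMap O R c :=
  F.avg_eq_self fun _ _ => (Algebra.commutes _ _).symm

theorem avg_mul_comm {a : U} (ha : a ∈ A) (x : R) :
    F.avg (X.u a * x) = F.avg (x * X.u a) := by
  have h1 : F.avg (X.u a * (x * X.u a) * X.u a⁻¹) = F.avg (x * X.u a) := by
    rw [avg_apply, avg_apply,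
      ← F.sum_mul_left (fun g => X.u g * (x * X.u a) * X.u g⁻¹)
        (fun a z hz => conj_mul_central _ a hz) ha]
    congr 1
    refine Finset.sum_congr rfl fun i _ => ?_
    have hz : (a * F.t i)⁻¹ * (F.t i * a) ∈ Z := by
      have := F.comm _ (A.inv_mem (F.mem i)) _ (A.inv_mem ha)
      convert this using 1
      simp [commutatorElement_def, mul_assoc]
    have := conj_mul_central (X := X) (x * X.u a) (a * F.t i) hz
    rw [mul_inv_cancel_left] at this
    rw [← this, mul_inv_rev, map_mul, map_mul]
    simp only [mul_assoc]
  rw [← h1]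
  simp only [mul_assoc, X.u_mul_inv, mul_one]

theorem avg_u_of_notMem {b : U} (hb : b ∈ A) (hbZ : b ∉ Z) : F.avg (X.u b) = 0 := by
  have h1 : ∃ s : O, F.avg (X.u b) = s • X.u b := by
    choose y hy using fun i => F.exists_eq_smul (F.mem i) hb
    refine ⟨F.ninv * ∑ i, L.teich (y i), ?_⟩
    rw [avg_apply, mul_smul, Finset.sum_smul]
    congr 1
    refine Finset.sum_congr rfl fun i _ => ?_
    rw [hy, smul_mul_assoc, mul_assoc, X.u_mul_inv, mul_one]
  obtain ⟨s, hs⟩ := h1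
  by_contra hne
  refine hbZ (F.nondeg b hb fun a ha => ?_)
  obtain ⟨y, hy⟩ := F.exists_eq_smul hb ha
  by_cases hy1 : y = 1
  · rw [hy, hy1, map_one, one_smul]
  · exfalso
    apply hne
    have hc := F.u_mul_avg ha (X.u b)
    have : (L.teich y - 1) • (F.avg (X.u b) * X.u a) = 0 := by
      rw [sub_smul, one_smul, sub_eq_zero]
      conv_rhs => rw [hs, smul_mul_assoc, hy, smul_comm, ← mul_smul_comm, ← hs, hc]
    have hu : IsUnit (L.teich y - 1) := by
      apply L.isUnit_of_red
      rw [map_sub, L.red_teich, map_one]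
      exact sub_ne_zero.2 hy1
    rw [hu.smul_eq_zero] at this
    calc F.avg (X.u b) = F.avg (X.u b) * X.u a * X.u a⁻¹ := by rw [mul_assoc]; simp
      _ = 0 := by rw [this, zero_mul]

theorem avg_of_mem_sub {x : R} (hx : x ∈ X.sub A) : F.avg x = algebraMap O R (X.form x) := by
  refine X.sub_induction (p := fun x => F.avg x = algebraMap O R (X.form x)) ?_ ?_ ?_ hx
  · simp
  · intro x y hx hy
    rw [map_add, map_add, map_add, hx, hy]
  · intro c a ha
    rw [map_smul, map_smul, smul_eq_mul, map_mul, ← Algebra.smul_def]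
    congr 1
    by_cases haZ : a ∈ Z
    · have := X.u_central ⟨a, haZ⟩
      change X.u a = _ at this
      rw [this, F.avg_algebraMap, X.form_algebraMap]
    · rw [F.avg_u_of_notMem ha haZ, X.form_u_of_notMem haZ, map_zero]

theorem sum_avg (x : R) : ∑ i, F.avg (x * X.u (F.t i)) * X.u (F.t i)⁻¹ = x := by
  have h1 : ∑ i, F.avg (x * X.u (F.t i)) * X.u (F.t i)⁻¹ =
      ∑ j, X.u (F.t j) * x * F.avg (X.u (F.t j)⁻¹) := by
    simp only [avg_apply, mul_smul_comm, smul_mul_assoc, Finset.sum_mul, Finset.mul_sum,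
      ← Finset.smul_sum]
    rw [Finset.sum_comm]
    simp only [mul_assoc]
  obtain ⟨j, hj, huniq⟩ := F.exists_unique 1 A.one_mem
  rw [mul_one] at hj
  rw [h1, Finset.sum_eq_single j]
  · have h2 := X.u_central ⟨_, hj⟩
    change X.u (F.t j)⁻¹ = _ at h2
    rw [h2, F.avg_algebraMap, ← Algebra.commutes, ← mul_assoc, ← h2, X.u_inv_mul, one_mul]
  · intro i _ hi
    rw [F.avg_u_of_notMem (A.inv_mem (F.mem i)), mul_zero]
    intro h
    exact hi (huniq i (by simpa using h))
  · simp

theorem avg_mul (x y : R) :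
    F.avg (x * y) = ∑ i, F.avg (x * X.u (F.t i)) * F.avg (X.u (F.t i)⁻¹ * y) := by
  conv_lhs => rw [← F.sum_avg x, Finset.sum_mul, map_sum]
  refine Finset.sum_congr rfl fun i _ => ?_
  rw [mul_assoc, F.avg_mul_left fun a ha => F.u_mul_avg ha _]

theorem sum_form {x : R} (hx : x ∈ X.sub A) :
    ∑ i, X.form (x * X.u (F.t i)) • X.u (F.t i)⁻¹ = x := by
  conv_rhs => rw [← F.sum_avg x]
  refine Finset.sum_congr rfl fun i _ => ?_
  rw [F.avg_of_mem_sub (mul_mem hx (X.u_mem_sub (F.mem i))), Algebra.smul_def]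

end Frame
end Crossed
end Lifting

end

section

namespace Lifting
open MonoidAlgebra
open scoped commutatorElement

namespace Crossed.Frame
variable {O k : Type*} [CommRing O] [Field k] {L : Lifting O k}
  {U : Type*} [Group U] {Z : Subgroup U} {χ : Z →* k} {R : Type*} [Ring R] [Algebra O R]
  {X : L.Crossed χ R} {A : Subgroup U} {ι : Type*} [Fintype ι] (F : X.Frame A ι)

/-- The matrix of `d ↦ x * d * (u g)⁻¹` on the span of `A`. -/
noncomputable def mat (g : U) (x : R) : Matrix ι ι O :=
  Matrix.of fun i j => X.form (x * X.u (F.t j)⁻¹ * X.u g⁻¹ * X.u (F.t i))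

theorem mat_smul (g : U) (c : O) (x : R) : F.mat g (c • x) = c • F.mat g x := by
  ext i j
  simp [mat]

theorem mat_mul [A.Normal] {g h : U} {x y : R} (hy : y * X.u h⁻¹ ∈ X.sub A) :
    F.mat g x * F.mat h y = F.mat (g * h) (x * y) := by
  ext i l
  have hδ : y * X.u (F.t l)⁻¹ * X.u h⁻¹ ∈ X.sub A := by
    have h1 := X.conj_mem_sub h (X.u_mem_sub (A.inv_mem (F.mem l)))
    have h2 := mul_mem hy h1
    convert h2 using 1
    calc _ = y * (X.u h⁻¹ * X.u h) * X.u (F.t l)⁻¹ * X.u h⁻¹ := by simp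
      _ = _ := by simp only [mul_assoc]
  have h3 := F.sum_form hδ
  have h4 : x * y * X.u (F.t l)⁻¹ * X.u (g * h)⁻¹ * X.u (F.t i) =
      x * (y * X.u (F.t l)⁻¹ * X.u h⁻¹) * X.u g⁻¹ * X.u (F.t i) := by
    rw [mul_inv_rev, map_mul]
    simp only [mul_assoc]
  simp only [Matrix.mul_apply, mat, Matrix.of_apply]
  rw [h4]
  conv_rhs => rw [← h3]
  simp only [Finset.mul_sum, Finset.sum_mul, map_sum, mul_smul_comm, smul_mul_assoc, map_smul,
    smul_eq_mul]
  exact Finset.sum_congr rfl fun j _ => mul_comm _ _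

theorem mat_central [DecidableEq ι] (z : Z) : F.mat z 1 = L.teich (χ z⁻¹) • 1 := by
  ext i j
  have hz : X.u (z : U)⁻¹ = algebraMap O R (L.teich (χ z⁻¹)) := X.u_central z⁻¹
  rw [mat, Matrix.of_apply, one_mul, hz, ← Algebra.commutes, mul_assoc, ← Algebra.smul_def,
    map_smul, Matrix.smul_apply]
  congr 1
  rw [← map_mul]
  by_cases h : i = j
  · rw [h, Matrix.one_apply_eq, inv_mul_cancel, map_one, ← map_one (algebraMap O R),
      X.form_algebraMap]
  · rw [Matrix.one_apply_ne h, X.form_u_of_notMem]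
    intro hm
    exact h ((F.exists_unique _ (F.mem i)).unique (by simp [Z.one_mem]) hm)

theorem mat_one [DecidableEq ι] : F.mat 1 1 = 1 := by
  have := F.mat_central 1
  simpa using this

variable [DecidableEq ι] [A.Normal]

/-- The pairs of a group element `g` and a unit in the centralizer of `A` that differs from `g` by
an element of the span of `A`, suitably normalized. -/
noncomputable def cover : Subgroup (U × Rˣ) where
  carrier := {p | (p.2 : R) * X.u p.1⁻¹ ∈ X.sub A ∧ (↑p.2⁻¹ : R) * X.u p.1 ∈ X.sub A ∧
    (∀ a ∈ A, X.u a * p.2 = p.2 * X.u a) ∧ (F.mat p.1 p.2).det = 1}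
  one_mem' := by simp [one_mem, F.mat_one]
  mul_mem' := by
    rintro ⟨g, x⟩ ⟨h, y⟩ ⟨hg1, hg2, hg3, hg4⟩ ⟨hh1, hh2, hh3, hh4⟩
    dsimp only at *
    refine ⟨?_, ?_, ?_, ?_⟩
    · have := mul_mem hg1 (X.conj_mem_sub g hh1)
      convert this using 1
      calc _ = (x : R) * y * X.u h⁻¹ * X.u g⁻¹ := by simp [mul_assoc]
        _ = (x : R) * (X.u g⁻¹ * X.u g) * (y * X.u h⁻¹) * X.u g⁻¹ := by
          rw [X.u_inv_mul]
          simp [mul_assoc]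
        _ = _ := by simp only [mul_assoc]
    · have h1 := X.conj_mem_sub h⁻¹ hg2
      rw [inv_inv] at h1
      have := mul_mem hh2 h1
      convert this using 1
      calc _ = (↑y⁻¹ : R) * ↑x⁻¹ * X.u g * X.u h := by simp [mul_assoc]
        _ = (↑y⁻¹ : R) * (X.u h * X.u h⁻¹) * (↑x⁻¹ * X.u g) * X.u h := by
          rw [X.u_mul_inv]
          simp [mul_assoc]
        _ = _ := by simp only [mul_assoc]
    · intro a ha
      dsimp
      rw [← mul_assoc, hg3 a ha, mul_assoc, hh3 a ha, mul_assoc]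
    · dsimp
      rw [← F.mat_mul hh1, Matrix.det_mul, hg4, hh4, one_mul]
  inv_mem' := by
    rintro ⟨g, x⟩ ⟨hg1, hg2, hg3, hg4⟩
    dsimp only at *
    have hg2' : (↑x⁻¹ : R) * X.u g⁻¹⁻¹ ∈ X.sub A := by rwa [inv_inv]
    refine ⟨hg2', by simpa using hg1, fun a ha => ?_, ?_⟩
    · exact (Commute.units_inv_right (show Commute (X.u a) (x : R) from hg3 a ha))
    · have := congrArg Matrix.det (F.mat_mul (g := g) (x := (x : R)) hg2')
      simpa [hg4, F.mat_one] using this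

omit [DecidableEq ι] in
include F in
theorem exists_inv_of_commute (g : U) :
    ∃ x : Rˣ, (x : R) * X.u g⁻¹ ∈ X.sub A ∧ (↑x⁻¹ : R) * X.u g ∈ X.sub A ∧
      ∀ a ∈ A, X.u a * x = x * X.u a := by
  have hA : ∀ a ∈ A, ∀ g, g * a * g⁻¹ ∈ A := ‹A.Normal›.conj_mem
  obtain ⟨i, hi⟩ : ∃ i, L.red (X.form (F.avg (X.u g * X.u (F.t i)) * X.u (F.t i)⁻¹ * X.u g⁻¹)) ≠ 0
      := by
    by_contra! h
    have h1 := congrArg (fun x => L.red (X.form (x * X.u g⁻¹))) (F.sum_avg (X.u g))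
    simp only [Finset.sum_mul, map_sum, h, Finset.sum_const_zero, X.u_mul_inv] at h1
    rw [← map_one (algebraMap O R), X.form_algebraMap, map_one] at h1
    exact zero_ne_one h1
  set y := F.avg (X.u g * X.u (F.t i)) with hy
  have hcomm : ∀ a ∈ A, X.u a * y = y * X.u a := fun a ha => F.u_mul_avg ha _
  set d := y * X.u g⁻¹ with hd
  have hyd : y = d * X.u g := by rw [hd, mul_assoc, X.u_inv_mul, mul_one]
  clear_value d
  have hdA : d ∈ X.sub A := by
    rw [hd, hy, avg_apply, smul_mul_assoc, Finset.sum_mul]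
    refine Subalgebra.smul_mem _ (sum_mem fun j _ => ?_) _
    rw [← map_mul, ← map_mul, ← map_mul, ← map_mul]
    refine X.u_mem_sub ?_
    have := A.mul_mem (F.mem j) (hA _ (A.mul_mem (F.mem i) (A.inv_mem (F.mem j))) g)
    convert this using 1
    group
  have h1 : ∀ a ∈ A, X.u a * d = d * X.u (g * a * g⁻¹) := fun a ha => by
    rw [hd, ← mul_assoc, hcomm a ha, mul_assoc, mul_assoc, ← map_mul, ← map_mul]
    congr 2
    group
  have h2 : ∀ a ∈ A, d * X.u a = X.u (g⁻¹ * a * g) * d := fun a ha => by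
    have hm : g⁻¹ * a * g ∈ A := by simpa using hA a ha g⁻¹
    rw [h1 _ hm]
    congr 2
    group
  set b := g * (F.t i)⁻¹ * g⁻¹ with hb
  have hbA : b ∈ A := hA _ (A.inv_mem (F.mem i)) g
  have hu : IsUnit (X.form (d * X.u b)) := by
    apply L.isUnit_of_red
    convert hi using 3
    rw [hd, hb, map_mul, map_mul, mul_assoc y, ← mul_assoc (X.u g⁻¹), ← mul_assoc (X.u g⁻¹),
      X.u_inv_mul, one_mul, mul_assoc]
  obtain ⟨c, hc⟩ := hu
  have hav : F.avg (d * X.u b) = algebraMap O R c := by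
    rw [F.avg_of_mem_sub (mul_mem hdA (X.u_mem_sub hbA)), hc]
  have hav' : F.avg (X.u b * d) = algebraMap O R c := by rw [F.avg_mul_comm hbA, hav]
  obtain ⟨e, heA, he⟩ : ∃ e ∈ X.sub A, d * e = algebraMap O R c := by
    refine ⟨F.ninv • ∑ j, X.u (g * F.t j * g⁻¹) * X.u b * X.u (F.t j)⁻¹, ?_, ?_⟩
    · exact Subalgebra.smul_mem _ (sum_mem fun j _ => mul_mem (mul_mem
        (X.u_mem_sub (hA _ (F.mem j) g)) (X.u_mem_sub hbA)) (X.u_mem_sub (A.inv_mem (F.mem j)))) _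
    · rw [← hav, avg_apply, mul_smul_comm, Finset.mul_sum]
      congr 1
      refine Finset.sum_congr rfl fun j _ => ?_
      rw [← mul_assoc, ← mul_assoc, ← mul_assoc, h1 _ (F.mem j)]
  obtain ⟨e', he'⟩ : ∃ e', e' * d = algebraMap O R c := by
    refine ⟨F.ninv • ∑ j, X.u (F.t j) * X.u b * X.u (g⁻¹ * (F.t j)⁻¹ * g), ?_⟩
    rw [← hav', avg_apply, smul_mul_assoc, Finset.sum_mul]
    congr 1
    refine Finset.sum_congr rfl fun j _ => ?_
    rw [← mul_assoc, mul_assoc _ d, h2 _ (A.inv_mem (F.mem j)), ← mul_assoc]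
  have hr : d * ((↑c⁻¹ : O) • e) = 1 := by
    rw [mul_smul_comm, he, Algebra.smul_def, ← map_mul, Units.inv_mul, map_one]
  have hl : ((↑c⁻¹ : O) • e') * d = 1 := by
    rw [smul_mul_assoc, he', Algebra.smul_def, ← map_mul, Units.inv_mul, map_one]
  have hl' := left_inv_eq_right_inv hl hr
  rw [hl'] at hl
  have heA' := Subalgebra.smul_mem _ heA (↑c⁻¹ : O)
  refine ⟨⟨y, X.u g⁻¹ * ((↑c⁻¹ : O) • e), ?_, ?_⟩, hd ▸ hdA, ?_, hcomm⟩
  · rw [← mul_assoc, ← hd, hr]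
  · rw [hyd, mul_assoc, ← mul_assoc _ d, hl, one_mul, X.u_inv_mul]
  · have := X.conj_mem_sub g⁻¹ heA'
    rwa [inv_inv] at this

theorem exists_mem_cover (g : U) : ∃ x : Rˣ, (g, x) ∈ F.cover := by
  obtain ⟨x, h1, h2, h3⟩ := F.exists_inv_of_commute g
  have hu : IsUnit (F.mat g x).det := by
    have := congrArg Matrix.det (F.mat_mul (g := g) (x := (x : R)) (h := g⁻¹) (y := ↑x⁻¹)
      (by rwa [inv_inv]))
    rw [Matrix.det_mul, mul_inv_cancel, Units.mul_inv, F.mat_one, Matrix.det_one] at this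
    exact IsUnit.of_mul_eq_one _ this
  have : Nontrivial O := L.red.domain_nontrivial
  obtain ⟨s, hs⟩ := L.exists_root _ F.card_ne_zero _ (hu.map L.red).ne_zero
  have hsu : IsUnit s := (isUnit_pow_iff (M := O) (n := Fintype.card ι)
    (fun h => F.card_ne_zero (by rw [h, Nat.cast_zero]))).1 (hs ▸ hu)
  obtain ⟨s, rfl⟩ := hsu
  have hx : ((Units.map (algebraMap O R : O →* R) s⁻¹ * x : Rˣ) : R) = (↑s⁻¹ : O) • (x : R) := by
    rw [Algebra.smul_def]
    rfl
  have hx' : ((Units.map (algebraMap O R : O →* R) s⁻¹ * x : Rˣ)⁻¹ : Rˣ) =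
      (s : O) • (↑x⁻¹ : R) := by
    rw [Algebra.smul_def, mul_inv_rev, Units.val_mul, Algebra.commutes, ← map_inv, inv_inv]
    rfl
  refine ⟨Units.map (algebraMap O R : O →* R) s⁻¹ * x, ?_, ?_, ?_, ?_⟩
  · dsimp only
    rw [hx, smul_mul_assoc]
    exact Subalgebra.smul_mem _ h1 _
  · dsimp only
    rw [hx', smul_mul_assoc]
    exact Subalgebra.smul_mem _ h2 _
  · intro a ha
    dsimp only
    rw [hx, smul_mul_assoc, mul_smul_comm, h3 a ha]
  · dsimp only
    rw [hx, mat_smul, Matrix.det_smul, ← hs, ← mul_pow, Units.inv_mul, one_pow]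

theorem eq_algebraMap_of_mem_cover {a : U} (ha : a ∈ A) {x : Rˣ} (hx : (a, x) ∈ F.cover) :
    (x : R) = algebraMap O R (X.form x) := by
  have h1 : (x : R) ∈ X.sub A := by
    have := mul_mem hx.1 (X.u_mem_sub ha)
    dsimp only at this
    rwa [mul_assoc, X.u_inv_mul, mul_one] at this
  rw [← F.avg_of_mem_sub h1, F.avg_eq_self hx.2.2.1]

theorem red_form_ne_zero {a : U} (ha : a ∈ A) {x : Rˣ} (hx : (a, x) ∈ F.cover) :
    L.red (X.form x) ≠ 0 := by
  have h1 := F.eq_algebraMap_of_mem_cover ha hx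
  have h2 := F.eq_algebraMap_of_mem_cover (A.inv_mem ha) (F.cover.inv_mem hx)
  have h3 := congrArg X.form x.mul_inv
  dsimp only at h2
  rw [h1, h2, ← map_mul, X.form_algebraMap, ← map_one (algebraMap O R), X.form_algebraMap] at h3
  intro h
  have := congrArg L.red h3
  rw [map_mul, h, zero_mul, map_one] at this
  exact zero_ne_one this

theorem form_eq_teich {a : U} (ha : a ∈ A) {x : Rˣ} (hx : (a, x) ∈ F.cover) :
    X.form x = L.teich (L.red (X.form x)) := by
  set c := X.form x with hc
  have h1 := F.eq_algebraMap_of_mem_cover ha hx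
  rw [← hc] at h1
  have hpow : ∀ n : ℕ, F.mat a 1 ^ n = F.mat (a ^ n) 1 := by
    intro n
    induction n with
    | zero => simp [F.mat_one]
    | succ n ih =>
      rw [pow_succ, ih, F.mat_mul (by rw [one_mul]; exact X.u_mem_sub (A.inv_mem ha)), one_mul,
        pow_succ]
  have h2 : (F.mat a x).det = 1 := hx.2.2.2
  rw [h1, Algebra.algebraMap_eq_smul_one, mat_smul] at h2
  have h3 := congrArg (· ^ Fintype.card ι) h2
  simp only [one_pow] at h3
  have h4 := F.mat_central ⟨_, F.pow_mem a ha⟩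
  dsimp only at h4
  rw [← Matrix.det_pow, smul_pow, hpow, h4, smul_smul, Matrix.det_smul, Matrix.det_one, mul_one,
    mul_pow, ← map_pow L.teich] at h3
  set b : k := χ (⟨_, F.pow_mem a ha⟩ : Z)⁻¹ ^ Fintype.card ι with hb
  have hb0 : b ≠ 0 := by
    intro h
    rw [h] at h3
    have := congrArg L.red h3
    rw [map_mul, L.red_teich, mul_zero, map_one] at this
    exact zero_ne_one this
  refine L.eq_teich (M := Fintype.card ι * Fintype.card ι) (b := b⁻¹) ?_ (F.red_form_ne_zero ha hx) ?_
  · rw [Nat.cast_mul]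
    exact mul_ne_zero F.card_ne_zero F.card_ne_zero
  · calc c ^ (Fintype.card ι * Fintype.card ι) =
        (c ^ Fintype.card ι) ^ Fintype.card ι * (L.teich b * L.teich b⁻¹) := by
          rw [← map_mul, mul_inv_cancel₀ hb0, map_one, mul_one, pow_mul]
      _ = L.teich b⁻¹ := by rw [← mul_assoc, h3, one_mul]

theorem avg_u {g : U} {x : Rˣ} (hx : (g, x) ∈ F.cover) :
    ∃ c : O, F.avg (X.u g) = c • (x : R) := by
  refine ⟨X.form (X.u g * ↑x⁻¹), ?_⟩
  have h1 : X.u g * ↑x⁻¹ ∈ X.sub A := by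
    have := X.conj_mem_sub g hx.2.1
    dsimp only at this
    rwa [mul_assoc, mul_assoc, X.u_mul_inv, mul_one] at this
  rw [Algebra.smul_def, ← F.avg_of_mem_sub h1, ← F.avg_mul_right hx.2.2.1]
  dsimp only
  rw [mul_assoc, Units.inv_mul, mul_one]

end Crossed.Frame
end Lifting

end

section

namespace Lifting
open MonoidAlgebra

namespace Crossed.Frame
variable {O k : Type*} [CommRing O] [Field k] {L : Lifting O k}
  {U : Type*} [Group U] {Z : Subgroup U} {χ : Z →* k} {R : Type*} [Ring R] [Algebra O R]
  {X : L.Crossed χ R} {A : Subgroup U} {ι : Type*} [Fintype ι] (F : X.Frame A ι)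
  [DecidableEq ι] [A.Normal]

/-- The part of the cover that lies over `A`. -/
noncomputable def coverKer : Subgroup F.cover :=
  A.comap ((MonoidHom.fst U Rˣ).comp F.cover.subtype)

/-- The projection of the cover to the units. -/
noncomputable def coverUnit : F.cover →* R :=
  (Units.coeHom R).comp ((MonoidHom.snd U Rˣ).comp F.cover.subtype)

theorem coverUnit_eq {p : F.cover} (hp : p ∈ F.coverKer) :
    F.coverUnit p = algebraMap O R (X.form (F.coverUnit p)) :=
  F.eq_algebraMap_of_mem_cover hp p.2

/-- The central character of the cover. -/
noncomputable def coverChar : F.coverKer →* k where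
  toFun p := L.red (X.form (F.coverUnit p))
  map_one' := by
    rw [OneMemClass.coe_one, map_one, ← map_one (algebraMap O R), X.form_algebraMap, map_one]
  map_mul' p q := by
    rw [Subgroup.coe_mul, map_mul, F.coverUnit_eq p.2, F.coverUnit_eq q.2, ← map_mul,
      X.form_algebraMap, map_mul, X.form_algebraMap, X.form_algebraMap]

theorem form_coverUnit {p : F.cover} (hp : p ∈ F.coverKer) :
    X.form (F.coverUnit p) = L.teich (F.coverChar ⟨p, hp⟩) :=
  F.form_eq_teich hp p.2

theorem form_coverUnit_of_notMem {p : F.cover} (hp : p ∉ F.coverKer) :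
    X.form (F.coverUnit p) = 0 := by
  have key : ∀ d ∈ X.sub A, X.form (d * X.u p.1.1) = 0 := by
    intro d hd
    refine X.sub_induction (p := fun d => X.form (d * X.u p.1.1) = 0) ?_ ?_ ?_ hd
    · simp
    · intro x y hx hy
      rw [add_mul, map_add, hx, hy, add_zero]
    · intro c a ha
      rw [smul_mul_assoc, map_smul, ← map_mul, X.form_u_of_notMem, smul_zero]
      intro h
      exact hp ((A.mul_mem_cancel_left ha).1 (F.le h))
  have := key _ p.2.1
  rwa [mul_assoc, X.u_inv_mul, mul_one] at this

/-- The group algebra of the cover acts through the crossed product. -/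
noncomputable def coverMap : MonoidAlgebra O F.cover →ₐ[O] R := lift O R F.cover F.coverUnit

theorem coverMap_of (p : F.cover) : F.coverMap (of O _ p) = F.coverUnit p := by
  simp [coverMap]

theorem form_coverMap (x : MonoidAlgebra O F.cover) :
    X.form (F.coverMap x) = L.tr F.coverChar x := by
  induction x using MonoidAlgebra.induction_on with
  | of p =>
    rw [coverMap_of]
    by_cases hp : p ∈ F.coverKer
    · rw [F.form_coverUnit hp, ← L.tr_of_mem]
    · rw [F.form_coverUnit_of_notMem hp, L.tr_of_notMem _ hp]
  | add x y hx hy => rw [map_add, map_add, map_add, hx, hy]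
  | smul c x hx => rw [map_smul, map_smul, map_smul, hx]

theorem avg_mem_range (x : R) : F.avg x ∈ F.coverMap.range := by
  refine X.induction (p := fun x => F.avg x ∈ F.coverMap.range) ?_ ?_ ?_ x
  · rw [map_zero]
    exact zero_mem _
  · intro x y hx hy
    rw [map_add]
    exact add_mem hx hy
  · intro c g
    obtain ⟨x, hx⟩ := F.exists_mem_cover g
    obtain ⟨c', hc'⟩ := F.avg_u hx
    rw [map_smul, hc']
    have : (x : R) ∈ F.coverMap.range := ⟨of O _ ⟨_, hx⟩, F.coverMap_of _⟩
    exact Subalgebra.smul_mem _ (Subalgebra.smul_mem _ this _) _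

theorem isFilt_map {V : Type*} [AddCommGroup V] [Module k V]
    {σ : F.cover →* Module.End k V} {J : ℕ → AddSubgroup (MonoidAlgebra O F.cover)}
    (hJ : L.IsGood F.coverChar σ J) :
    IsFilt L.unif fun n => (J n).map (F.coverMap : MonoidAlgebra O F.cover →+ R) where
  mul_mem := by
    rintro n m _ _ ⟨x, hx, rfl⟩ ⟨y, hy, rfl⟩
    exact ⟨x * y, hJ.mul_mem hx hy, map_mul F.coverMap x y⟩
  dvd := by
    rintro n c ⟨x, hx, hxc⟩
    change F.coverMap x = _ at hxc
    refine hJ.dvd (n := n) ?_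
    have : x - algebraMap O _ c ∈ J n := by
      refine L.mem_of_tr_eq_zero (hJ.mul_left n) (hJ.mul_right n) (hJ.central n) fun g => ?_
      rw [← F.form_coverMap, map_mul, map_sub, hxc, AlgHom.commutes, sub_self, mul_zero, map_zero]
    have := (J n).sub_mem hx this
    rwa [sub_sub_cancel] at this

theorem exists_isGood {V : Type*} [AddCommGroup V] [Module k V]
    {σ : U →* Module.End k V} {ρ : R →+* Module.End k V} (hρ : ∀ x, ρ (X.map x) = L.act σ x)
    {J : ℕ → AddSubgroup (MonoidAlgebra O F.cover)}
    (hJ : L.IsGood F.coverChar ((ρ : R →* Module.End k V).comp F.coverUnit) J) :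
    ∃ J, L.IsGood χ σ J := by
  have hρc : ∀ c, ρ (algebraMap O R c) = algebraMap k _ (L.red c) := fun c => by
    rw [← AlgHom.commutes X.map, hρ, act_algebraMap]
  have hact : ∀ x, ρ (F.coverMap x) =
      L.act ((ρ : R →* Module.End k V).comp F.coverUnit) x := by
    intro x
    induction x using MonoidAlgebra.induction_on with
    | of p =>
      rw [coverMap_of, of_apply, act_single, map_one, one_smul]
      rfl
    | add x y hx hy => rw [map_add, map_add, map_add, hx, hy]
    | smul c x hx => rw [Algebra.smul_def, map_mul, map_mul, map_mul, hx, AlgHom.commutes, hρc,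
        act_algebraMap]
  let π : MonoidAlgebra O U →+ R := F.avg.toAddMonoidHom.comp (X.map : MonoidAlgebra O U →+ R)
  have hπ : ∀ x, π x = F.avg (X.map x) := fun x => rfl
  have hfilt := IsFilt.core (F.isFilt_map hJ) (π := π)
    (fun c => by rw [hπ, AlgHom.commutes, F.avg_algebraMap])
    (fun x y => by
      rw [hπ, map_mul X.map, F.avg_mul]
      refine AddSubgroup.sum_mem _ fun i _ => AddSubgroup.subset_closure
        ⟨of O U (F.t i), of O U (F.t i)⁻¹, ?_⟩
      rw [hπ, hπ, map_mul X.map, map_mul X.map]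
      rfl)
  refine ⟨_, ⟨hfilt, fun n r x h => AddSubgroup.mul_mem_core_left r h,
    fun n r x h => AddSubgroup.mul_mem_core_right r h, fun n z u w => ?_, fun x hx u w => ?_⟩⟩
  · rw [hπ, map_mul X.map, map_mul X.map, map_sub, X.map_central, AlgHom.commutes, sub_self, mul_zero,
      zero_mul, map_zero]
    exact zero_mem _
  · obtain ⟨y, hy⟩ := F.avg_mem_range (X.map (u * x * w))
    refine ⟨y, hJ.ker y ?_, hy⟩
    rw [← hact, show F.coverMap y = _ from hy, avg_apply, Algebra.smul_def, map_mul, map_sum]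
    refine mul_eq_zero_of_right _ (Finset.sum_eq_zero fun i _ => ?_)
    simp only [map_mul, hρ, hx, mul_zero, zero_mul]

end Crossed.Frame
end Lifting

end

section

theorem Module.End.exists_common_eigenvector {k V ι : Type*} [Field k] [IsAlgClosed k]
    [AddCommGroup V] [Module k V] [FiniteDimensional k V] [Nontrivial V]
    (f : ι → Module.End k V) (hf : ∀ i j, f i * f j = f j * f i) :
    ∃ v ≠ 0, ∀ i, ∃ c : k, f i v = c • v := by
  let S : Set (Submodule k V) := {W | W ≠ ⊥ ∧ ∀ i, ∀ w ∈ W, f i w ∈ W}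
  obtain ⟨W, ⟨hW0, hWs⟩, hmin⟩ := wellFounded_lt.has_min S ⟨⊤, top_ne_bot, by simp⟩
  have : Nontrivial W := Submodule.nontrivial_iff_ne_bot.2 hW0
  obtain ⟨v, hvW, hv0⟩ := W.exists_mem_ne_zero_of_ne_bot hW0
  refine ⟨v, hv0, fun i => ?_⟩
  obtain ⟨c, hc⟩ := Module.End.exists_eigenvalue ((f i).restrict (hWs i))
  refine ⟨c, ?_⟩
  let W' : Submodule k V := W ⊓ (f i).eigenspace c
  have hW' : W' ∈ S := by
    refine ⟨?_, fun j w hw => ⟨hWs j w hw.1, ?_⟩⟩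
    · obtain ⟨w, hw⟩ := hc.exists_hasEigenvector
      refine (Submodule.ne_bot_iff _).2 ⟨w, ⟨w.2, ?_⟩, ?_⟩
      · exact Module.End.mem_eigenspace_iff.2 (congrArg Subtype.val hw.apply_eq_smul)
      · simpa using hw.2
    · have h1 := Module.End.mem_eigenspace_iff.1 hw.2
      apply Module.End.mem_eigenspace_iff.2
      have := LinearMap.congr_fun (hf i j) w
      rw [Module.End.mul_apply, Module.End.mul_apply, h1, map_smul] at this
      exact this
  have hle : W' = W := by
    by_contra hne
    exact hmin W' hW' (lt_of_le_of_ne inf_le_left hne)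
  rw [← hle] at hvW
  exact Module.End.mem_eigenspace_iff.1 hvW.2

namespace Lifting
open MonoidAlgebra

section
variable {O k : Type*} [CommRing O] [Field k] {L : Lifting O k}
  {U : Type*} [Group U] {Z : Subgroup U} {V : Type*} [AddCommGroup V] [Module k V]

theorem mapRingHom_incl_restr (H : Subgroup U) (x : MonoidAlgebra O U) :
    mapRingHom U L.red (incl H (restr H x)) = incl H (restr H (mapRingHom U L.red x)) := by
  classical
  induction x using MonoidAlgebra.induction_on with
  | of g =>
    by_cases hg : g ∈ H
    · have h1 : of O U g = incl H (single ⟨g, hg⟩ 1) := by simp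
      have h2 : of k U g = incl H (single ⟨g, hg⟩ 1) := by simp
      have h3 : mapRingHom U L.red (of O U g) = of k U g := by simp [mapRingHom_single]
      rw [h3, h1, restr_incl, h2, restr_incl, ← h1, ← h2, h3]
    · have h3 : mapRingHom U L.red (of O U g) = of k U g := by simp [mapRingHom_single]
      rw [h3, restr_of_notMem hg, restr_of_notMem hg, map_zero, map_zero, map_zero]
  | add x y hx hy => simp only [map_add, hx, hy]
  | smul c x hx =>
    have h : ∀ z : MonoidAlgebra O U,
        mapRingHom U L.red (c • z) = L.red c • mapRingHom U L.red z := by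
      intro z
      rw [Algebra.smul_def, map_mul, Algebra.smul_def]
      congr 1
      simp [MonoidAlgebra.coe_algebraMap, mapRingHom_single]
    rw [map_smul, map_smul, h, hx, h, map_smul, map_smul]

theorem char_conj [Nontrivial V] {χ : Z →* k} {σ : U →* Module.End k V}
    (hσ : ∀ (z : Z) v, σ z v = χ z • v) (g : U) (z : Z) (h : g * (z : U) * g⁻¹ ∈ Z) :
    χ ⟨_, h⟩ = χ z := by
  obtain ⟨v, hv⟩ := exists_ne (0 : V)
  have hinj : σ g v ≠ 0 := by
    intro h0
    apply hv
    have : σ g⁻¹ (σ g v) = v := by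
      rw [← Module.End.mul_apply, ← map_mul, inv_mul_cancel, map_one, Module.End.one_apply]
    rw [← this, h0, map_zero]
  have h1 := hσ ⟨_, h⟩ (σ g v)
  dsimp only at h1
  rw [← Module.End.mul_apply, ← map_mul, inv_mul_cancel_right, map_mul, Module.End.mul_apply,
    hσ, map_smul] at h1
  exact (smul_left_injective k hinj h1).symm

/-- The stabilizer of a character of a normal subgroup. -/
def charStabilizer {A : Subgroup U} [A.Normal] (ψ : A →* k) : Subgroup U where
  carrier := {h | ∀ a, ψ (MulAut.conjNormal h a) = ψ a}
  one_mem' := by simp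
  mul_mem' := by
    intro g h hg hh a
    rw [map_mul, MulAut.mul_apply, hg, hh]
  inv_mem' := by
    intro g hg a
    rw [← hg, ← MulAut.mul_apply, ← map_mul, mul_inv_cancel, map_one, MulAut.one_apply]

theorem le_charStabilizer {A : Subgroup U} [A.Normal] (ψ : A →* k) : A ≤ charStabilizer ψ := by
  intro h hh a
  have : MulAut.conjNormal h a = ⟨h, hh⟩ * a * ⟨h, hh⟩⁻¹ := Subtype.ext (by simp)
  rw [this, map_mul, mul_comm, ← map_mul, ← mul_assoc, inv_mul_cancel, one_mul]

/-- The weight space of a character. -/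
def weightSpace (σ : U →* Module.End k V) {A : Subgroup U} (ψ : A →* k) : Submodule k V where
  carrier := {v | ∀ a : A, σ a v = ψ a • v}
  zero_mem' := by simp
  add_mem' := by
    intro v w hv hw a
    rw [map_add, hv, hw, smul_add]
  smul_mem' := by
    intro c v hv a
    rw [map_smul, hv, smul_comm]

theorem apply_mem_weightSpace {σ : U →* Module.End k V} {A : Subgroup U} [A.Normal] {ψ : A →* k}
    {h : U} (hh : h ∈ charStabilizer ψ) {v : V} (hv : v ∈ weightSpace σ ψ) :
    σ h v ∈ weightSpace σ ψ := by
  intro a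
  have h1 := hv (MulAut.conjNormal h⁻¹ a)
  rw [(charStabilizer ψ).inv_mem hh] at h1
  rw [← map_smul, ← h1, ← Module.End.mul_apply, ← Module.End.mul_apply, ← map_mul, ← map_mul]
  simp [mul_assoc]

/-- The representation of the stabilizer on the weight space. -/
def weightRep (σ : U →* Module.End k V) {A : Subgroup U} [A.Normal] (ψ : A →* k) :
    charStabilizer ψ →* Module.End k (weightSpace σ ψ) where
  toFun h := (σ h).restrict fun _ hv => apply_mem_weightSpace h.2 hv
  map_one' := by
    ext
    simp
  map_mul' g h := by
    ext
    simp

theorem coe_act_weightRep (σ : U →* Module.End k V) {A : Subgroup U} [A.Normal] (ψ : A →* k)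
    (x : MonoidAlgebra O (charStabilizer ψ)) (v : weightSpace σ ψ) :
    (L.act (weightRep σ ψ) x v : V) = L.act σ (incl _ x) v := by
  induction x using MonoidAlgebra.induction_linear with
  | zero => simp
  | add x y hx hy => simp [hx, hy]
  | single h c => simp [act_single, weightRep]

/-- The restriction of a character to a larger group. -/
noncomputable def charOf {A H : Subgroup U} (h : A ≤ H) (ψ : A →* k) : A.subgroupOf H →* k :=
  ψ.comp (Subgroup.subgroupOfEquivOfLe h).toMonoidHom

theorem exists_isGood_of_stabilizer {χ : Z →* k} {σ : U →* Module.End k V} [Z.Normal]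
    (hχ : ∀ g (z : Z) (h : g * (z : U) * g⁻¹ ∈ Z), χ ⟨_, h⟩ = χ z)
    {A : Subgroup U} [A.Normal] (hZA : Z ≤ A) (ψ : A →* k)
    (hψ : ∀ z : Z, ψ (Subgroup.inclusion hZA z) = χ z)
    {J : ℕ → AddSubgroup (MonoidAlgebra O (charStabilizer ψ))}
    (hJ : L.IsGood (charOf (le_charStabilizer ψ) ψ) (weightRep σ ψ) J) :
    ∃ J, L.IsGood χ σ J := by
  let H := charStabilizer ψ
  have hAH : A ≤ H := le_charStabilizer ψ
  have hfilt := IsFilt.core hJ.toIsFilt (π := (restr H : MonoidAlgebra O U →ₗ[O] _).toAddMonoidHom)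
    (fun c => by
      change restr H (algebraMap O _ c) = _
      rw [Algebra.algebraMap_eq_smul_one, map_smul, restr_one, Algebra.algebraMap_eq_smul_one])
    (fun x y => by
      obtain ⟨F, hF⟩ := exists_restr_mul H y
      change restr H (x * y) ∈ _
      rw [hF]
      exact AddSubgroup.sum_mem _ fun g _ => AddSubgroup.subset_closure ⟨of O U g, of O U g⁻¹, rfl⟩)
  refine ⟨_, ⟨hfilt, fun n r x h => AddSubgroup.mul_mem_core_left r h,
    fun n r x h => AddSubgroup.mul_mem_core_right r h, fun n z u w => ?_, fun x hx u w => ?_⟩⟩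
  · change restr H _ ∈ J n
    induction u using MonoidAlgebra.induction_linear with
    | zero => simp [zero_mem]
    | add x y hx hy =>
      rw [add_mul, add_mul, map_add]
      exact (J n).add_mem hx hy
    | single g c =>
      have hz := ‹Z.Normal›.conj_mem z z.2 g
      have hzH := hAH (hZA hz)
      have h1 : (single g c : MonoidAlgebra O U) * (of O U z - algebraMap O _ (L.teich (χ z))) =
          incl H (of O H ⟨_, hzH⟩ - algebraMap O _ (L.teich (χ z))) * single g c := by
        rw [mul_sub, map_sub, sub_mul, AlgHom.commutes, Algebra.commutes]
        simp
      rw [h1, mul_assoc, restr_incl_mul]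
      refine hJ.mul_right _ _ _ ?_
      have h2 := hJ.central n ⟨⟨_, hzH⟩, hZA hz⟩
      have h3 : charOf (le_charStabilizer ψ) ψ ⟨⟨_, hzH⟩, hZA hz⟩ = χ z := by
        rw [← hχ g z hz, ← hψ]
        rfl
      rwa [h3] at h2
  · refine hJ.ker _ (LinearMap.ext fun v => Subtype.ext ?_)
    change (L.act (weightRep σ ψ) (restr H (u * x * w)) v : V) = 0
    rw [coe_act_weightRep]
    change lift k _ U σ (mapRingHom U L.red (incl H (restr H (u * x * w)))) v = 0
    rw [mapRingHom_incl_restr]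
    have h0 : L.act σ (u * x * w) = 0 := by rw [map_mul, map_mul, hx, mul_zero, zero_mul]
    refine restr_apply_eq_zero_of_weight (ρ := σ) (A := A) (C := H)
      (V₁ := (weightSpace σ ψ).toAddSubgroup) hAH (fun g hg v hv => apply_mem_weightSpace hg hv)
      (fun r v hv => (weightSpace σ ψ).smul_mem r hv) ?_ ?_ ?_ v v.2
    · intro g hg b hb v hv
      have h1 := hv ⟨b, hb⟩
      have h2 := apply_mem_weightSpace hg hv ⟨b, hb⟩
      dsimp only at h1 h2
      rw [map_mul, map_mul, Module.End.mul_apply, Module.End.mul_apply, h1, h2, map_smul]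
    · intro g hg
      have hg' : ¬ ∀ a, ψ (MulAut.conjNormal g a) = ψ a := hg
      push Not at hg'
      obtain ⟨a, ha⟩ := hg'
      refine ⟨a, a.2, fun v hv h => ?_⟩
      have h1 := hv a
      have h2 := hv (MulAut.conjNormal g a)
      rw [MulAut.conjNormal_apply, ← h, h1] at h2
      by_contra hv0
      exact ha (smul_left_injective k hv0 h2).symm
    · intro v _
      exact LinearMap.congr_fun h0 v

theorem exists_char_of_commute [IsAlgClosed k] [FiniteDimensional k V] [Nontrivial V]
    {σ : U →* Module.End k V} {A : Subgroup U} (hA : ∀ a ∈ A, ∀ b ∈ A, σ a * σ b = σ b * σ a) :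
    ∃ ψ : A →* k, ∃ v ≠ 0, v ∈ weightSpace σ ψ := by
  obtain ⟨v, hv0, hv⟩ := Module.End.exists_common_eigenvector (fun a : A => σ a)
    fun a b => hA a a.2 b b.2
  choose ψ hψ using hv
  refine ⟨⟨⟨ψ, ?_⟩, ?_⟩, v, hv0, hψ⟩
  · apply smul_left_injective k hv0
    dsimp only
    rw [← hψ]
    simp
  · intro a b
    apply smul_left_injective k hv0
    dsimp only
    rw [← hψ, Subgroup.coe_mul, map_mul, Module.End.mul_apply, hψ, map_smul, hψ, smul_smul,
      mul_comm]

end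
end Lifting

end

section

open scoped commutatorElement in
theorem Subgroup.exists_lt_of_derivedSeries_le {U : Type*} [Group U] {Z : Subgroup U} [Z.Normal]
    (hZ : Z ≠ ⊤) {m : ℕ} (hm : derivedSeries U m ≤ Z) :
    ∃ A : Subgroup U, A.Normal ∧ Z < A ∧ ∀ a ∈ A, ∀ b ∈ A, ⁅a, b⁆ ∈ Z := by
  induction m with
  | zero => exact absurd (top_le_iff.1 hm) hZ
  | succ j ih =>
    by_cases hj : derivedSeries U j ≤ Z
    · exact ih hj
    refine ⟨Z ⊔ derivedSeries U j, inferInstance, left_lt_sup.2 hj, fun a ha b hb => ?_⟩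
    obtain ⟨z, hz, d, hd, rfl⟩ := Subgroup.mem_sup_of_normal_left.1 ha
    obtain ⟨y, hy, e, he, rfl⟩ := Subgroup.mem_sup_of_normal_left.1 hb
    have hde : ⁅d, e⁆ ∈ Z := hm (Subgroup.commutator_mem_commutator hd he)
    rw [← QuotientGroup.eq_one_iff] at hz hy hde ⊢
    rw [← QuotientGroup.mk'_apply] at hz hy hde ⊢
    rw [map_commutatorElement] at hde ⊢
    rw [map_mul, map_mul, hz, hy, one_mul, one_mul, hde]

namespace Lifting
open MonoidAlgebra

section
variable {k : Type*} [Field k] {U : Type*} [Group U] {Z : Subgroup U} {V : Type*}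
  [AddCommGroup V] [Module k V]

/-- The elements of `A` that commute with `A` in a representation. -/
noncomputable def radical (σ : U →* Module.End k V) (A : Subgroup U) : Subgroup U :=
  A ⊓ (Subgroup.centralizer (A.map σ.toHomUnits.rangeRestrict : Set _)).comap
    σ.toHomUnits.rangeRestrict

theorem mem_radical {σ : U →* Module.End k V} {A : Subgroup U} {a : U} :
    a ∈ radical σ A ↔ a ∈ A ∧ ∀ b ∈ A, σ a * σ b = σ b * σ a := by
  rw [radical, Subgroup.mem_inf, Subgroup.mem_comap, Subgroup.mem_centralizer_iff]
  refine and_congr_right fun _ => ⟨fun h b hb => ?_, ?_⟩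
  · have := h _ ⟨b, hb, rfl⟩
    exact (congrArg (fun u => ((u : (Module.End k V)ˣ) : Module.End k V)) (congrArg Subtype.val this)).symm
  · rintro h _ ⟨b, hb, rfl⟩
    exact Subtype.ext (Units.ext (h b hb).symm)

instance (σ : U →* Module.End k V) (A : Subgroup U) [A.Normal] : (radical σ A).Normal := by
  have : (A.map σ.toHomUnits.rangeRestrict).Normal :=
    ‹A.Normal›.map _ σ.toHomUnits.rangeRestrict_surjective
  unfold radical
  infer_instance

open scoped commutatorElement in
theorem cast_relIndex_ne_zero {q : ℕ} [Fact q.Prime] [CharP k q] [Nontrivial V] [Z.Normal]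
    {χ : Z →* k} {σ : U →* Module.End k V} (hσ : ∀ (z : Z) v, σ z v = χ z • v)
    {A : Subgroup U} [Finite (A ⧸ Z.subgroupOf A)]
    (hA : ∀ a ∈ A, ∀ b ∈ A, ⁅a, b⁆ ∈ Z) (hr : radical σ A ≤ Z) :
    (Nat.card (A ⧸ Z.subgroupOf A) : k) ≠ 0 := by
  intro h0
  rw [CharP.cast_eq_zero_iff k q] at h0
  obtain ⟨x, hx⟩ := exists_prime_orderOf_dvd_card' q h0
  obtain ⟨a, rfl⟩ := QuotientGroup.mk_surjective x
  have haq : (a : U) ^ q ∈ Z := by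
    have h1 := pow_orderOf_eq_one (a : A ⧸ Z.subgroupOf A)
    rw [hx, ← QuotientGroup.mk_pow, QuotientGroup.eq_one_iff] at h1
    exact h1
  have haZ : (a : U) ∉ Z := by
    intro h
    have h1 : (a : A ⧸ Z.subgroupOf A) = 1 := (QuotientGroup.eq_one_iff _).2 h
    rw [h1, orderOf_one] at hx
    exact (Fact.out : q.Prime).one_lt.ne hx
  apply haZ
  apply hr
  refine mem_radical.2 ⟨a.2, fun b hb => ?_⟩
  obtain ⟨v, hv⟩ := exists_ne (0 : V)
  have hinj : ∀ g : U, Function.Injective (σ g) := fun g x y hxy => by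
    have h1 : ∀ w, σ g⁻¹ (σ g w) = w := fun w => by
      rw [← Module.End.mul_apply, ← map_mul, inv_mul_cancel, map_one, Module.End.one_apply]
    rw [← h1 x, hxy, h1]
  set y := χ ⟨_, hA a a.2 b hb⟩ with hy
  have hcomm : ∀ w, σ a (σ b w) = y • σ b (σ a w) := by
    intro w
    rw [hy, ← hσ ⟨_, hA a a.2 b hb⟩]
    simp only [← Module.End.mul_apply, ← map_mul]
    simp [commutatorElement_def, mul_assoc]
  have hpow : ∀ n : ℕ, ∀ w, σ (a ^ n) (σ b w) = y ^ n • σ b (σ (a ^ n) w) := by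
    intro n
    induction n with
    | zero => simp
    | succ n ih =>
      intro w
      rw [pow_succ', map_mul, Module.End.mul_apply, ih, map_smul, hcomm, smul_smul, pow_succ,
        Module.End.mul_apply]
  have hyq : y ^ q = 1 := by
    have h1 := hpow q v
    have h2 := hσ ⟨_, haq⟩
    dsimp only at h2
    rw [h2, h2, map_smul] at h1
    have h3 : χ ⟨_, haq⟩ ≠ 0 := by
      intro h
      have := h2 v
      rw [h, zero_smul] at this
      exact hv (hinj _ (this.trans (map_zero _).symm))
    have h4 : σ b v ≠ 0 := fun h => hv (hinj _ (h.trans (map_zero _).symm))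
    rw [smul_smul] at h1
    have h5 := smul_left_injective k h4 h1
    exact mul_right_cancel₀ h3 (h5.symm.trans (one_mul _).symm)
  have hy1 : y = 1 := frobenius_inj k q (by rw [frobenius_def, hyq, map_one])
  ext w
  rw [Module.End.mul_apply, Module.End.mul_apply, hcomm, hy1, one_smul]

end

theorem exists_isGood {O : Type} {k : Type*} [CommRing O] [Field k] [IsAlgClosed k] {q : ℕ}
    [Fact q.Prime] [CharP k q] (L : Lifting O k) {U V : Type*} [Group U] (Z : Subgroup U)
    [Z.Normal] [AddCommGroup V] [Module k V] [FiniteDimensional k V] [Nontrivial V] (χ : Z →* k)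
    (σ : U →* Module.End k V) (hσ : ∀ (z : Z) v, σ z v = χ z • v) (hZ : Z.index ≠ 0) {m : ℕ}
    (hm : derivedSeries U m ≤ Z) : ∃ J, L.IsGood χ σ J := by
  induction hn : Z.index using Nat.strong_induction_on generalizing U V with
  | _ n ih =>
  subst hn
  by_cases htop : Z = ⊤
  · exact L.exists_isGood_of_top htop hσ
  have hχ := char_conj hσ
  obtain ⟨A, hAn, hZA, hA⟩ := Subgroup.exists_lt_of_derivedSeries_le htop hm
  have hlt : ∀ B : Subgroup U, Z < B → B.index < Z.index ∧ B.index ≠ 0 := by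
    intro B hB
    have h0 : B.index ≠ 0 := fun h => hZ (Nat.eq_zero_of_zero_dvd (h ▸ Subgroup.index_dvd_of_le hB.le))
    refine ⟨?_, h0⟩
    have : Z.FiniteIndex := ⟨hZ⟩
    exact Subgroup.index_strictAnti hB
  by_cases hr : radical σ A ≤ Z
  · have hfi : Z.FiniteIndex := ⟨hZ⟩
    have : Finite (A ⧸ Z.subgroupOf A) := inferInstance
    have hcard := cast_relIndex_ne_zero (q := q) hσ hA hr
    obtain ⟨R, _, _, X, ρ, hρ⟩ := exists_crossed (L := L) hχ hσ
    classical
    have := Fintype.ofFinite (A ⧸ Z.subgroupOf A)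
    rw [Nat.card_eq_fintype_card] at hcard
    have hρu : ∀ g, ρ (X.u g) = σ g := by
      intro g
      rw [X.u_apply, hρ, of_apply, act_single, map_one, one_smul]
    let F : X.Frame A (A ⧸ Z.subgroupOf A) :=
      { t := fun i => i.out
        mem := fun i => i.out.2
        le := hZA.le
        exists_unique := by
          intro a ha
          refine ⟨(⟨a, ha⟩ : A), ?_, ?_⟩
          · have := QuotientGroup.eq.1 (QuotientGroup.out_eq' ((⟨a, ha⟩ : A) : A ⧸ Z.subgroupOf A))
            exact this
          · intro i hi
            rw [← QuotientGroup.out_eq' i]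
            exact QuotientGroup.eq.2 hi
        comm := hA
        nondeg := by
          intro a ha h
          refine hr (mem_radical.2 ⟨ha, fun b hb => ?_⟩)
          rw [← hρu, ← hρu, ← map_mul, h b hb, map_mul]
        card_ne_zero := hcard
        pow_mem := by
          intro a ha
          have h1 : ((⟨a, ha⟩ : A) : A ⧸ Z.subgroupOf A) ^ Fintype.card (A ⧸ Z.subgroupOf A) = 1 :=
            pow_card_eq_one
          rw [← QuotientGroup.mk_pow, QuotientGroup.eq_one_iff] at h1
          exact h1 }
    have hidx : F.coverKer.index ∣ A.index := by
      have : F.coverKer.index = A.relIndex _ := Subgroup.index_comap _ _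
      rw [this]
      exact Subgroup.relIndex_dvd_index_of_normal _ _
    obtain ⟨hlt1, hlt0⟩ := hlt A hZA
    have hker : F.coverKer.Normal := hAn.comap _
    obtain ⟨J, hJ⟩ := ih F.coverKer.index ((Nat.le_of_dvd (Nat.pos_of_ne_zero hlt0) hidx).trans_lt hlt1)
      F.coverKer F.coverChar ((ρ : R →* Module.End k V).comp F.coverUnit) (by
        intro p v
        change ρ (F.coverUnit p) v = _
        rw [F.coverUnit_eq p.2, ← AlgHom.commutes X.map, hρ, act_algebraMap]
        rfl) (fun h => hlt0 (Nat.eq_zero_of_zero_dvd (h ▸ hidx))) (by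
        rw [Crossed.Frame.coverKer, ← Subgroup.map_le_iff_le_comap]
        exact (map_derivedSeries_le_derivedSeries _ m).trans (hm.trans hZA.le)) rfl
    exact F.exists_isGood hρ hJ
  · obtain ⟨a₀, ha₀, ha₀Z⟩ := SetLike.not_le_iff_exists.1 hr
    set B := radical σ A
    have hZB : Z ≤ B := by
      intro z hz
      refine mem_radical.2 ⟨hZA.le hz, fun b _ => ?_⟩
      ext v
      rw [Module.End.mul_apply, Module.End.mul_apply, hσ ⟨z, hz⟩, hσ ⟨z, hz⟩, map_smul]
    have hZB' : Z < B := lt_of_le_of_ne hZB fun h => ha₀Z (h ▸ ha₀)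
    obtain ⟨ψ, v, hv0, hv⟩ := exists_char_of_commute (σ := σ) (A := B) fun a ha b hb =>
      (mem_radical.1 ha).2 b (mem_radical.1 hb).1
    have hψ : ∀ z : Z, ψ (Subgroup.inclusion hZB z) = χ z := fun z =>
      smul_left_injective k hv0 ((hv (Subgroup.inclusion hZB z)).symm.trans (hσ z v))
    obtain ⟨hlt1, hlt0⟩ := hlt B hZB'
    have : Nontrivial (weightSpace σ ψ) := ⟨⟨⟨v, hv⟩, 0, fun h => hv0 (congrArg Subtype.val h)⟩⟩
    have hidx : (B.subgroupOf (charStabilizer ψ)).index ∣ B.index :=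
      Subgroup.relIndex_dvd_index_of_normal _ _
    obtain ⟨J, hJ⟩ := ih _ ((Nat.le_of_dvd (Nat.pos_of_ne_zero hlt0) hidx).trans_lt hlt1)
      (B.subgroupOf (charStabilizer ψ)) (charOf (le_charStabilizer ψ) ψ) (weightRep σ ψ) (by
        intro a w
        exact Subtype.ext (w.2 ⟨a, a.2⟩)) (fun h => hlt0 (Nat.eq_zero_of_zero_dvd (h ▸ hidx))) (by
        rw [Subgroup.subgroupOf, ← Subgroup.map_le_iff_le_comap]
        exact (map_derivedSeries_le_derivedSeries _ m).trans (hm.trans hZB)) rfl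
    exact exists_isGood_of_stabilizer hχ hZB ψ hψ hJ

end Lifting

end

section

theorem Int.eq_zero_of_forall_pow_dvd_cast {O k : Type*} [CommRing O] [IsDomain O] [Field k]
    (q : ℕ) [Fact q.Prime] [CharP k q] (red : O →+* k) (hq : (q : O) ≠ 0) {n : ℤ}
    (h : ∀ m : ℕ, (q : O) ^ m ∣ (n : O)) : n = 0 := by
  by_contra hn
  have hq1 : (q : ℤ).natAbs ≠ 1 := by simpa using (Fact.out : q.Prime).ne_one
  obtain ⟨c, hnc, hc⟩ := (Int.finiteMultiplicity_iff.2 ⟨hq1, hn⟩).exists_eq_pow_mul_and_not_dvd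
  generalize multiplicity (q : ℤ) n = a at hnc
  obtain ⟨d, hd⟩ := h (a + 1)
  rw [hnc, Int.cast_mul, Int.cast_pow, Int.cast_natCast, pow_succ, mul_assoc] at hd
  have h1 := congrArg red (mul_left_cancel₀ (pow_ne_zero _ hq) hd)
  rw [map_intCast, map_mul, map_natCast, CharP.cast_eq_zero, zero_mul,
    CharP.intCast_eq_zero_iff k q] at h1
  exact hc h1

namespace WittVector
variable (q : ℕ) [Fact q.Prime] (k : Type*) [Field k] [CharP k q]

variable [IsAlgClosed k]

theorem exists_pow_eq {N : ℕ} (hN : (N : k) ≠ 0) {c : WittVector q k}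
    (hc : constantCoeff c ≠ 0) : ∃ s, s ^ N = c := by
  have hN0 : N ≠ 0 := by
    rintro rfl
    exact hN Nat.cast_zero
  obtain ⟨b, hb⟩ := IsAlgClosed.exists_pow_nat_eq (constantCoeff c) (Nat.pos_of_ne_zero hN0)
  have hb0 : b ≠ 0 := by
    rintro rfl
    rw [zero_pow hN0] at hb
    exact hc hb.symm
  have hred : constantCoeff (teichmuller q b) = b := teichmuller_coeff_zero q b
  obtain ⟨s, hs, -⟩ := HenselianRing.is_henselian (I := Ideal.span {(q : WittVector q k)})
    (Polynomial.X ^ N - Polynomial.C c) (Polynomial.monic_X_pow_sub_C c hN0) (teichmuller q b)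
    (by
      rw [← ker_constantCoeff, RingHom.mem_ker]
      simp only [Polynomial.eval_sub, Polynomial.eval_pow, Polynomial.eval_X, Polynomial.eval_C,
        map_sub, map_pow, hred, hb, sub_self])
    (by
      apply IsUnit.map
      apply isUnit_of_coeff_zero_ne_zero
      change constantCoeff _ ≠ 0
      simp only [Polynomial.derivative_sub, Polynomial.derivative_X_pow, Polynomial.derivative_C,
        Polynomial.eval_mul, sub_zero, Polynomial.eval_pow, Polynomial.eval_X,
        map_mul, map_pow, hred, Polynomial.eval_natCast, map_natCast]
      exact mul_ne_zero hN (pow_ne_zero _ hb0))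
  refine ⟨s, ?_⟩
  simpa [Polynomial.IsRoot, sub_eq_zero] using hs

/-- The Witt vectors of an algebraically closed field. -/
noncomputable def lifting : Lifting (WittVector q k) k where
  red := constantCoeff
  teich := teichmuller q
  unif := q
  red_teich := teichmuller_coeff_zero q
  unif_dvd c hc := Ideal.mem_span_singleton.1 ((mem_span_p_iff_coeff_zero_eq_zero c).2 hc)
  isUnit_of_red c hc := isUnit_of_coeff_zero_ne_zero c hc
  exists_root _ hN _ hc := exists_pow_eq q k hN hc

end WittVector

namespace Lifting
open MonoidAlgebra

variable {k H : Type*} [Field k] [Group H]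

/-- The linear forms that vanish on an ideal. -/
noncomputable def annihilator (k : Type*) [Field k] (T : Submodule ℤ (MonoidAlgebra ℤ H)) :
    Submodule k (MonoidAlgebra ℤ H →ₗ[ℤ] k) where
  carrier := {f | ∀ x ∈ T, f x = 0}
  zero_mem' := by simp
  add_mem' := by
    intro f g hf hg x hx
    rw [LinearMap.add_apply, hf x hx, hg x hx, add_zero]
  smul_mem' := by
    intro c f hf x hx
    rw [LinearMap.smul_apply, hf x hx, smul_zero]

/-- The contragredient of the right regular representation on the forms vanishing on an ideal. -/
noncomputable def annihilatorRep (k : Type*) [Field k] {T : Submodule ℤ (MonoidAlgebra ℤ H)} (hT : T.IsBi) :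
    H →* Module.End k (annihilator k T) where
  toFun g :=
    { toFun := fun f => ⟨f.1 ∘ₗ LinearMap.mulRight ℤ (of ℤ H g), fun x hx => f.2 _ (hT _ _ hx).2⟩
      map_add' := fun _ _ => rfl
      map_smul' := fun _ _ => rfl }
  map_one' := by
    ext f x
    simp
  map_mul' g h := by
    ext f x
    simp [mul_assoc]

theorem act_annihilatorRep {O : Type*} [CommRing O] (L : Lifting O k)
    {T : Submodule ℤ (MonoidAlgebra ℤ H)} (hT : T.IsBi) (y : MonoidAlgebra ℤ H)
    (f : annihilator k T) (x : MonoidAlgebra ℤ H) :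
    (L.act (annihilatorRep k hT) (mapRingHom H (Int.castRingHom O) y) f).1 x = f.1 (x * y) := by
  induction y using MonoidAlgebra.induction_linear with
  | zero => simp
  | add y z hy hz =>
    rw [map_add, map_add, mul_add, map_add, ← hy, ← hz]
    rfl
  | single g c =>
    have : (single g c : MonoidAlgebra ℤ H) = c • of ℤ H g := by simp
    rw [mapRingHom_single, act_single, eq_intCast, map_intCast, this, mul_smul_comm, map_zsmul,
      zsmul_eq_mul]
    rfl

end Lifting

open MonoidAlgebra in
/-- A descending chain of ideals in the integral group ring of a finite solvable group. -/
theorem IsDescent.eq_zero_of_intCast_mem {H : Type*} [Group H] [Finite H] [Group.IsSolvable H]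
    {T : ℕ → Submodule ℤ (MonoidAlgebra ℤ H)} (hT : IsDescent T) (h1 : 1 ∉ T 0) {n : ℤ}
    (hn : (n : MonoidAlgebra ℤ H) ∈ T 1) : n = 0 := by
  have htop : T 0 ≠ ⊤ := fun h => h1 (h ▸ Submodule.mem_top)
  obtain ⟨N, hN, hTN⟩ := (eq_top_or_exists_le_coatom (T 0)).resolve_left htop
  have : IsSimpleModule ℤ (MonoidAlgebra ℤ H ⧸ N) := isSimpleModule_iff_isCoatom.2 hN
  obtain ⟨I, hI, ⟨e⟩⟩ := isSimpleModule_iff_quot_maximal.1 this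
  let _ : Field (ℤ ⧸ I) := Ideal.Quotient.field I
  let k := AlgebraicClosure (ℤ ⧸ I)
  obtain ⟨q, hq⟩ := CharP.exists k
  have hq0 : q ≠ 0 := by
    rintro rfl
    have : CharZero k := CharP.charP_to_charZero k
    obtain ⟨m, hm⟩ := Ideal.Quotient.mk_surjective ((2 : ℤ ⧸ I)⁻¹)
    have h2 := congrArg (algebraMap (ℤ ⧸ I) k) hm
    rw [map_inv₀, map_ofNat, ← mul_eq_one_iff_eq_inv₀ two_ne_zero, ← RingHom.comp_apply,
      eq_intCast] at h2
    norm_cast at h2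
    omega
  have : Fact q.Prime := ⟨(CharP.char_is_prime_or_zero k q).resolve_right hq0⟩
  let L := WittVector.lifting q k
  let f : MonoidAlgebra ℤ H →ₗ[ℤ] k :=
    (algebraMap (ℤ ⧸ I) k).toIntAlgHom.toLinearMap ∘ₗ e.toLinearMap ∘ₗ N.mkQ
  have hf : f ∈ Lifting.annihilator k (T 0) := by
    intro x hx
    have : N.mkQ x = 0 := (Submodule.Quotient.mk_eq_zero N).2 (hTN hx)
    simp [f, this]
  have hf0 : f ≠ 0 := by
    intro h
    apply hN.1
    rw [eq_top_iff]
    intro x _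
    have h2 := LinearMap.congr_fun h x
    have h3 : algebraMap (ℤ ⧸ I) k (e (N.mkQ x)) = 0 := h2
    rw [map_eq_zero, map_eq_zero_iff e e.injective] at h3
    exact (Submodule.Quotient.mk_eq_zero N).1 h3
  have : Nontrivial (Lifting.annihilator k (T 0)) :=
    ⟨⟨⟨f, hf⟩, 0, fun h => hf0 (congrArg Subtype.val h)⟩⟩
  have : FiniteDimensional k (Lifting.annihilator k (T 0)) := inferInstance
  obtain ⟨m, hm⟩ := ‹Group.IsSolvable H›
  obtain ⟨J, hJ⟩ := Lifting.exists_isGood (q := q) L (⊥ : Subgroup H) 1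
    (Lifting.annihilatorRep k (hT.isBi 0)) (by
      intro z v
      rw [Subgroup.mem_bot.1 z.2]
      simp) Subgroup.index_ne_zero_of_finite hm.le
  let ι := mapRingHom H (Int.castRingHom (WittVector q k))
  have h0 : ∀ x ∈ T 0, ι x ∈ J 1 := by
    intro x hx
    refine hJ.ker _ (LinearMap.ext fun g => Subtype.ext (LinearMap.ext fun y => ?_))
    rw [Lifting.act_annihilatorRep, g.2 _ ((hT.isBi 0) _ _ hx).1]
    rfl
  have key : ∀ m : ℕ, ∀ x ∈ T 1, ι x ∈ J (m + 1) := by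
    intro m
    induction m with
    | zero =>
      intro x hx
      refine h0 x ((Submodule.mul_le.2 fun y hy z _ => ((hT.isBi 0) z y hy).2) (hT.le_mul 0 hx))
    | succ m ih =>
      intro x hx
      refine Submodule.mul_induction_on (hT.le_mul 0 hx) (fun y hy z hz => ?_) fun y z hy hz => ?_
      · rw [map_mul, add_comm]
        exact hJ.mul_mem (h0 y hy) (ih z hz)
      · rw [map_add]
        exact (J _).add_mem hy hz
  refine Int.eq_zero_of_forall_pow_dvd_cast q (WittVector.constantCoeff : WittVector q k →+* k)
    (WittVector.p_nonzero q k) fun m => (pow_dvd_pow _ m.le_succ).trans (hJ.dvd (n := m + 1) ?_)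
  rw [map_intCast, ← map_intCast ι]
  exact key m _ hn

end

section

universe u

theorem IsDescent.map {A R S : Type*} [CommRing A] [Ring R] [Ring S] [Algebra A R] [Algebra A S]
    {T : ℕ → Submodule A R} (hT : IsDescent T) {φ : R →ₐ[A] S} (hφ : Function.Surjective φ) :
    IsDescent fun n => (T n).map φ.toLinearMap where
  isBi := by
    rintro n r _ ⟨x, hx, rfl⟩
    obtain ⟨r, rfl⟩ := hφ r
    exact ⟨⟨r * x, (hT.isBi n r x hx).1, map_mul φ r x⟩,
      ⟨x * r, (hT.isBi n r x hx).2, map_mul φ x r⟩⟩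
  le_mul n := by
    rw [← Submodule.map_mul]
    exact Submodule.map_mono (hT.le_mul n)

theorem Submodule.IsBi.exists_separated_quotient {R : Type u} [Ring R] [Module.Finite ℤ R]
    {T : Submodule ℤ R} (hT : T.IsBi) (h : ∀ n : ℤ, (n : R) ∈ T → n = 0) :
    ∃ (Q : Type u) (_ : Ring Q) (_ : CharZero Q) (π : R →+* Q), (∀ x ∈ T, π x = 0) ∧
      ∀ ℓ : ℕ, ℓ.Prime → ∀ x : Q, (∀ n : ℕ, ∃ y, x = (ℓ : Q) ^ n * y) → x = 0 := by
  let I : TwoSidedIdeal R := .mk' {x | ∃ n : ℤ, n ≠ 0 ∧ n • x ∈ T}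
    ⟨1, one_ne_zero, by rw [smul_zero]; exact T.zero_mem⟩
    (by
      rintro x y ⟨n, hn, hx⟩ ⟨m, hm, hy⟩
      refine ⟨n * m, mul_ne_zero hn hm, ?_⟩
      rw [smul_add, mul_comm, mul_smul, mul_comm, mul_smul]
      exact T.add_mem (T.smul_mem _ hx) (T.smul_mem _ hy))
    (by
      rintro x ⟨n, hn, hx⟩
      exact ⟨n, hn, by rw [smul_neg]; exact T.neg_mem hx⟩)
    (by
      rintro r x ⟨n, hn, hx⟩
      exact ⟨n, hn, by rw [← mul_smul_comm]; exact (hT r _ hx).1⟩)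
    (by
      rintro x r ⟨n, hn, hx⟩
      exact ⟨n, hn, by rw [← smul_mul_assoc]; exact (hT r _ hx).2⟩)
  let Q := I.ringCon.Quotient
  let π : R →+* Q := I.ringCon.mk'
  have hsurj : Function.Surjective π := I.ringCon.mk'_surjective
  have hπ : ∀ x, π x = 0 ↔ ∃ n : ℤ, n ≠ 0 ∧ n • x ∈ T := by
    intro x
    rw [← TwoSidedIdeal.mem_ker, TwoSidedIdeal.ker_ringCon_mk', TwoSidedIdeal.mem_mk']
    rfl
  have hchar : CharZero Q := by
    refine charZero_of_inj_zero fun n hn => ?_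
    rw [← map_natCast π, hπ] at hn
    obtain ⟨m, hm, hmn⟩ := hn
    have h1 := h (m * n) (by simpa using hmn)
    exact_mod_cast (mul_eq_zero.1 h1).resolve_left hm
  have hfin : Module.Finite ℤ Q :=
    Module.Finite.of_surjective π.toAddMonoidHom.toIntLinearMap hsurj
  have htf : Module.IsTorsionFree ℤ Q := by
    refine ⟨fun r hr => ?_⟩
    rw [isSMulRegular_iff_right_eq_zero_of_smul]
    intro x hx
    obtain ⟨x, rfl⟩ := hsurj x
    rw [← map_zsmul, hπ] at hx
    obtain ⟨n, hn, hnx⟩ := hx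
    rw [hπ]
    exact ⟨n * r, mul_ne_zero hn hr.ne_zero, by rwa [mul_smul]⟩
  refine ⟨Q, inferInstance, hchar, π, fun x hx => (hπ x).2 ⟨1, one_ne_zero, by rwa [one_smul]⟩,
    fun ℓ hℓ x hx => ?_⟩
  have hI : Ideal.span {(ℓ : ℤ)} ≠ ⊤ := by
    rw [Ne, Ideal.span_singleton_eq_top, Int.isUnit_iff_natAbs_eq, Int.natAbs_natCast]
    exact hℓ.ne_one
  rw [← Submodule.mem_bot ℤ, ← Ideal.iInf_pow_smul_eq_bot_of_isTorsionFree _ hI, Submodule.mem_iInf]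
  intro n
  obtain ⟨y, rfl⟩ := hx n
  have : (ℓ : Q) ^ n * y = ((ℓ : ℤ) ^ n) • y := by simp [zsmul_eq_mul]
  rw [this]
  exact Submodule.smul_mem_smul (Ideal.pow_mem_pow (Ideal.mem_span_singleton_self _) n)
    Submodule.mem_top

theorem PolyZ.exists_eq_bot_of_isDescent_of_ne_top {G : Type*} [Group G] (hG : PolyZ G)
    {T : ℕ → Submodule ℤ (MonoidAlgebra ℤ G)} (hT : IsDescent T) (h0 : T 0 ≠ ⊤) :
    ∃ k, T k = ⊥ := by
  obtain ⟨K, _, _, hK⟩ := hG.exists_finite_quotient (hT.isBi 0) h0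
  have := hG.isSolvable
  have : Group.IsSolvable (G ⧸ K) := Group.isSolvable_of_surjective (QuotientGroup.mk'_surjective K)
  set φ := MonoidAlgebra.mapDomainAlgHom ℤ ℤ (QuotientGroup.mk' K)
  have hφ : Function.Surjective φ := by
    intro y
    induction y using MonoidAlgebra.induction_linear with
    | zero => exact ⟨0, map_zero φ⟩
    | add x y hx hy =>
      obtain ⟨x, rfl⟩ := hx
      obtain ⟨y, rfl⟩ := hy
      exact ⟨x + y, map_add φ x y⟩
    | single g n =>
      obtain ⟨g, rfl⟩ := QuotientGroup.mk'_surjective K g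
      exact ⟨.single g n, by simp [φ]⟩
  have hT' := hT.map hφ
  obtain ⟨Q, _, _, π, hπ, hQ⟩ := (hT'.isBi 1).exists_separated_quotient fun n hn =>
    hT'.eq_zero_of_intCast_mem hK hn
  obtain ⟨k, hk⟩ := hG.exists_eq_bot_of_isDescent hQ (π.comp φ.toRingHom) hT.shift
    fun x hx => hπ _ ⟨x, hx, rfl⟩
  exact ⟨k + 1, hk⟩

end

/-- **Proposition** (Linnell–Puninski–Smith).  Every non-finitely generated
projective module over the integral group ring of a polycyclic group is
free. -/
theorem free_of_projective_not_finite (G : Type*) [Group G]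
    (hG : IsPolycyclic G) (P : Type*) [AddCommGroup P]
    [Module (MonoidAlgebra ℤ G) P]
    (hproj : Module.Projective (MonoidAlgebra ℤ G) P)
    (hnfg : ¬ Module.Finite (MonoidAlgebra ℤ G) P) :
    Module.Free (MonoidAlgebra ℤ G) P := by
  have hG' := hG.polyZ
  have := hG'.isNoetherianRing (B := ℤ)
  have := hG'.isNoetherian_op (B := ℤ)
  exact Module.Free.of_isDescent ℤ
    (fun _ hT h0 => hG'.exists_eq_bot_of_isDescent_of_ne_top hT h0) hproj hnfg
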